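/- Let K ⊂ S² be a convex body of width w with π/2 < w < π. Then area(K) ≥ area(U°_{π−w}), where U°_{π−w} is the convex hull of three geodesic balls of radius w − π/2 whose centers form a regular spherical triangle of side length π − w. Equality holds if and only if K is congruent to U°_{π−w}. -/

import Mathlib

open scoped RealInnerProductSpace
open Real MeasureTheory

noncomputable section

namespace SphericalPal

/-- Ambient Euclidean space of the sphere `Sⁿ`. -/
abbrev E (n : ℕ) := EuclideanSpace ℝ (Fin (n + 1))

/-- The unit sphere `Sⁿ ⊂ ℝⁿ⁺¹`. -/
def unitSphere (n : ℕ) : Set (E n) := Metric.sphere 0 1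

variable {n : ℕ}

/-- Geodesic (angular) distance on the unit sphere. -/
def gdist (x y : E n) : ℝ := Real.arccos ⟪x, y⟫

/-- The geodesic segment joining `x` and `y` on the sphere. -/
def seg (x y : E n) : Set (E n) :=
  {z ∈ unitSphere n | gdist x z + gdist z y = gdist x y}

/-- A subset of the sphere is spherically convex if it lies on the sphere, is contained
in an open hemisphere and contains the geodesic segment joining any two of its points. -/
def SConvex (X : Set (E n)) : Prop :=
  X ⊆ unitSphere n ∧
  (∃ u ∈ unitSphere n, ∀ x ∈ X, 0 < ⟪u, x⟫) ∧
  ∀ x ∈ X, ∀ y ∈ X, seg x y ⊆ X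

/-- Spherical convex hull. -/
def sconv (X : Set (E n)) : Set (E n) := ⋂₀ {C | SConvex C ∧ X ⊆ C}

/-- Relative (spherical) interior of a subset of the sphere. -/
def sInterior (X : Set (E n)) : Set (E n) :=
  {x ∈ X | ∃ ε > 0, ∀ y ∈ unitSphere n, gdist x y < ε → y ∈ X}

/-- A spherical convex body: compact, spherically convex, with nonempty relative interior. -/
def IsConvexBody (K : Set (E n)) : Prop :=
  SConvex K ∧ IsCompact K ∧ (sInterior K).Nonempty

/-- The lune determined by `u` and `v` (intersection of the closed hemispheres
opposite to `u` and to `v`). -/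
def lune (u v : E n) : Set (E n) := {x ∈ unitSphere n | ⟪x, u⟫ ≤ 0 ∧ ⟪x, v⟫ ≤ 0}

/-- The bounding hemisphere of `lune u v` contained in the great sphere orthogonal to `u`. -/
def luneFace (u v : E n) : Set (E n) := {x ∈ unitSphere n | ⟪x, u⟫ = 0 ∧ ⟪x, v⟫ ≤ 0}

/-- The center (midpoint) of the bounding hemisphere `luneFace u v`. -/
def luneFaceCenter (u v : E n) : E n :=
  ‖(⟪u, v⟫ • u - v : E n)‖⁻¹ • (⟪u, v⟫ • u - v)

/-- The breadth of the lune `lune u v`: the geodesic distance of the centers of the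
two bounding hemispheres. -/
def breadth (u v : E n) : ℝ := gdist (luneFaceCenter u v) (luneFaceCenter v u)

/-- `lune u v` is a supporting lune of `K`. -/
def IsSupportingLune (K : Set (E n)) (u v : E n) : Prop :=
  u ∈ unitSphere n ∧ v ∈ unitSphere n ∧ u ≠ v ∧ u ≠ -v ∧
  K ⊆ lune u v ∧ (K ∩ luneFace u v).Nonempty ∧ (K ∩ luneFace v u).Nonempty

/-- The (minimal) width of a spherical convex body. -/
def width (K : Set (E n)) : ℝ :=
  sInf {b | ∃ u v : E n, IsSupportingLune K u v ∧ b = breadth u v}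

/-- The width of `K` with respect to the supporting great hypersphere orthogonal to `u`:
the minimal breadth among supporting lunes of `K` having one bounding hemisphere
contained in that great hypersphere. -/
def widthAt (K : Set (E n)) (u : E n) : ℝ :=
  sInf {b | ∃ v : E n, IsSupportingLune K u v ∧ b = breadth u v}

/-- The great hypersphere orthogonal to `u` supports `K`. -/
def IsSupportingSphere (K : Set (E n)) (u : E n) : Prop :=
  u ∈ unitSphere n ∧ (∀ x ∈ K, ⟪x, u⟫ ≤ 0) ∧ ∃ x ∈ K, ⟪x, u⟫ = 0

/-- `K` is of constant width `w`. -/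
def HasConstantWidth (K : Set (E n)) (w : ℝ) : Prop :=
  ∀ u : E n, IsSupportingSphere K u → widthAt K u = w

/-- `K` is a reduced convex body. -/
def IsReduced (K : Set (E n)) : Prop :=
  IsConvexBody K ∧ ∀ L : Set (E n), IsConvexBody L → L ⊆ K → L ≠ K → width L < width K

/-- The spherical polar set. -/
def polar (A : Set (E n)) : Set (E n) := {u ∈ unitSphere n | ∀ a ∈ A, ⟪a, u⟫ ≤ 0}

/-- Closed geodesic ball on the sphere. -/
def gball (p : E n) (r : ℝ) : Set (E n) := {x ∈ unitSphere n | gdist p x ≤ r}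

/-- The inradius of `K`: the largest `r` such that some geodesic ball of radius `r`
is contained in `K`. -/
def inradius (K : Set (E n)) : ℝ :=
  sSup {r | 0 ≤ r ∧ ∃ p ∈ unitSphere n, gball p r ⊆ K}

/-- Geodesic distance from a point to a set. -/
def sdist (x : E n) (A : Set (E n)) : ℝ := sInf (gdist x '' A)

/-- Hausdorff distance with respect to the geodesic metric. -/
def hausdorffG (A B : Set (E n)) : ℝ :=
  max (sSup ((fun x => sdist x B) '' A)) (sSup ((fun y => sdist y A) '' B))

/-- Two subsets of the sphere are congruent, i.e., isometric by an orthogonal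
transformation of the ambient Euclidean space. -/
def Congruent (A B : Set (E n)) : Prop :=
  ∃ f : E n ≃ₗᵢ[ℝ] E n, f '' A = B

/-- Spherical surface measure on `S²` (2-dimensional Hausdorff measure). -/
def area (X : Set (E 2)) : ℝ := (μH[2] X).toReal

/-- The spherical angle `∠(x, p, y)` at `p` between the geodesic segments `[p,x]`, `[p,y]`. -/
def sangle (x p y : E 2) : ℝ :=
  InnerProductGeometry.angle (x - ⟪p, x⟫ • p) (y - ⟪p, y⟫ • p)

/-- `T` is a regular spherical triangle: the spherical convex hull of three points
with equal pairwise geodesic distances, not lying on a common great circle. -/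
def IsRegularTriangle (T : Set (E 2)) : Prop :=
  ∃ v₁ v₂ v₃ : E 2, v₁ ∈ unitSphere 2 ∧ v₂ ∈ unitSphere 2 ∧ v₃ ∈ unitSphere 2 ∧
    LinearIndependent ℝ ![v₁, v₂, v₃] ∧
    gdist v₁ v₂ = gdist v₂ v₃ ∧ gdist v₂ v₃ = gdist v₁ v₃ ∧
    T = sconv {v₁, v₂, v₃}

/-- Three points on the sphere with equal pairwise geodesic distance `a`
(the vertices of a regular spherical triangle of side length `a`). -/
def IsRegularCenters (x₁ x₂ x₃ : E 2) (a : ℝ) : Prop :=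
  x₁ ∈ unitSphere 2 ∧ x₂ ∈ unitSphere 2 ∧ x₃ ∈ unitSphere 2 ∧
  gdist x₁ x₂ = a ∧ gdist x₂ x₃ = a ∧ gdist x₁ x₃ = a

/-- `U` is a spherical Reuleaux triangle: intersection of three geodesic balls of radius `r`
whose centers have pairwise geodesic distance `r`. -/
def IsReuleaux (U : Set (E 2)) (r : ℝ) : Prop :=
  ∃ x₁ x₂ x₃ : E 2, IsRegularCenters x₁ x₂ x₃ r ∧
    U = gball x₁ r ∩ gball x₂ r ∩ gball x₃ r

/-- The body `U°_{π-w}` for `w > π/2`: the spherical convex hull of three geodesic balls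
of radius `w - π/2` (whose centers are meant to form a regular triangle of side `π - w`). -/
def polarReuleaux (x₁ x₂ x₃ : E 2) (w : ℝ) : Set (E 2) :=
  sconv (gball x₁ (w - π / 2) ∪ gball x₂ (w - π / 2) ∪ gball x₃ (w - π / 2))

end SphericalPal

open SphericalPal

namespace SphericalPal

/-! ### Part 1: angles, cones, Moreau decomposition -/

lemma mem_us {n : ℕ} {x : E n} : x ∈ unitSphere n ↔ ‖x‖ = 1 := by
  simp [unitSphere]

lemma us_inner_self {x : E 2} (hx : ‖x‖ = 1) : ⟪x, x⟫ = 1 := by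
  rw [real_inner_self_eq_norm_sq, hx]; norm_num

lemma gdist_eq_angle {x y : E 2} (hx : ‖x‖ = 1) (hy : ‖y‖ = 1) :
    gdist x y = InnerProductGeometry.angle x y := by
  simp [gdist, InnerProductGeometry.angle, hx, hy]

lemma mem_nnspan {x y z : E 2} :
    z ∈ Submodule.span NNReal {x, y} ↔ ∃ a b : ℝ, 0 ≤ a ∧ 0 ≤ b ∧ a • x + b • y = z := by
  rw [Submodule.mem_span_pair]
  constructor
  · rintro ⟨a, b, h⟩
    exact ⟨a, b, a.2, b.2, h⟩
  · rintro ⟨a, b, ha, hb, h⟩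
    exact ⟨⟨a, ha⟩, ⟨b, hb⟩, h⟩

lemma seg_of_comb {x y z : E 2} (hx : ‖x‖ = 1) (hy : ‖y‖ = 1) (hz : ‖z‖ = 1) {a b : ℝ}
    (ha : 0 ≤ a) (hb : 0 ≤ b) (h : a • x + b • y = z) : z ∈ seg x y := by
  refine ⟨mem_us.2 hz, ?_⟩
  rw [gdist_eq_angle hx hz, gdist_eq_angle hz hy, gdist_eq_angle hx hy]
  have hz0 : z ≠ 0 := by intro h0; simp [h0] at hz
  exact (InnerProductGeometry.angle_eq_angle_add_add_angle_add_of_mem_span hz0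
    (mem_nnspan.2 ⟨a, b, ha, hb, h⟩)).symm

lemma comb_of_seg {x y z : E 2} (hx : ‖x‖ = 1) (hy : ‖y‖ = 1) (hxy : x ≠ -y)
    (h : z ∈ seg x y) : ∃ a b : ℝ, 0 ≤ a ∧ 0 ≤ b ∧ a • x + b • y = z := by
  obtain ⟨hz, h⟩ := h
  rw [mem_us] at hz
  rw [gdist_eq_angle hx hz, gdist_eq_angle hz hy, gdist_eq_angle hx hy] at h
  have hz0 : z ≠ 0 := by intro h0; simp [h0] at hz
  rcases (InnerProductGeometry.angle_eq_angle_add_angle_iff hz0).1 h.symm with h1 | h1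
  · exfalso
    have := InnerProductGeometry.inner_eq_neg_mul_norm_of_angle_eq_pi h1
    rw [hx, hy] at this
    apply hxy
    have h2 : ‖x + y‖ ^ 2 = 0 := by
      rw [norm_add_sq_real, hx, hy, this]; norm_num
    exact eq_neg_of_add_eq_zero_left (norm_eq_zero.1 (pow_eq_zero_iff (two_ne_zero) |>.1 h2))
  · exact mem_nnspan.1 h1

/-- closed convex cones -/
structure IsCC (C : Set (E 2)) : Prop where
  closed : IsClosed C
  zero : (0 : E 2) ∈ C
  smul : ∀ t : ℝ, 0 ≤ t → ∀ x ∈ C, t • x ∈ C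
  add : ∀ x ∈ C, ∀ y ∈ C, x + y ∈ C

lemma IsCC.moreau {C : Set (E 2)} (hC : IsCC C) (x : E 2) :
    ∃ p ∈ C, ⟪p, x - p⟫ = 0 ∧ ∀ z ∈ C, ⟪z, x - p⟫ ≤ 0 := by
  have hconv : Convex ℝ C := by
    intro a ha b hb s t hs ht _
    exact hC.add _ (hC.smul s hs a ha) _ (hC.smul t ht b hb)
  obtain ⟨p, hp, hmin⟩ := exists_norm_eq_iInf_of_complete_convex ⟨0, hC.zero⟩
    hC.closed.isComplete hconv x
  rw [norm_eq_iInf_iff_real_inner_le_zero hconv hp] at hmin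
  have h1 : ∀ z ∈ C, ⟪z, x - p⟫ ≤ 0 := by
    intro z hz
    have := hmin (p + z) (hC.add _ hp _ hz)
    rw [add_sub_cancel_left] at this
    rwa [real_inner_comm]
  refine ⟨p, hp, le_antisymm (h1 p hp) ?_, h1⟩
  have := hmin 0 hC.zero
  rw [zero_sub, inner_neg_right, real_inner_comm] at this
  linarith

/-- cone generated by a subset -/
def coneOf (K : Set (E 2)) : Set (E 2) := {x | ∃ t : ℝ, 0 ≤ t ∧ ∃ k ∈ K, x = t • k}

lemma coneOf_closed {K : Set (E 2)} (hK : IsCompact K) (hK0 : (0 : E 2) ∉ K) (hne : K.Nonempty) :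
    IsClosed (coneOf K) := by
  obtain ⟨m, hm, hmin⟩ := hK.exists_isMinOn hne continuous_norm.continuousOn
  have hm0 : 0 < ‖m‖ := norm_pos_iff.2 (fun h => hK0 (h ▸ hm))
  apply isClosed_of_closure_subset
  intro x hx
  obtain ⟨f, hf, hlim⟩ := mem_closure_iff_seq_limit.1 hx
  choose t ht k hk hfk using hf
  -- `t` is bounded
  obtain ⟨B, hB⟩ := hlim.norm.bddAbove_range
  have hbd : ∀ n, t n ∈ Set.Icc 0 (B / ‖m‖) := by
    intro n
    refine ⟨ht n, ?_⟩
    rw [le_div_iff₀ hm0]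
    have h1 : ‖f n‖ ≤ B := hB ⟨n, rfl⟩
    rw [hfk n, norm_smul, Real.norm_of_nonneg (ht n)] at h1
    have h2 : ‖m‖ ≤ ‖k n‖ := hmin (hk n)
    nlinarith [mul_le_mul_of_nonneg_left h2 (ht n)]
  have hcomp : IsCompact (Set.Icc 0 (B / ‖m‖) ×ˢ K) := isCompact_Icc.prod hK
  obtain ⟨⟨t0, k0⟩, h0, φ, hφ, hl⟩ := hcomp.tendsto_subseq
    (x := fun n => (t n, k n)) (fun n => ⟨hbd n, hk n⟩)
  have hl1 : Filter.Tendsto (fun n => t (φ n) • k (φ n)) Filter.atTop (nhds (t0 • k0)) :=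
    ((continuous_fst.tendsto _).comp hl).smul ((continuous_snd.tendsto _).comp hl)
  have hl2 : Filter.Tendsto (fun n => t (φ n) • k (φ n)) Filter.atTop (nhds x) := by
    have := hlim.comp hφ.tendsto_atTop
    refine this.congr (fun n => hfk _)
  exact ⟨t0, h0.1.1, k0, h0.2, tendsto_nhds_unique hl2 hl1⟩

lemma SConvex.coneOf_add {K : Set (E 2)} (hK : SConvex K) :
    ∀ x ∈ coneOf K, ∀ y ∈ coneOf K, x + y ∈ coneOf K := by
  obtain ⟨hs, ⟨u, hu, hpos⟩, hseg⟩ := hK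
  rintro _ ⟨a, ha, x, hx, rfl⟩ _ ⟨b, hb, y, hy, rfl⟩
  have hx1 := mem_us.1 (hs hx)
  have hy1 := mem_us.1 (hs hy)
  by_cases h0 : a • x + b • y = 0
  · rw [h0]; exact ⟨0, le_rfl, x, hx, by simp⟩
  · have hn : 0 < ‖a • x + b • y‖ := norm_pos_iff.2 h0
    refine ⟨‖a • x + b • y‖, hn.le, ‖a • x + b • y‖⁻¹ • (a • x + b • y), ?_, ?_⟩
    · apply hseg x hx y hy
      refine seg_of_comb hx1 hy1 ?_ (a := ‖a • x + b • y‖⁻¹ * a) (b := ‖a • x + b • y‖⁻¹ * b)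
        (by positivity) (by positivity) ?_
      · rw [norm_smul, norm_inv, norm_norm, inv_mul_cancel₀ hn.ne']
      · rw [smul_add, smul_smul, smul_smul]
    · rw [smul_smul, mul_inv_cancel₀ hn.ne', one_smul]

lemma SConvex.coneOf_isCC {K : Set (E 2)} (hK : SConvex K) (hc : IsCompact K)
    (hne : K.Nonempty) : IsCC (coneOf K) := by
  obtain ⟨k, hk⟩ := hne
  refine ⟨coneOf_closed hc ?_ ⟨k, hk⟩, ⟨0, le_rfl, k, hk, by simp⟩, ?_, hK.coneOf_add⟩
  · intro h; have := mem_us.1 (hK.1 h); simp at this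
  · rintro t ht _ ⟨s, hs, x, hx, rfl⟩
    exact ⟨t * s, by positivity, x, hx, by rw [smul_smul]⟩

lemma coneOf_unit {K : Set (E 2)} (hs : ∀ x ∈ K, ‖x‖ = 1) {y : E 2} (hy : ‖y‖ = 1)
    (h : y ∈ coneOf K) : y ∈ K := by
  obtain ⟨t, ht, x, hx, rfl⟩ := h
  rw [norm_smul, hs x hx, mul_one, Real.norm_of_nonneg ht] at hy
  rw [hy, one_smul]; exact hx

/-- bipolar theorem -/
lemma IsCC.bipolar {C : Set (E 2)} (hC : IsCC C) {y : E 2}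
    (h : ∀ u : E 2, (∀ a ∈ C, 0 ≤ ⟪a, u⟫) → 0 ≤ ⟪y, u⟫) : y ∈ C := by
  obtain ⟨p, hp, h0, hz⟩ := hC.moreau y
  have h1 := h (-(y - p)) (fun a ha => by rw [inner_neg_right]; linarith [hz a ha])
  have h2 : ⟪y, y - p⟫ = ‖y - p‖ ^ 2 := by
    have : y = p + (y - p) := by abel
    conv_lhs => rw [this]
    rw [inner_add_left, add_sub_cancel, h0, real_inner_self_eq_norm_sq, zero_add]
  rw [inner_neg_right, h2] at h1
  have h3 : ‖y - p‖ = 0 := by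
    have : ‖y - p‖ ^ 2 = 0 := le_antisymm (by linarith) (sq_nonneg _)
    simpa using this
  have : y = p := by rw [norm_eq_zero, sub_eq_zero] at h3; exact h3
  rwa [this]

end SphericalPal

namespace SphericalPal

/-! ### Part 2: spherical measure -/

lemma ennreal_div_mul_div {h g : ENNReal} (h0 : h ≠ 0) (g0 : g ≠ 0) (h1 : h ≠ ⊤) (g1 : g ≠ ⊤) :
    h / g * (g / h) = 1 := by
  rw [div_eq_mul_inv, div_eq_mul_inv, mul_assoc, ← mul_assoc g⁻¹, ENNReal.inv_mul_cancel g0 g1,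
    one_mul, ENNReal.mul_inv_cancel h0 h1]

/-- Christensen's uniqueness argument for uniformly distributed measures. -/
lemma christensen_ineq {X : Type*} [MetricSpace X] [MeasurableSpace X] [BorelSpace X]
    [SecondCountableTopology X]
    (μ ν : Measure X) [IsFiniteMeasure μ] [IsFiniteMeasure ν] (S : Set X)
    (hμS : μ Sᶜ = 0) (hνS : ν Sᶜ = 0) (h g : ℝ → ENNReal)
    (hμ : ∀ x ∈ S, ∀ r > 0, μ (Metric.ball x r) = h r)
    (hν : ∀ x ∈ S, ∀ r > 0, ν (Metric.ball x r) = g r)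
    (hh : ∀ r > 0, h r ≠ 0) (hg : ∀ r > 0, g r ≠ 0)
    (hh' : ∀ r > 0, h r ≠ ⊤) (hg' : ∀ r > 0, g r ≠ ⊤)
    (U W : Set X) (hU : IsOpen U) (hW : IsOpen W) :
    μ U * ν W ≤ ν U * μ W := by
  -- general facts for a pair of measures
  have key : ∀ (μ ν : Measure X) [IsFiniteMeasure μ] [IsFiniteMeasure ν] (h g : ℝ → ENNReal),
      μ Sᶜ = 0 → ν Sᶜ = 0 →
      (∀ x ∈ S, ∀ r > 0, μ (Metric.ball x r) = h r) →
      (∀ x ∈ S, ∀ r > 0, ν (Metric.ball x r) = g r) →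
      (∀ r > 0, g r ≠ 0) → (∀ r > 0, g r ≠ ⊤) → ∀ U : Set X, IsOpen U →
      ∃ a : ℕ → ENNReal, Filter.Tendsto a Filter.atTop (nhds (μ U)) ∧
        ∀ n, a n ≤ h (1 / ((n : ℝ) + 1)) / g (1 / ((n : ℝ) + 1)) * ν U := by
    clear hμS hνS hμ hν hh hg hh' hg' hU hW U W h g
    intro μ ν _ _ h g hμS hνS hμ hν hg hg' U hU
    have hrpos : ∀ n : ℕ, (0 : ℝ) < 1 / ((n : ℝ) + 1) := fun n => by positivity
    set r : ℕ → ℝ := fun n => 1 / ((n : ℝ) + 1) with hr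
    have hmeas : ∀ ρ : ℝ, MeasurableSet {p : X × X | p.1 ∈ U ∧ p.2 ∈ U ∧ dist p.2 p.1 < ρ} := by
      intro ρ
      apply IsOpen.measurableSet
      exact (hU.preimage continuous_fst).inter ((hU.preimage continuous_snd).inter
        (isOpen_lt (continuous_snd.dist continuous_fst) continuous_const))
    have hsec : ∀ ρ : ℝ, ∀ x : X, ν (Prod.mk x ⁻¹' {p : X × X | p.1 ∈ U ∧ p.2 ∈ U ∧ dist p.2 p.1 < ρ})
        = U.indicator (fun x => ν (U ∩ Metric.ball x ρ)) x := by
      intro ρ x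
      by_cases hx : x ∈ U
      · rw [Set.indicator_of_mem hx]; congr 1; ext y; simp [hx, Metric.mem_ball]
      · rw [Set.indicator_of_notMem hx]
        convert measure_empty (μ := ν)
        ext y; simp [hx]
    have hmf : ∀ n, Measurable (fun x => ν (Prod.mk x ⁻¹' {p : X × X | p.1 ∈ U ∧ p.2 ∈ U ∧ dist p.2 p.1 < r n})) :=
      fun n => measurable_measure_prodMk_left (hmeas _)
    refine ⟨fun n => ∫⁻ x, ν (Prod.mk x ⁻¹' {p : X × X | p.1 ∈ U ∧ p.2 ∈ U ∧ dist p.2 p.1 < r n})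
      / g (r n) ∂μ, ?_, ?_⟩
    · have h1 : μ U = ∫⁻ x, U.indicator 1 x ∂μ := by
        rw [lintegral_indicator_one hU.measurableSet]
      rw [h1]
      apply tendsto_lintegral_of_dominated_convergence (fun _ => 1)
      · intro n; exact (hmf n).div_const _
      · intro n
        have : ∀ᵐ x ∂μ, x ∈ S := by rw [ae_iff]; exact hμS
        filter_upwards [this] with x hx
        rw [hsec]
        apply ENNReal.div_le_of_le_mul
        rw [one_mul, ← hν x hx _ (hrpos n)]
        refine (Set.indicator_le_self' (fun _ _ => zero_le) x).trans ?_
        exact measure_mono Set.inter_subset_right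
      · simp
      · have : ∀ᵐ x ∂μ, x ∈ S := by rw [ae_iff]; exact hμS
        filter_upwards [this] with x hx
        by_cases hxU : x ∈ U
        · apply tendsto_const_nhds.congr'
          obtain ⟨ε, hε, hb⟩ := Metric.isOpen_iff.1 hU x hxU
          have hev : ∀ᶠ n in Filter.atTop, r n < ε :=
            (tendsto_one_div_add_atTop_nhds_zero_nat).eventually_lt_const hε
          filter_upwards [hev] with n hn
          rw [hsec, Set.indicator_of_mem hxU, Set.indicator_of_mem hxU,
            Set.inter_eq_self_of_subset_right ((Metric.ball_subset_ball hn.le).trans hb),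
            hν x hx _ (hrpos n), ENNReal.div_self (hg _ (hrpos n)) (hg' _ (hrpos n))]
          rfl
        · simp only [hsec, Set.indicator_of_notMem hxU]
          simp
    · intro n
      simp_rw [ENNReal.div_eq_inv_mul]
      rw [lintegral_const_mul _ (hmf n), ← Measure.prod_apply (hmeas _),
        Measure.prod_apply_symm (hmeas _), mul_assoc]
      gcongr
      calc ∫⁻ y, μ ((fun x => (x, y)) ⁻¹' {p : X × X | p.1 ∈ U ∧ p.2 ∈ U ∧ dist p.2 p.1 < r n}) ∂ν
          ≤ ∫⁻ y, U.indicator (fun _ => h (r n)) y ∂ν := by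
            apply lintegral_mono_ae
            have : ∀ᵐ x ∂ν, x ∈ S := by rw [ae_iff]; exact hνS
            filter_upwards [this] with y hy
            by_cases hyU : y ∈ U
            · rw [Set.indicator_of_mem hyU, ← hμ y hy _ (hrpos n)]
              apply measure_mono
              rintro x ⟨_, _, hd⟩
              rw [Metric.mem_ball, dist_comm]; exact hd
            · rw [Set.indicator_of_notMem hyU]
              apply le_of_eq
              convert measure_empty (μ := μ)
              ext x; simp [hyU]
        _ = h (r n) * ν U := by
            rw [lintegral_indicator hU.measurableSet, setLIntegral_const]
  obtain ⟨a, ha, ha'⟩ := key μ ν h g hμS hνS hμ hν hg hg' U hU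
  obtain ⟨b, hb, hb'⟩ := key ν μ g h hνS hμS hν hμ hh hh' W hW
  have hlim := ENNReal.Tendsto.mul ha (Or.inr (measure_ne_top ν W)) hb (Or.inr (measure_ne_top μ U))
  refine le_of_tendsto hlim (Filter.Eventually.of_forall (fun n => ?_))
  have hrpos : (0 : ℝ) < 1 / ((n : ℝ) + 1) := by positivity
  calc a n * b n ≤ (h (1 / ((n : ℝ) + 1)) / g (1 / ((n : ℝ) + 1)) * ν U) *
        (g (1 / ((n : ℝ) + 1)) / h (1 / ((n : ℝ) + 1)) * μ W) := mul_le_mul' (ha' n) (hb' n)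
    _ = (h (1 / ((n : ℝ) + 1)) / g (1 / ((n : ℝ) + 1)) *
        (g (1 / ((n : ℝ) + 1)) / h (1 / ((n : ℝ) + 1)))) * (ν U * μ W) := by ring
    _ = ν U * μ W := by
        have := hh _ hrpos
        have := hg _ hrpos
        have := hh' _ hrpos
        have := hg' _ hrpos
        rw [ennreal_div_mul_div, one_mul] <;> assumption

/-- radial projection -/
def nz (x : E 2) : E 2 := ‖x‖⁻¹ • x

lemma nz_meas : Measurable nz := by
  unfold nz; fun_prop

lemma nz_norm {x : E 2} (hx : x ≠ 0) : ‖nz x‖ = 1 := by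
  rw [nz, norm_smul, norm_inv, norm_norm, inv_mul_cancel₀ (norm_ne_zero_iff.2 hx)]

lemma norm_smul_nz (x : E 2) : ‖x‖ • nz x = x := by
  by_cases hx : x = 0
  · simp [hx, nz]
  · rw [nz, smul_smul, mul_inv_cancel₀ (norm_ne_zero_iff.2 hx), one_smul]

lemma nz_smul {t : ℝ} (ht : 0 < t) (x : E 2) : nz (t • x) = nz x := by
  rw [nz, nz, norm_smul, Real.norm_of_nonneg ht.le, smul_smul, mul_inv, mul_assoc, mul_comm ‖x‖⁻¹,
    ← mul_assoc, inv_mul_cancel₀ ht.ne', one_mul]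

lemma nz_of_unit {x : E 2} (hx : ‖x‖ = 1) : nz x = x := by simp [nz, hx]

lemma nz_isom (f : E 2 ≃ₗᵢ[ℝ] E 2) (x : E 2) : nz (f x) = f (nz x) := by
  simp [nz]

/-- punctured closed unit ball -/
def pball : Set (E 2) := {x | x ≠ 0 ∧ ‖x‖ ≤ 1}

lemma pball_meas : MeasurableSet pball := by
  have : pball = {0}ᶜ ∩ Metric.closedBall 0 1 := by
    ext x; simp [pball]
  rw [this]
  exact (measurableSet_singleton _).compl.inter measurableSet_closedBall

/-- cone volume measure on the sphere -/
def sm : Measure (E 2) := (volume.restrict pball).map nz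

lemma sm_apply {X : Set (E 2)} (hX : MeasurableSet X) : sm X = volume (nz ⁻¹' X ∩ pball) := by
  rw [sm, Measure.map_apply nz_meas hX, Measure.restrict_apply (nz_meas hX)]

instance : IsFiniteMeasure sm := by
  constructor
  rw [sm_apply MeasurableSet.univ]
  refine lt_of_le_of_lt (measure_mono (t := Metric.closedBall 0 1) ?_) measure_closedBall_lt_top
  rintro x ⟨-, hx⟩
  simpa using hx.2

lemma us_meas : MeasurableSet (unitSphere 2) := Metric.isClosed_sphere.measurableSet

lemma sm_compl : sm (unitSphere 2)ᶜ = 0 := by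
  rw [sm_apply us_meas.compl]
  convert measure_empty (μ := (volume : Measure (E 2)))
  ext x
  simp only [Set.mem_inter_iff, Set.mem_preimage, Set.mem_compl_iff, mem_us, pball,
    Set.mem_ofPred_eq, Set.mem_empty_iff_false, iff_false]
  rintro ⟨h1, h2, -⟩
  exact h1 (nz_norm h2)

lemma sm_isom (f : E 2 ≃ₗᵢ[ℝ] E 2) {X : Set (E 2)} (hX : MeasurableSet X) :
    sm (f ⁻¹' X) = sm X := by
  have hf : Measurable f := f.continuous.measurable
  rw [sm_apply hX, sm_apply (hf hX),
    ← (LinearIsometryEquiv.measurePreserving f).measure_preimage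
      ((nz_meas hX).inter pball_meas).nullMeasurableSet]
  congr 1
  ext x
  simp [pball, nz_isom]

lemma exists_isom {x y : E 2} (hx : ‖x‖ = 1) (hy : ‖y‖ = 1) : ∃ f : E 2 ≃ₗᵢ[ℝ] E 2, f x = y :=
  ⟨_, Submodule.reflection_sub (v := x) (w := y) (by rw [hx, hy])⟩

lemma sm_ball_eq {x y : E 2} (hx : ‖x‖ = 1) (hy : ‖y‖ = 1) (r : ℝ) :
    sm (Metric.ball x r) = sm (Metric.ball y r) := by
  obtain ⟨f, hf⟩ := exists_isom hx hy
  rw [← sm_isom f (X := Metric.ball y r) measurableSet_ball]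
  congr 1
  rw [← hf, LinearIsometryEquiv.preimage_ball, f.symm_apply_apply]

lemma nz_continuousAt {x : E 2} (hx : x ≠ 0) : ContinuousAt nz x := by
  unfold nz
  exact (continuousAt_id.norm.inv₀ (by simpa using hx)).smul continuousAt_id

lemma sm_open_pos {U : Set (E 2)} (hU : IsOpen U) {x : E 2} (hx : ‖x‖ = 1) (hxU : x ∈ U) :
    0 < sm U := by
  have hx0 : x ≠ 0 := by rintro rfl; simp at hx
  rw [sm_apply hU.measurableSet]
  have h1 : nz ⁻¹' U ∈ nhds ((1 / 2 : ℝ) • x) := by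
    apply (nz_continuousAt (by simpa using hx0)).preimage_mem_nhds
    rw [nz_smul (by norm_num), nz_of_unit hx]
    exact hU.mem_nhds hxU
  have h2 : pball ∈ nhds ((1 / 2 : ℝ) • x) := by
    have : {0}ᶜ ∩ Metric.ball (0 : E 2) 1 ⊆ pball := by
      rintro y ⟨h1, h2⟩
      exact ⟨by simpa using h1, by simpa using (Metric.mem_ball.1 h2).le⟩
    refine Filter.mem_of_superset ?_ this
    refine (isOpen_compl_singleton.inter Metric.isOpen_ball).mem_nhds ⟨by simpa using hx0, ?_⟩
    simp [norm_smul, hx]; norm_num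
  exact Measure.measure_pos_of_mem_nhds _ (Filter.inter_mem h1 h2)

/-! Hausdorff measure on the sphere -/

def sphParam (p : Fin 2 → ℝ) : E 2 :=
  !₂[cos (p 0) * cos (p 1), cos (p 0) * sin (p 1), sin (p 0)]

lemma sphParam_contDiff : ContDiff ℝ 1 sphParam := by
  unfold sphParam
  rw [contDiff_euclidean]
  intro i
  fin_cases i <;> simp <;> fun_prop

lemma sphParam_surj {x : E 2} (hx : ‖x‖ = 1) :
    ∃ p ∈ Metric.closedBall (0 : Fin 2 → ℝ) 4, sphParam p = x := by
  have hn : x 0 ^ 2 + x 1 ^ 2 + x 2 ^ 2 = 1 := by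
    have := EuclideanSpace.norm_sq_eq x
    rw [hx, Fin.sum_univ_three] at this
    simp only [Real.norm_eq_abs, sq_abs] at this
    linarith
  let z : ℂ := ⟨x 0, x 1⟩
  have hz : ‖z‖ = √(1 - x 2 ^ 2) := by
    rw [Complex.norm_def, Complex.normSq_apply]
    congr 1
    simp only [z]; linarith
  have h1 := Complex.norm_mul_cos_arg z
  have h2 := Complex.norm_mul_sin_arg z
  refine ⟨![arcsin (x 2), Complex.arg z], ?_, ?_⟩
  · rw [mem_closedBall_zero_iff, pi_norm_le_iff_of_nonneg (by norm_num)]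
    intro i
    have := Real.pi_lt_d2
    fin_cases i
    · simp only [Fin.zero_eta, Matrix.cons_val_zero, Real.norm_eq_abs]
      rw [abs_le]
      constructor <;> linarith [Real.neg_pi_div_two_le_arcsin (x 2), Real.arcsin_le_pi_div_two (x 2)]
    · simp only [Fin.mk_one, Matrix.cons_val_one, Matrix.cons_val_zero, Real.norm_eq_abs]
      linarith [Complex.abs_arg_le_pi z]
  · have hx2 : sin (arcsin (x 2)) = x 2 := Real.sin_arcsin (by nlinarith) (by nlinarith)
    ext i
    fin_cases i
    · simp [sphParam, Real.cos_arcsin, ← hz, h1]; rfl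
    · simp [sphParam, Real.cos_arcsin, ← hz, h2]; rfl
    · simp [sphParam, hx2]

lemma hm_sphere_lt_top : μH[2] (unitSphere 2) < ⊤ := by
  have hl : LocallyLipschitz sphParam := sphParam_contDiff.locallyLipschitz
  have hc : IsCompact (Metric.closedBall (0 : Fin 2 → ℝ) 4) := isCompact_closedBall _ _
  obtain ⟨K, hK⟩ := (hl.locallyLipschitzOn (s := Metric.closedBall (0 : Fin 2 → ℝ) 4)).exists_lipschitzOnWith_of_compact hc
  have h1 := hK.hausdorffMeasure_image_le (d := 2) (by norm_num)
  have h2 : unitSphere 2 ⊆ sphParam '' (Metric.closedBall (0 : Fin 2 → ℝ) 4) := by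
    intro x hx
    obtain ⟨p, hp, h⟩ := sphParam_surj (mem_us.1 hx)
    exact ⟨p, hp, h⟩
  refine (measure_mono h2).trans_lt (h1.trans_lt ?_)
  have h3 : (μH[2] : Measure (Fin 2 → ℝ)) = volume := by
    have := @hausdorffMeasure_pi_real (Fin 2) _
    simpa using this
  rw [h3]
  exact ENNReal.mul_lt_top (by simp) hc.measure_lt_top

lemma hm_sphere_pos : 0 < μH[2] (unitSphere 2) := by
  let f : E 2 → (Fin 2 → ℝ) := fun x => ![x 0, x 1]
  have hf : LipschitzWith 1 f := by
    apply LipschitzWith.of_dist_le_mul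
    intro x y
    rw [NNReal.coe_one, one_mul, dist_pi_le_iff dist_nonneg]
    intro i
    have : ∀ j : Fin 3, dist (x j) (y j) ≤ dist x y := by
      intro j
      rw [dist_eq_norm, dist_eq_norm]
      exact PiLp.norm_apply_le (x - y) j
    fin_cases i
    · exact this 0
    · exact this 1
  have h1 := hf.hausdorffMeasure_image_le (d := 2) (by norm_num) (unitSphere 2)
  have h3 : (μH[2] : Measure (Fin 2 → ℝ)) = volume := by
    have := @hausdorffMeasure_pi_real (Fin 2) _
    simpa using this
  rw [h3] at h1
  have h4 : Metric.ball (0 : Fin 2 → ℝ) (1 / 2) ⊆ f '' (unitSphere 2) := by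
    intro p hp
    rw [mem_ball_zero_iff, pi_norm_lt_iff (by norm_num)] at hp
    have p0 := abs_lt.1 (hp 0)
    have p1 := abs_lt.1 (hp 1)
    refine ⟨!₂[p 0, p 1, √(1 - p 0 ^ 2 - p 1 ^ 2)], ?_, ?_⟩
    · rw [mem_us]
      have : ‖(!₂[p 0, p 1, √(1 - p 0 ^ 2 - p 1 ^ 2)] : E 2)‖ ^ 2 = 1 := by
        rw [EuclideanSpace.norm_sq_eq, Fin.sum_univ_three]
        simp only [Real.norm_eq_abs, sq_abs]
        simp
        rw [Real.sq_sqrt (by nlinarith)]; ring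
      nlinarith [norm_nonneg (!₂[p 0, p 1, √(1 - p 0 ^ 2 - p 1 ^ 2)] : E 2)]
    · ext i; fin_cases i <;> simp [f]
  have h5 : 0 < volume (Metric.ball (0 : Fin 2 → ℝ) (1 / 2)) := Metric.measure_ball_pos _ _ (by norm_num)
  have h6 := h5.trans_le ((measure_mono h4).trans h1)
  simpa using h6

lemma hm_isom (f : E 2 ≃ₗᵢ[ℝ] E 2) (X : Set (E 2)) : μH[2] (f '' X) = μH[2] X :=
  f.isometry.hausdorffMeasure_image (Or.inl (by norm_num)) _

/-- the surface measure -/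
def hm : Measure (E 2) := (μH[2] : Measure (E 2)).restrict (unitSphere 2)

instance : IsFiniteMeasure hm := ⟨by rw [hm, Measure.restrict_apply_univ]; exact hm_sphere_lt_top⟩

lemma hm_ball_eq {x y : E 2} (hx : ‖x‖ = 1) (hy : ‖y‖ = 1) (r : ℝ) :
    hm (Metric.ball x r) = hm (Metric.ball y r) := by
  obtain ⟨f, hf⟩ := exists_isom hx hy
  rw [hm, Measure.restrict_apply measurableSet_ball, Measure.restrict_apply measurableSet_ball,
    ← hm_isom f, Set.image_inter f.injective, LinearIsometryEquiv.image_ball, hf]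
  congr 2
  rw [unitSphere, LinearIsometryEquiv.image_sphere, map_zero]

lemma hm_ball_pos {x : E 2} (hx : ‖x‖ = 1) {r : ℝ} (hr : 0 < r) : hm (Metric.ball x r) ≠ 0 := by
  intro h0
  have : hm (unitSphere 2) = 0 := by
    have hc : IsCompact (unitSphere 2) := isCompact_sphere _ _
    apply hc.measure_zero_of_nhdsWithin
    intro y hy
    refine ⟨Metric.ball y r, mem_nhdsWithin_of_mem_nhds (Metric.ball_mem_nhds _ hr), ?_⟩
    rw [hm_ball_eq (mem_us.1 hy) hx, h0]
  rw [hm, Measure.restrict_apply us_meas, Set.inter_self] at this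
  exact hm_sphere_pos.ne' this

lemma exists_kappa : ∃ κ : ℝ, 0 < κ ∧ ∀ X : Set (E 2), MeasurableSet X → X ⊆ unitSphere 2 →
    area X = κ * (sm X).toReal := by
  let e : E 2 := EuclideanSpace.single 0 1
  have he : ‖e‖ = 1 := by simp [e]
  have hS : hm (unitSphere 2)ᶜ = 0 := by
    rw [hm, Measure.restrict_apply us_meas.compl]; simp
  have main : ∀ U : Set (E 2), IsOpen U → hm U * sm Set.univ = sm U * hm Set.univ := by
    intro U hU
    apply le_antisymm
    · exact christensen_ineq hm sm (unitSphere 2) hS sm_compl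
        (fun r => hm (Metric.ball e r)) (fun r => sm (Metric.ball e r))
        (fun x hx r _ => hm_ball_eq (mem_us.1 hx) he r)
        (fun x hx r _ => sm_ball_eq (mem_us.1 hx) he r)
        (fun r hr => hm_ball_pos he hr)
        (fun r hr => (sm_open_pos Metric.isOpen_ball he (Metric.mem_ball_self hr)).ne')
        (fun r _ => measure_ne_top _ _) (fun r _ => measure_ne_top _ _) U Set.univ hU isOpen_univ
    · exact christensen_ineq sm hm (unitSphere 2) sm_compl hS
        (fun r => sm (Metric.ball e r)) (fun r => hm (Metric.ball e r))
        (fun x hx r _ => sm_ball_eq (mem_us.1 hx) he r)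
        (fun x hx r _ => hm_ball_eq (mem_us.1 hx) he r)
        (fun r hr => (sm_open_pos Metric.isOpen_ball he (Metric.mem_ball_self hr)).ne')
        (fun r hr => hm_ball_pos he hr)
        (fun r _ => measure_ne_top _ _) (fun r _ => measure_ne_top _ _) U Set.univ hU isOpen_univ
  have hsp : 0 < sm Set.univ := sm_open_pos isOpen_univ he (Set.mem_univ _)
  have hhp : 0 < hm Set.univ :=
    (pos_iff_ne_zero.2 (hm_ball_pos he one_pos)).trans_le (measure_mono (Set.subset_univ _))
  have hmeas : (sm Set.univ) • hm = (hm Set.univ) • sm := by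
    have : IsFiniteMeasure ((sm Set.univ) • hm) :=
      Measure.smul_finite _ (measure_ne_top _ _)
    apply ext_of_generate_finite _ (BorelSpace.measurable_eq (α := E 2)) isPiSystem_isOpen
    · intro U hU
      simp only [Measure.smul_apply, smul_eq_mul]
      rw [mul_comm, main U hU, mul_comm]
    · simp only [Measure.smul_apply, smul_eq_mul]; rw [mul_comm]
  refine ⟨(hm Set.univ).toReal / (sm Set.univ).toReal, ?_, ?_⟩
  · exact div_pos (ENNReal.toReal_pos hhp.ne' (measure_ne_top _ _))
      (ENNReal.toReal_pos hsp.ne' (measure_ne_top _ _))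
  · intro X hX hXs
    have h1 : hm X = μH[2] X := by
      rw [hm, Measure.restrict_apply hX, Set.inter_eq_self_of_subset_left hXs]
    have h2 := congrArg (fun m : Measure (E 2) => (m X).toReal) hmeas
    simp only [Measure.smul_apply, smul_eq_mul, ENNReal.toReal_mul] at h2
    rw [area, ← h1]
    have h3 : 0 < (sm Set.univ).toReal := ENNReal.toReal_pos hsp.ne' (measure_ne_top _ _)
    field_simp
    linarith

end SphericalPal

namespace SphericalPal

/-! ### Part 3: Steiner formula for cones -/

/-- derivative from two-sided increment estimates -/
lemma squeeze_deriv {F V k : ℝ → ℝ} {I : Set ℝ} {s V' : ℝ} (hI : I ∈ nhds s)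
    (h : ∀ y ∈ I, F y - F s ∈ Set.uIcc (k s * (V y - V s)) (k y * (V y - V s)))
    (hk : ContinuousAt k s) (hV : HasDerivAt V V' s) : HasDerivAt F (k s * V') s := by
  rw [hasDerivAt_iff_tendsto_slope] at hV ⊢
  have h1 : Filter.Tendsto (fun y => k s * slope V s y) (nhdsWithin s {s}ᶜ) (nhds (k s * V')) :=
    hV.const_mul _
  have h2 : Filter.Tendsto (fun y => |(k y - k s) * slope V s y|) (nhdsWithin s {s}ᶜ) (nhds 0) := by
    have hk' : Filter.Tendsto (fun y => k y - k s) (nhdsWithin s {s}ᶜ) (nhds 0) := by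
      have := (hk.tendsto.mono_left (nhdsWithin_le_nhds (s := {s}ᶜ))).sub_const (k s)
      simpa using this
    have := (hk'.mul hV).abs
    simpa using this
  have h3 : Filter.Tendsto (fun y => slope F s y - k s * slope V s y) (nhdsWithin s {s}ᶜ) (nhds 0) := by
    apply squeeze_zero_norm' _ h2
    filter_upwards [mem_nhdsWithin_of_mem_nhds hI] with y hy
    have := Set.abs_sub_left_of_mem_uIcc (h y hy)
    rw [Real.norm_eq_abs, slope_def_field, slope_def_field]
    rw [show (F y - F s) / (y - s) - k s * ((V y - V s) / (y - s)) =
      (F y - F s - k s * (V y - V s)) / (y - s) by ring, abs_div,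
      show (k y - k s) * ((V y - V s) / (y - s)) = (k y * (V y - V s) - k s * (V y - V s)) / (y - s) by ring,
      abs_div]
    gcongr
  have := h3.add h1
  simpa using this

variable {C : Set (E 2)}

/-- projection onto a closed convex cone -/
def IsCC.pr (hC : IsCC C) (x : E 2) : E 2 := (hC.moreau x).choose

lemma IsCC.pr_mem (hC : IsCC C) (x : E 2) : hC.pr x ∈ C := (hC.moreau x).choose_spec.1
lemma IsCC.pr_orth (hC : IsCC C) (x : E 2) : ⟪hC.pr x, x - hC.pr x⟫ = 0 :=
  (hC.moreau x).choose_spec.2.1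
lemma IsCC.pr_le (hC : IsCC C) (x : E 2) : ∀ z ∈ C, ⟪z, x - hC.pr x⟫ ≤ 0 :=
  (hC.moreau x).choose_spec.2.2

/-- firm nonexpansiveness -/
lemma IsCC.pr_firm (hC : IsCC C) (x y : E 2) :
    ‖hC.pr x - hC.pr y‖ ^ 2 ≤ ⟪hC.pr x - hC.pr y, x - y⟫ := by
  have h1 := hC.pr_orth x
  have h2 := hC.pr_orth y
  have h3 := hC.pr_le x _ (hC.pr_mem y)
  have h4 := hC.pr_le y _ (hC.pr_mem x)
  rw [← real_inner_self_eq_norm_sq]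
  simp only [inner_sub_left, inner_sub_right] at *
  linarith

lemma IsCC.pr_uniq (hC : IsCC C) {p q : E 2} (hp : p ∈ C) (h0 : ⟪p, q⟫ = 0)
    (hq : ∀ z ∈ C, ⟪z, q⟫ ≤ 0) : hC.pr (p + q) = p := by
  have h1 := hC.pr_orth (p + q)
  have h2 := hC.pr_le (p + q) p hp
  have h3 := hq _ (hC.pr_mem (p + q))
  have h4 : ‖hC.pr (p + q) - p‖ ^ 2 ≤ 0 := by
    rw [← real_inner_self_eq_norm_sq]
    set P := hC.pr (p + q)
    have e1 := real_inner_comm P p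
    have e2 := real_inner_comm P q
    have e3 := real_inner_comm p q
    simp only [inner_sub_left, inner_sub_right, inner_add_right] at *
    linarith
  have h5 : hC.pr (p + q) - p = 0 := by
    rw [← norm_eq_zero]; nlinarith [norm_nonneg (hC.pr (p + q) - p)]
  exact sub_eq_zero.1 h5

lemma IsCC.pr_of_mem (hC : IsCC C) {p : E 2} (hp : p ∈ C) : hC.pr p = p := by
  have := hC.pr_uniq hp (q := 0) (by simp) (by simp)
  simpa using this

lemma IsCC.pr_norm_sub (hC : IsCC C) (x y : E 2) : ‖hC.pr x - hC.pr y‖ ≤ ‖x - y‖ := by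
  have h1 := hC.pr_firm x y
  have h2 := real_inner_le_norm (hC.pr x - hC.pr y) (x - y)
  by_contra! h
  have := norm_nonneg (x - y)
  nlinarith

lemma IsCC.pr_lip (hC : IsCC C) : LipschitzWith 1 hC.pr :=
  LipschitzWith.of_dist_le_mul fun x y => by
    rw [dist_eq_norm, dist_eq_norm, NNReal.coe_one, one_mul]; exact hC.pr_norm_sub x y

lemma IsCC.pr_cont (hC : IsCC C) : Continuous hC.pr := hC.pr_lip.continuous

/-- residual -/
def IsCC.rs (hC : IsCC C) (x : E 2) : E 2 := x - hC.pr x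

lemma IsCC.pr_add_rs (hC : IsCC C) (x : E 2) : hC.pr x + hC.rs x = x := by simp [IsCC.rs]

lemma IsCC.norm_sq (hC : IsCC C) (x : E 2) : ‖x‖ ^ 2 = ‖hC.pr x‖ ^ 2 + ‖hC.rs x‖ ^ 2 := by
  conv_lhs => rw [← hC.pr_add_rs x]
  rw [norm_add_sq_real]
  have : ⟪hC.pr x, hC.rs x⟫ = 0 := hC.pr_orth x
  rw [this]; ring

lemma IsCC.pr_comb (hC : IsCC C) (x : E 2) {a b : ℝ} (ha : 0 ≤ a) (hb : 0 ≤ b) :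
    hC.pr (a • hC.pr x + b • hC.rs x) = a • hC.pr x := by
  apply hC.pr_uniq (hC.smul a ha _ (hC.pr_mem x))
  · rw [inner_smul_left, inner_smul_right, IsCC.rs, hC.pr_orth]; simp
  · intro z hz
    rw [inner_smul_right]
    exact mul_nonpos_of_nonneg_of_nonpos hb (hC.pr_le x z hz)

lemma IsCC.pr_smul (hC : IsCC C) (x : E 2) {a : ℝ} (ha : 0 ≤ a) :
    hC.pr (a • x) = a • hC.pr x := by
  have := hC.pr_comb x ha ha
  rwa [← smul_add, hC.pr_add_rs] at this

lemma IsCC.rs_smul (hC : IsCC C) (x : E 2) {a : ℝ} (ha : 0 ≤ a) :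
    hC.rs (a • x) = a • hC.rs x := by
  rw [IsCC.rs, hC.pr_smul x ha, ← smul_sub, IsCC.rs]

/-- the stretching maps -/
def IsCC.T (hC : IsCC C) (s : ℝ) (x : E 2) : E 2 := s • x + (1 - s) • hC.pr x

lemma IsCC.T_eq (hC : IsCC C) (s : ℝ) (x : E 2) : hC.T s x = (1 : ℝ) • hC.pr x + s • hC.rs x := by
  rw [IsCC.T, IsCC.rs]; module

lemma IsCC.pr_T (hC : IsCC C) {s : ℝ} (hs : 0 ≤ s) (x : E 2) : hC.pr (hC.T s x) = hC.pr x := by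
  rw [hC.T_eq, hC.pr_comb x zero_le_one hs, one_smul]

lemma IsCC.rs_T (hC : IsCC C) {s : ℝ} (hs : 0 ≤ s) (x : E 2) : hC.rs (hC.T s x) = s • hC.rs x := by
  rw [IsCC.rs, hC.pr_T hs, hC.T_eq]; module

lemma IsCC.T_T (hC : IsCC C) {s t : ℝ} (hs : 0 ≤ s) (hst : t * s = 1) (x : E 2) :
    hC.T t (hC.T s x) = x := by
  rw [hC.T_eq t, hC.pr_T hs, hC.rs_T hs, smul_smul, hst, one_smul, one_smul, hC.pr_add_rs]

lemma det_poly (M : E 2 →L[ℝ] E 2) (s : ℝ) (hM : (ContinuousLinearMap.id ℝ (E 2) - M).det = 0) :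
    (s • ContinuousLinearMap.id ℝ (E 2) + (1 - s) • M).det =
      ((1 : ℝ) • ContinuousLinearMap.id ℝ (E 2) + (1 - (1 : ℝ)) • M).det * ((s - 2) * (s - 3) / 2) -
      ((2 : ℝ) • ContinuousLinearMap.id ℝ (E 2) + (1 - (2 : ℝ)) • M).det * ((s - 1) * (s - 3)) +
      ((3 : ℝ) • ContinuousLinearMap.id ℝ (E 2) + (1 - (3 : ℝ)) • M).det * ((s - 1) * (s - 2) / 2) := by
  let b := (EuclideanSpace.basisFun (Fin 3) ℝ).toBasis
  let A := LinearMap.toMatrix b b M.toLinearMap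
  have h1 : ∀ s : ℝ, (s • ContinuousLinearMap.id ℝ (E 2) + (1 - s) • M).det =
      (s • (1 : Matrix (Fin 3) (Fin 3) ℝ) + (1 - s) • A).det := by
    intro s
    rw [ContinuousLinearMap.det, ← LinearMap.det_toMatrix b]
    congr 1
    simp [A]
  have h2 : (ContinuousLinearMap.id ℝ (E 2) - M).det = (1 - A).det := by
    rw [ContinuousLinearMap.det, ← LinearMap.det_toMatrix b]
    congr 1
    simp [A]
  rw [h2] at hM
  rw [← sub_eq_zero, ← mul_zero ((s - 1) * (s - 2) * (s - 3)), ← hM]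
  simp only [h1, Matrix.det_fin_three, Matrix.add_apply, Matrix.smul_apply, Matrix.sub_apply,
    Matrix.one_apply, smul_eq_mul]
  simp only [Fin.isValue, ↓reduceIte, zero_ne_one, one_ne_zero, Fin.reduceEq]
  ring

lemma IsCC.fderiv_pr_pr (hC : IsCC C) {x : E 2} (hd : DifferentiableAt ℝ hC.pr x) :
    fderiv ℝ hC.pr x (hC.pr x) = hC.pr x := by
  have h1 : HasDerivAt (fun t : ℝ => x + t • hC.pr x) (hC.pr x) 0 := by
    have := ((hasDerivAt_id (0 : ℝ)).smul_const (hC.pr x)).const_add x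
    simpa using this
  have h2 : HasDerivAt (fun t : ℝ => hC.pr (x + t • hC.pr x)) (fderiv ℝ hC.pr x (hC.pr x)) 0 := by
    have h3 : HasFDerivAt hC.pr (fderiv ℝ hC.pr x) (x + (0 : ℝ) • hC.pr x) := by
      simpa using hd.hasFDerivAt
    exact h3.comp_hasDerivAt 0 h1
  have h4 : HasDerivAt (fun t : ℝ => (1 + t) • hC.pr x) (hC.pr x) 0 := by
    have := ((hasDerivAt_id (0 : ℝ)).const_add 1).smul_const (hC.pr x)
    simpa using this
  refine h2.unique (h4.congr_of_eventuallyEq ?_)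
  filter_upwards [lt_mem_nhds (show (-1 : ℝ) < 0 by norm_num)] with t ht
  have := hC.pr_comb x (a := 1 + t) (b := 1) (by linarith) zero_le_one
  rw [← this]
  congr 1
  conv_lhs => rw [← hC.pr_add_rs x]
  rw [hC.pr_add_rs]
  rw [IsCC.rs]
  module

lemma IsCC.fderiv_firm (hC : IsCC C) {x : E 2} (hd : DifferentiableAt ℝ hC.pr x) (v : E 2) :
    ‖fderiv ℝ hC.pr x v‖ ^ 2 ≤ ⟪fderiv ℝ hC.pr x v, v⟫ := by
  have h1 : HasDerivAt (fun t : ℝ => x + t • v) v 0 := by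
    have := ((hasDerivAt_id (0 : ℝ)).smul_const v).const_add x
    simpa using this
  have h2 : HasDerivAt (fun t : ℝ => hC.pr (x + t • v)) (fderiv ℝ hC.pr x v) 0 := by
    have h3 : HasFDerivAt hC.pr (fderiv ℝ hC.pr x) (x + (0 : ℝ) • v) := by
      simpa using hd.hasFDerivAt
    exact h3.comp_hasDerivAt 0 h1
  rw [hasDerivAt_iff_tendsto_slope] at h2
  refine le_of_tendsto_of_tendsto (h2.norm.pow 2) (h2.inner tendsto_const_nhds) ?_
  filter_upwards [self_mem_nhdsWithin] with t ht
  have ht : t ≠ 0 := ht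
  rw [slope_def_module, norm_smul, inner_smul_left, mul_pow]
  have := hC.pr_firm (x + t • v) x
  rw [add_sub_cancel_left, inner_smul_right] at this
  simp only [zero_smul, add_zero, sub_zero, norm_inv, Real.norm_eq_abs, inv_pow, sq_abs]
  simp only [conj_trivial]
  have ht2 : 0 < t ^ 2 := by positivity
  calc (t ^ 2)⁻¹ * ‖hC.pr (x + t • v) - hC.pr x‖ ^ 2
      ≤ (t ^ 2)⁻¹ * (t * ⟪hC.pr (x + t • v) - hC.pr x, v⟫) := by gcongr
    _ = _ := by field_simp

/-- the Jacobian determinant is positive -/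
lemma det_pos {M : E 2 →L[ℝ] E 2} (hM : ∀ v, ‖M v‖ ^ 2 ≤ ⟪M v, v⟫) {s : ℝ} (hs : 0 < s) :
    0 < (s • ContinuousLinearMap.id ℝ (E 2) + (1 - s) • M).det := by
  have hne : ∀ s : ℝ, 0 < s → (s • ContinuousLinearMap.id ℝ (E 2) + (1 - s) • M).det ≠ 0 := by
    intro s hs h0
    have h1 : ((s • ContinuousLinearMap.id ℝ (E 2) + (1 - s) • M : E 2 →L[ℝ] E 2) : E 2 →ₗ[ℝ] E 2).det = 0 := h0
    have h2 := LinearMap.bot_lt_ker_of_det_eq_zero h1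
    obtain ⟨v, hv, hv0⟩ := (Submodule.ne_bot_iff _).1 h2.ne'
    have h3 : s • v + (1 - s) • M v = 0 := by simpa using hv
    have h4 : s * ‖v‖ ^ 2 + (1 - s) * ⟪M v, v⟫ = 0 := by
      have := congrArg (fun z => ⟪z, v⟫) h3
      simpa [inner_add_left, inner_smul_left] using this
    have h5 := hM v
    have h6 := real_inner_le_norm (M v) v
    have h7 : 0 < ‖v‖ := norm_pos_iff.2 hv0
    have h8 := norm_nonneg (M v)
    have h9 : ‖M v‖ ≤ ‖v‖ := by by_contra! h; nlinarith
    have h10 : ⟪M v, v⟫ ≤ ‖v‖ ^ 2 := by nlinarith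
    have h11 : 0 ≤ ⟪M v, v⟫ := by nlinarith
    rcases le_total s 1 with h | h
    · nlinarith [mul_nonneg (sub_nonneg.2 h) h11, mul_pos hs (pow_pos h7 2)]
    · nlinarith [pow_pos h7 2]
  have hcont : Continuous fun s : ℝ => (s • ContinuousLinearMap.id ℝ (E 2) + (1 - s) • M).det := by
    apply ContinuousLinearMap.continuous_det.comp
    fun_prop
  by_contra! hneg
  have h1 : (0 : ℝ) < ((1 : ℝ) • ContinuousLinearMap.id ℝ (E 2) + (1 - (1 : ℝ)) • M).det := by
    simp [ContinuousLinearMap.det]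
  have hpre : IsPreconnected (Set.Ioi (0 : ℝ)) := isPreconnected_Ioi
  obtain ⟨t, ht, ht0⟩ := hpre.intermediate_value (a := s) (b := 1) hs (Set.mem_Ioi.2 one_pos) hcont.continuousOn
    ⟨hneg, h1.le⟩
  exact hne t ht ht0

/-- truncated region -/
def IsCC.reg (hC : IsCC C) (s : ℝ) : Set (E 2) :=
  {x | hC.pr x ≠ 0 ∧ ‖hC.pr x‖ ≤ 1 ∧ ‖hC.rs x‖ ≤ s * ‖hC.pr x‖}

lemma IsCC.rs_cont (hC : IsCC C) : Continuous hC.rs := continuous_id.sub hC.pr_cont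

lemma IsCC.reg_meas (hC : IsCC C) (s : ℝ) : MeasurableSet (hC.reg s) := by
  have h1 : MeasurableSet {x | hC.pr x ≠ 0} :=
    (hC.pr_cont.measurable (measurableSet_singleton 0)).compl
  have h2 : MeasurableSet {x | ‖hC.pr x‖ ≤ 1} :=
    (isClosed_le hC.pr_cont.norm continuous_const).measurableSet
  have h3 : MeasurableSet {x | ‖hC.rs x‖ ≤ s * ‖hC.pr x‖} :=
    (isClosed_le hC.rs_cont.norm (continuous_const.mul hC.pr_cont.norm)).measurableSet
  exact h1.inter (h2.inter h3)

lemma IsCC.reg_finite (hC : IsCC C) (s : ℝ) : volume (hC.reg s) < ⊤ := by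
  have : hC.reg s ⊆ Metric.closedBall 0 (1 + |s|) := by
    rintro x ⟨-, h1, h2⟩
    rw [mem_closedBall_zero_iff, ← hC.pr_add_rs x]
    refine (norm_add_le _ _).trans (add_le_add h1 (h2.trans ?_))
    nlinarith [le_abs_self s, abs_nonneg s, norm_nonneg (hC.pr x)]
  exact (measure_mono this).trans_lt measure_closedBall_lt_top

lemma IsCC.T_image (hC : IsCC C) {s : ℝ} (hs : 0 < s) : hC.T s '' hC.reg 1 = hC.reg s := by
  have key : ∀ a b : ℝ, 0 < a → a * b = 1 → ∀ c : ℝ, ∀ x ∈ hC.reg c, hC.T a x ∈ hC.reg (a * c) := by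
    rintro a b ha hab c x ⟨h1, h2, h3⟩
    rw [IsCC.reg, Set.mem_ofPred_eq, hC.pr_T ha.le, hC.rs_T ha.le, norm_smul, Real.norm_of_nonneg ha.le]
    exact ⟨h1, h2, by rw [mul_assoc]; gcongr⟩
  ext y
  constructor
  · rintro ⟨x, hx, rfl⟩
    have := key s s⁻¹ hs (mul_inv_cancel₀ hs.ne') 1 x hx
    rwa [mul_one] at this
  · intro hy
    refine ⟨hC.T s⁻¹ y, ?_, hC.T_T (inv_nonneg.2 hs.le) (mul_inv_cancel₀ hs.ne') y⟩
    have := key s⁻¹ s (inv_pos.2 hs) (inv_mul_cancel₀ hs.ne') s y hy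
    rwa [inv_mul_cancel₀ hs.ne'] at this

lemma lip_null {f : E 2 → E 2} {K : NNReal} (hf : LipschitzWith K f) {N : Set (E 2)}
    (hN : volume N = 0) : volume (f '' N) = 0 := by
  have hH : (μH[3] : Measure (E 2)).IsAddHaarMeasure := by
    have := isAddHaarMeasure_hausdorffMeasure (E := E 2)
    simpa using this
  have h1 : (volume : Measure (E 2)) ≪ μH[3] := Measure.absolutelyContinuous_isAddHaarMeasure _ _
  have h2 : μH[3] ≪ (volume : Measure (E 2)) := Measure.absolutelyContinuous_isAddHaarMeasure _ _
  apply h1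
  have := hf.hausdorffMeasure_image_le (d := 3) (by norm_num) N
  rw [h2 hN, mul_zero] at this
  exact le_antisymm this (zero_le)

/-- points of differentiability inside the basic region -/
def IsCC.dreg (hC : IsCC C) : Set (E 2) := hC.reg 1 ∩ {x | DifferentiableAt ℝ hC.pr x}

lemma IsCC.dreg_meas (hC : IsCC C) : MeasurableSet hC.dreg :=
  (hC.reg_meas 1).inter (measurableSet_of_differentiableAt ℝ _)

lemma IsCC.T_lip (hC : IsCC C) (s : ℝ) : ∃ K, LipschitzWith K (hC.T s) := by
  refine ⟨Real.toNNReal (|s| + |1 - s|), LipschitzWith.of_dist_le_mul fun x y => ?_⟩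
  rw [dist_eq_norm, dist_eq_norm]
  have : hC.T s x - hC.T s y = s • (x - y) + (1 - s) • (hC.pr x - hC.pr y) := by
    rw [IsCC.T, IsCC.T]; module
  rw [this]
  refine (norm_add_le _ _).trans ?_
  rw [norm_smul, norm_smul, Real.coe_toNNReal _ (by positivity), add_mul]
  have := mul_le_mul_of_nonneg_left (hC.pr_norm_sub x y) (norm_nonneg (1 - s))
  simp only [Real.norm_eq_abs] at *
  linarith

lemma IsCC.vol_T_dreg (hC : IsCC C) {s : ℝ} (hs : 0 < s) :
    volume (hC.T s '' hC.dreg) = volume (hC.reg s) := by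
  have h0 : volume (hC.reg 1 \ hC.dreg) = 0 := by
    have := hC.pr_lip.ae_differentiableAt (μ := volume)
    rw [ae_iff] at this
    refine measure_mono_null ?_ this
    rintro x ⟨h1, h2⟩ h3
    exact h2 ⟨h1, h3⟩
  obtain ⟨K, hK⟩ := hC.T_lip s
  have h1 := lip_null hK h0
  have h2 : hC.T s '' hC.dreg ⊆ hC.reg s := by
    rw [← hC.T_image hs]; exact Set.image_mono Set.inter_subset_left
  refine le_antisymm (measure_mono h2) ?_
  have h3 : hC.reg s ⊆ hC.T s '' hC.dreg ∪ hC.T s '' (hC.reg 1 \ hC.dreg) := by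
    rw [← Set.image_union, Set.union_sdiff_cancel (show hC.dreg ⊆ hC.reg 1 from Set.inter_subset_left), hC.T_image hs]
  refine (measure_mono h3).trans ((measure_union_le _ _).trans ?_)
  rw [h1, add_zero]

lemma IsCC.vol_quad (hC : IsCC C) {s : ℝ} (hs : 0 < s) :
    IntegrableOn (fun x => (s • ContinuousLinearMap.id ℝ (E 2) + (1 - s) • fderiv ℝ hC.pr x).det) hC.dreg ∧
    ∫ x in hC.dreg, (s • ContinuousLinearMap.id ℝ (E 2) + (1 - s) • fderiv ℝ hC.pr x).det =
      (volume (hC.reg s)).toReal := by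
  have hinj : Set.InjOn (hC.T s) hC.dreg := by
    intro x _ y _ h
    have := congrArg (hC.T s⁻¹) h
    rwa [hC.T_T hs.le (inv_mul_cancel₀ hs.ne'), hC.T_T hs.le (inv_mul_cancel₀ hs.ne')] at this
  have hder : ∀ x ∈ hC.dreg, HasFDerivWithinAt (hC.T s)
      (s • ContinuousLinearMap.id ℝ (E 2) + (1 - s) • fderiv ℝ hC.pr x) hC.dreg x := by
    rintro x ⟨-, hx⟩
    apply HasFDerivAt.hasFDerivWithinAt
    exact ((hasFDerivAt_id x).const_smul s).add (hx.hasFDerivAt.const_smul (1 - s))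
  have h1 := integral_image_eq_integral_abs_det_fderiv_smul volume hC.dreg_meas hder hinj
    (fun _ => (1 : ℝ))
  have h2 := integrableOn_image_iff_integrableOn_abs_det_fderiv_smul volume hC.dreg_meas hder hinj
    (fun _ => (1 : ℝ))
  have hfin : volume (hC.T s '' hC.dreg) ≠ ⊤ := by
    rw [hC.vol_T_dreg hs]; exact (hC.reg_finite s).ne
  have h3 : IntegrableOn (fun _ => (1 : ℝ)) (hC.T s '' hC.dreg) := integrableOn_const hfin
  have h4 := h2.1 h3
  have heq : Set.EqOn (fun x => |(s • ContinuousLinearMap.id ℝ (E 2) + (1 - s) • fderiv ℝ hC.pr x).det| • (1 : ℝ))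
      (fun x => (s • ContinuousLinearMap.id ℝ (E 2) + (1 - s) • fderiv ℝ hC.pr x).det) hC.dreg := by
    rintro x ⟨-, hx⟩
    simp only [smul_eq_mul, mul_one]
    exact abs_of_pos (det_pos (fun v => hC.fderiv_firm hx v) hs)
  refine ⟨h4.congr_fun heq hC.dreg_meas, ?_⟩
  rw [← setIntegral_congr_fun hC.dreg_meas heq, ← h1]
  simp [Measure.real, hC.vol_T_dreg hs]

lemma IsCC.vol_reg_poly (hC : IsCC C) : ∃ c0 c1 c2 : ℝ, ∀ s : ℝ, 0 < s →
    (volume (hC.reg s)).toReal = c0 + c1 * s + c2 * s ^ 2 := by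
  obtain ⟨i1, v1⟩ := hC.vol_quad (s := 1) (by norm_num)
  obtain ⟨i2, v2⟩ := hC.vol_quad (s := 2) (by norm_num)
  obtain ⟨i3, v3⟩ := hC.vol_quad (s := 3) (by norm_num)
  set a := (volume (hC.reg 1)).toReal
  set b := (volume (hC.reg 2)).toReal
  set c := (volume (hC.reg 3)).toReal
  refine ⟨3 * a - 3 * b + c, -5 / 2 * a + 4 * b - 3 / 2 * c, a / 2 - b + c / 2, fun s hs => ?_⟩
  obtain ⟨-, v⟩ := hC.vol_quad hs
  rw [← v]
  have hd : Set.EqOn (fun x => (s • ContinuousLinearMap.id ℝ (E 2) + (1 - s) • fderiv ℝ hC.pr x).det)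
      (fun x => ((1 : ℝ) • ContinuousLinearMap.id ℝ (E 2) + (1 - (1 : ℝ)) • fderiv ℝ hC.pr x).det * ((s - 2) * (s - 3) / 2) -
      ((2 : ℝ) • ContinuousLinearMap.id ℝ (E 2) + (1 - (2 : ℝ)) • fderiv ℝ hC.pr x).det * ((s - 1) * (s - 3)) +
      ((3 : ℝ) • ContinuousLinearMap.id ℝ (E 2) + (1 - (3 : ℝ)) • fderiv ℝ hC.pr x).det * ((s - 1) * (s - 2) / 2))
      hC.dreg := by
    rintro x ⟨h1, hx⟩
    apply det_poly
    by_contra h0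
    have h2 := hC.fderiv_pr_pr hx
    have h3 : Function.Injective
        ((ContinuousLinearMap.id ℝ (E 2) - fderiv ℝ hC.pr x : E 2 →L[ℝ] E 2) : E 2 →ₗ[ℝ] E 2) :=
      (LinearMap.equivOfDetNeZero _ h0).injective
    apply h1.1
    apply h3
    simp [h2]
  rw [setIntegral_congr_fun hC.dreg_meas hd, integral_add, integral_sub, integral_mul_const,
    integral_mul_const, integral_mul_const, v1, v2, v3]
  · ring
  · exact i1.mul_const _
  · exact i2.mul_const _
  · exact (i1.mul_const _).sub (i2.mul_const _)
  · exact i3.mul_const _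

open scoped Pointwise in
lemma cone_scale {W : Set (E 2)} (hW : ∀ t : ℝ, 0 < t → ∀ x ∈ W, t • x ∈ W) {ρ : ℝ} (hρ : 0 < ρ) :
    volume (W ∩ {x | ‖x‖ ≤ ρ}) = ENNReal.ofReal (ρ ^ 3) * volume (W ∩ {x | ‖x‖ ≤ 1}) := by
  have h1 : W ∩ {x | ‖x‖ ≤ ρ} = ρ • (W ∩ {x | ‖x‖ ≤ 1}) := by
    ext x
    rw [Set.mem_smul_set_iff_inv_smul_mem₀ hρ.ne']
    simp only [Set.mem_inter_iff, Set.mem_ofPred_eq, norm_smul, norm_inv, Real.norm_of_nonneg hρ.le]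
    constructor
    · rintro ⟨h1, h2⟩
      exact ⟨hW _ (inv_pos.2 hρ) _ h1, by rw [inv_mul_le_iff₀ hρ]; linarith⟩
    · rintro ⟨h1, h2⟩
      have := hW ρ hρ _ h1
      rw [smul_smul, mul_inv_cancel₀ hρ.ne', one_smul] at this
      rw [inv_mul_le_iff₀ hρ] at h2
      exact ⟨this, by linarith⟩
  rw [h1, Measure.addHaar_smul]
  simp [abs_of_pos hρ]

/-- conical region -/
def IsCC.sec (hC : IsCC C) (s : ℝ) : Set (E 2) :=
  {x | hC.pr x ≠ 0 ∧ ‖hC.rs x‖ ≤ s * ‖hC.pr x‖}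

lemma IsCC.sec_meas (hC : IsCC C) (s : ℝ) : MeasurableSet (hC.sec s) := by
  have h1 : MeasurableSet {x | hC.pr x ≠ 0} :=
    (hC.pr_cont.measurable (measurableSet_singleton 0)).compl
  have h3 : MeasurableSet {x | ‖hC.rs x‖ ≤ s * ‖hC.pr x‖} :=
    (isClosed_le hC.rs_cont.norm (continuous_const.mul hC.pr_cont.norm)).measurableSet
  exact h1.inter h3

lemma IsCC.sec_smul (hC : IsCC C) (s : ℝ) {t : ℝ} (ht : 0 < t) (x : E 2) :
    t • x ∈ hC.sec s ↔ x ∈ hC.sec s := by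
  rw [IsCC.sec, Set.mem_ofPred_eq, Set.mem_ofPred_eq, hC.pr_smul x ht.le, hC.rs_smul x ht.le,
    norm_smul, norm_smul, Real.norm_of_nonneg ht.le, smul_ne_zero_iff]
  constructor
  · rintro ⟨⟨_, h1⟩, h2⟩
    refine ⟨h1, ?_⟩
    by_contra! h
    nlinarith
  · rintro ⟨h1, h2⟩
    exact ⟨⟨ht.ne', h1⟩, by nlinarith⟩

lemma IsCC.pr_zero (hC : IsCC C) : hC.pr 0 = 0 := hC.pr_of_mem hC.zero

lemma IsCC.sm_sec (hC : IsCC C) (s : ℝ) : sm (hC.sec s) = volume (hC.sec s ∩ {x | ‖x‖ ≤ 1}) := by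
  rw [sm_apply (hC.sec_meas s)]
  congr 1
  ext x
  simp only [Set.mem_inter_iff, Set.mem_preimage, pball, Set.mem_ofPred_eq]
  constructor
  · rintro ⟨h1, h2, h3⟩
    refine ⟨?_, h3⟩
    rw [nz, hC.sec_smul s (inv_pos.2 (norm_pos_iff.2 h2))] at h1
    exact h1
  · rintro ⟨h1, h3⟩
    have h2 : x ≠ 0 := by rintro rfl; exact h1.1 hC.pr_zero
    refine ⟨?_, h2, h3⟩
    rw [nz, hC.sec_smul s (inv_pos.2 (norm_pos_iff.2 h2))]
    exact h1

lemma IsCC.incr (hC : IsCC C) {a b : ℝ} (ha : 0 < a) (hab : a ≤ b) :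
    √(1 + a ^ 2) ^ 3 * ((sm (hC.sec b)).toReal - (sm (hC.sec a)).toReal) ≤
      (volume (hC.reg b)).toReal - (volume (hC.reg a)).toReal ∧
    (volume (hC.reg b)).toReal - (volume (hC.reg a)).toReal ≤
      √(1 + b ^ 2) ^ 3 * ((sm (hC.sec b)).toReal - (sm (hC.sec a)).toReal) := by
  have hsub : hC.reg a ⊆ hC.reg b := fun x h => ⟨h.1, h.2.1, h.2.2.trans (by gcongr)⟩
  have hsub2 : hC.sec a ⊆ hC.sec b := fun x h => ⟨h.1, h.2.trans (by gcongr)⟩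
  set W := hC.sec b \ hC.sec a
  have hW : ∀ t : ℝ, 0 < t → ∀ x ∈ W, t • x ∈ W := by
    rintro t ht x ⟨h1, h2⟩
    exact ⟨(hC.sec_smul b ht x).2 h1, fun h => h2 ((hC.sec_smul a ht x).1 h)⟩
  have hF : (sm (hC.sec b)).toReal - (sm (hC.sec a)).toReal = (volume (W ∩ {x | ‖x‖ ≤ 1})).toReal := by
    rw [hC.sm_sec, hC.sm_sec]
    have e : W ∩ {x | ‖x‖ ≤ 1} = (hC.sec b ∩ {x | ‖x‖ ≤ 1}) \ (hC.sec a ∩ {x | ‖x‖ ≤ 1}) := by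
      ext x; simp only [W, Set.mem_inter_iff, Set.mem_sdiff]; tauto
    have hm : MeasurableSet (hC.sec a ∩ {x | ‖x‖ ≤ 1}) :=
      (hC.sec_meas a).inter (isClosed_le continuous_norm continuous_const).measurableSet
    have hfin : ∀ s, volume (hC.sec s ∩ {x | ‖x‖ ≤ 1}) ≠ ⊤ := fun s => by
      rw [← hC.sm_sec]; exact measure_ne_top _ _
    rw [e, measure_sdiff (Set.inter_subset_inter_left _ hsub2) hm.nullMeasurableSet (hfin a),
      ENNReal.toReal_sub_of_le (measure_mono (Set.inter_subset_inter_left _ hsub2)) (hfin b)]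
  have hV : (volume (hC.reg b)).toReal - (volume (hC.reg a)).toReal = (volume (hC.reg b \ hC.reg a)).toReal := by
    rw [measure_sdiff hsub (hC.reg_meas a).nullMeasurableSet (hC.reg_finite a).ne,
      ENNReal.toReal_sub_of_le (measure_mono hsub) (hC.reg_finite b).ne]
  have hWfin : ∀ ρ : ℝ, volume (W ∩ {x | ‖x‖ ≤ ρ}) ≠ ⊤ := fun ρ => by
    refine ((measure_mono (t := Metric.closedBall 0 ρ) ?_).trans_lt measure_closedBall_lt_top).ne
    rintro x ⟨-, hx⟩; simpa using hx
  have hsc : ∀ ρ : ℝ, 0 < ρ → ρ ^ 3 * (volume (W ∩ {x | ‖x‖ ≤ 1})).toReal =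
      (volume (W ∩ {x | ‖x‖ ≤ ρ})).toReal := by
    intro ρ hρ
    rw [cone_scale hW hρ, ENNReal.toReal_mul, ENNReal.toReal_ofReal (by positivity)]
  rw [hF, hV, hsc _ (by positivity), hsc _ (by positivity)]
  constructor
  · apply ENNReal.toReal_mono ((measure_mono Set.sdiff_subset).trans_lt (hC.reg_finite b)).ne
    apply measure_mono
    rintro x ⟨⟨h1, h2⟩, h3⟩
    have h4 : ¬ (‖hC.rs x‖ ≤ a * ‖hC.pr x‖) := fun h => h2 ⟨h1.1, h⟩
    refine ⟨⟨h1.1, ?_, h1.2⟩, fun h => h4 h.2.2⟩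
    rw [not_le] at h4
    have h5 := hC.norm_sq x
    have h3 : ‖x‖ ≤ √(1 + a ^ 2) := h3
    have h6 : ‖x‖ ^ 2 ≤ 1 + a ^ 2 := by
      rw [← Real.sq_sqrt (show 0 ≤ 1 + a ^ 2 by positivity)]; gcongr
    have h7 := norm_nonneg (hC.pr x)
    by_contra! h8
    have : (a * ‖hC.pr x‖) ^ 2 ≤ ‖hC.rs x‖ ^ 2 := by gcongr
    have : 1 < ‖hC.pr x‖ ^ 2 := by nlinarith
    nlinarith
  · apply ENNReal.toReal_mono (hWfin _)
    apply measure_mono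
    rintro x ⟨⟨h1, h2, h3⟩, h4⟩
    refine ⟨⟨⟨h1, h3⟩, fun h => h4 ⟨h1, h2, h.2⟩⟩, ?_⟩
    show ‖x‖ ≤ √(1 + b ^ 2)
    apply Real.le_sqrt_of_sq_le
    rw [hC.norm_sq x]
    have : ‖hC.rs x‖ ^ 2 ≤ (b * ‖hC.pr x‖) ^ 2 := by gcongr
    have : ‖hC.pr x‖ ^ 2 ≤ 1 := by nlinarith [norm_nonneg (hC.pr x)]
    nlinarith [sq_nonneg b]

lemma IsCC.steiner0 (hC : IsCC C) : ∃ k P Q : ℝ, ∀ s : ℝ, 0 < s →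
    (sm (hC.sec s)).toReal = k + P * (s / √(1 + s ^ 2)) - Q * (1 / √(1 + s ^ 2)) := by
  obtain ⟨c0, c1, c2, hV⟩ := hC.vol_reg_poly
  let F : ℝ → ℝ := fun s => (sm (hC.sec s)).toReal
  let V : ℝ → ℝ := fun s => c0 + c1 * s + c2 * s ^ 2
  let Φ : ℝ → ℝ := fun s => c1 * (s / √(1 + s ^ 2)) - (2 * c2) * (1 / √(1 + s ^ 2))
  have hsq : ∀ s : ℝ, 0 < √(1 + s ^ 2) := fun s => by positivity
  have hF : ∀ s, 0 < s → HasDerivAt F (1 / √(1 + s ^ 2) ^ 3 * (c1 + c2 * (2 * s))) s := by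
    intro s hs
    apply squeeze_deriv (V := V) (k := fun s => 1 / √(1 + s ^ 2) ^ 3) (Ioi_mem_nhds hs)
    · intro y hy
      have hy : 0 < y := hy
      have g : ∀ a b, 0 < a → a ≤ b → 1 / √(1 + b ^ 2) ^ 3 * (V b - V a) ≤ F b - F a ∧
          F b - F a ≤ 1 / √(1 + a ^ 2) ^ 3 * (V b - V a) := by
        intro a b ha hab
        obtain ⟨h1, h2⟩ := hC.incr ha hab
        rw [hV a ha, hV b (ha.trans_le hab)] at h1 h2
        have ha3 : 0 < √(1 + a ^ 2) ^ 3 := by positivity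
        have hb3 : 0 < √(1 + b ^ 2) ^ 3 := by positivity
        constructor
        · rw [one_div, inv_mul_le_iff₀ hb3]; exact h2
        · rw [one_div, le_inv_mul_iff₀ ha3]; exact h1
      rw [Set.mem_uIcc]
      rcases le_total s y with h | h
      · right; exact g s y hs h
      · right
        obtain ⟨h1, h2⟩ := g y s hy h
        constructor <;> linarith
    · have : Continuous fun s : ℝ => 1 / √(1 + s ^ 2) ^ 3 := by
        apply continuous_const.div (by fun_prop)
        intro s; positivity
      exact this.continuousAt
    · have := (((hasDerivAt_id s).const_mul c1).const_add c0).add ((hasDerivAt_pow 2 s).const_mul c2)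
      refine (this.congr_deriv ?_)
      simp
  have hΦ : ∀ s, HasDerivAt Φ (1 / √(1 + s ^ 2) ^ 3 * (c1 + c2 * (2 * s))) s := by
    intro s
    have h0 : HasDerivAt (fun s : ℝ => √(1 + s ^ 2)) (s / √(1 + s ^ 2)) s := by
      have := ((hasDerivAt_pow 2 s).const_add 1).sqrt (by positivity)
      refine this.congr_deriv ?_
      have := hsq s
      field_simp; norm_num
    have h1 := (((hasDerivAt_id s).div h0 (hsq s).ne').const_mul c1).sub
      (((hasDerivAt_const s (1 : ℝ)).div h0 (hsq s).ne').const_mul (2 * c2))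
    refine h1.congr_deriv ?_
    have h3 := hsq s
    have h4 : √(1 + s ^ 2) ^ 2 = 1 + s ^ 2 := Real.sq_sqrt (by positivity)
    simp only [id]
    field_simp
    rw [h4]; ring
  have hconst : ∀ s, 0 < s → F s - Φ s = F 1 - Φ 1 := by
    intro s hs
    have hd : ∀ x ∈ Set.Ioi (0 : ℝ), HasDerivAt (fun s => F s - Φ s) 0 x := fun x hx => by
      exact ((hF x hx).sub (hΦ x)).congr_deriv (sub_self _)
    exact isOpen_Ioi.is_const_of_deriv_eq_zero isPreconnected_Ioi
      (fun x hx => (hd x hx).differentiableAt.differentiableWithinAt) (fun x hx => (hd x hx).deriv)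
      (Set.mem_Ioi.2 hs) (Set.mem_Ioi.2 one_pos)
  refine ⟨F 1 - Φ 1, c1, 2 * c2, fun s hs => ?_⟩
  have := hconst s hs
  simp only [F, Φ] at this ⊢
  linarith

/-- Steiner formula for parallel sets of spherically convex sets -/
lemma IsCC.steiner (hC : IsCC C) : ∃ k P Q : ℝ, (∀ τ : ℝ, 0 < τ → τ < π / 2 →
    (sm {u | cos τ ≤ ‖hC.pr u‖}).toReal = k + P * sin τ - Q * cos τ) ∧
    (sm {u | 1 ≤ ‖hC.pr u‖}).toReal = k - Q := by
  obtain ⟨k, P, Q, h⟩ := hC.steiner0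
  have hmeas : ∀ c : ℝ, MeasurableSet {u | c ≤ ‖hC.pr u‖} := fun c =>
    (isClosed_le continuous_const hC.pr_cont.norm).measurableSet
  have main : ∀ τ : ℝ, 0 < τ → τ < π / 2 →
    (sm {u | cos τ ≤ ‖hC.pr u‖}).toReal = k + P * sin τ - Q * cos τ := by
    intro τ h0 h1
    have hc : 0 < cos τ := Real.cos_pos_of_mem_Ioo ⟨by linarith, h1⟩
    have hs : 0 < sin τ := Real.sin_pos_of_pos_of_lt_pi h0 (by linarith [Real.pi_pos])
    have e0 : √(1 + tan τ ^ 2) = 1 / cos τ := by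
      rw [Real.tan_eq_sin_div_cos, show 1 + (sin τ / cos τ) ^ 2 = (1 / cos τ) ^ 2 by
        field_simp
        nlinarith [Real.sin_sq_add_cos_sq τ], Real.sqrt_sq (by positivity)]
    have e1 := h (tan τ) (Real.tan_pos_of_pos_of_lt_pi_div_two h0 h1)
    rw [e0, Real.tan_eq_sin_div_cos] at e1
    rw [show k + P * sin τ - Q * cos τ = k + P * (sin τ / cos τ / (1 / cos τ)) - Q * (1 / (1 / cos τ)) by
      field_simp, ← e1]
    congr 1
    rw [sm_apply (hmeas _), sm_apply (hC.sec_meas _)]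
    congr 1
    ext x
    simp only [Set.mem_inter_iff, Set.mem_preimage, Set.mem_ofPred_eq, and_congr_left_iff]
    intro hx
    have hu := nz_norm hx.1
    set u := nz x
    have hn := hC.norm_sq u
    rw [hu] at hn
    have n1 := norm_nonneg (hC.pr u)
    have n2 := norm_nonneg (hC.rs u)
    have sc := Real.sin_sq_add_cos_sq τ
    rw [IsCC.sec, Set.mem_ofPred_eq, div_mul_eq_mul_div, le_div_iff₀ hc]
    constructor
    · intro hp
      refine ⟨norm_pos_iff.1 (hc.trans_le hp), ?_⟩
      apply le_of_sq_le_sq _ (by positivity)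
      have : cos τ ^ 2 ≤ ‖hC.pr u‖ ^ 2 := by gcongr
      nlinarith
    · rintro ⟨hp, h2⟩
      have : (‖hC.rs u‖ * cos τ) ^ 2 ≤ (sin τ * ‖hC.pr u‖) ^ 2 := by gcongr
      apply le_of_sq_le_sq _ n1
      nlinarith
  refine ⟨k, P, Q, main, ?_⟩
  have hlim1 : Filter.Tendsto (fun n : ℕ => (sm {u | cos (1 / ((n : ℝ) + 1)) ≤ ‖hC.pr u‖}).toReal)
      Filter.atTop (nhds (sm {u | 1 ≤ ‖hC.pr u‖}).toReal) := by
    have hmono : Antitone fun n : ℕ => {u | cos (1 / ((n : ℝ) + 1)) ≤ ‖hC.pr u‖} := by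
      intro m n hmn u hu
      have hu : cos (1 / ((n : ℝ) + 1)) ≤ ‖hC.pr u‖ := hu
      refine le_trans ?_ hu
      apply Real.cos_le_cos_of_nonneg_of_le_pi (by positivity)
      · have : 1 / ((m : ℝ) + 1) ≤ 1 := by
          rw [div_le_one (by positivity)]; linarith [(Nat.cast_nonneg m : (0 : ℝ) ≤ m)]
        linarith [Real.pi_gt_three]
      · gcongr
    have hint : {u | 1 ≤ ‖hC.pr u‖} = ⋂ n : ℕ, {u | cos (1 / ((n : ℝ) + 1)) ≤ ‖hC.pr u‖} := by
      ext u
      simp only [Set.mem_iInter, Set.mem_ofPred_eq]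
      constructor
      · intro h n; exact (Real.cos_le_one _).trans h
      · intro h
        have hl : Filter.Tendsto (fun n : ℕ => cos (1 / ((n : ℝ) + 1))) Filter.atTop (nhds 1) := by
          have := (Real.continuous_cos.tendsto 0).comp (tendsto_one_div_add_atTop_nhds_zero_nat (𝕜 := ℝ))
          rw [Real.cos_zero] at this
          exact this
        exact le_of_tendsto hl (Filter.Eventually.of_forall h)
    have := tendsto_measure_iInter_atTop (μ := sm) (fun n : ℕ => (hmeas (cos (1 / ((n : ℝ) + 1)))).nullMeasurableSet)
      hmono ⟨0, measure_ne_top _ _⟩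
    rw [← hint] at this
    exact (ENNReal.tendsto_toReal (measure_ne_top _ _)).comp this
  have hlim2 : Filter.Tendsto (fun n : ℕ => k + P * sin (1 / ((n : ℝ) + 1)) - Q * cos (1 / ((n : ℝ) + 1)))
      Filter.atTop (nhds (k - Q)) := by
    have hc : Continuous fun t => k + P * sin t - Q * cos t := by fun_prop
    have := (hc.tendsto 0).comp (tendsto_one_div_add_atTop_nhds_zero_nat (𝕜 := ℝ))
    rw [Real.cos_zero, Real.sin_zero, mul_zero, add_zero, mul_one] at this
    exact this
  refine tendsto_nhds_unique hlim1 (hlim2.congr' ?_)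
  filter_upwards with n
  refine (main _ (by positivity) ?_).symm
  have : 1 / ((n : ℝ) + 1) ≤ 1 := by
    rw [div_le_one (by positivity)]; linarith [(Nat.cast_nonneg n : (0 : ℝ) ≤ n)]
  linarith [Real.pi_gt_three]

end SphericalPal

namespace SphericalPal

/-! ### Part 4: complete sets -/

lemma sm_congr {X Y : Set (E 2)} (hX : MeasurableSet X) (hY : MeasurableSet Y)
    (h : ∀ u : E 2, ‖u‖ = 1 → (u ∈ X ↔ u ∈ Y)) : sm X = sm Y := by
  rw [sm_apply hX, sm_apply hY]
  congr 1
  ext x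
  simp only [Set.mem_inter_iff, Set.mem_preimage, and_congr_left_iff]
  intro hx
  exact h _ (nz_norm hx.1)

lemma sm_mono {X Y : Set (E 2)} (hX : MeasurableSet X) (hY : MeasurableSet Y)
    (h : ∀ u : E 2, ‖u‖ = 1 → u ∈ X → u ∈ Y) : (sm X).toReal ≤ (sm Y).toReal := by
  apply ENNReal.toReal_mono (measure_ne_top _ _)
  rw [sm_apply hX, sm_apply hY]
  apply measure_mono
  rintro x ⟨h1, h2⟩
  exact ⟨h _ (nz_norm h2.1) h1, h2⟩

lemma sm_neg {X : Set (E 2)} (hX : MeasurableSet X) : sm {u | -u ∈ X} = sm X :=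
  sm_isom (LinearIsometryEquiv.neg ℝ) hX

/-- complete sets of diameter `r` -/
structure IsComp (r : ℝ) (D : Set (E 2)) : Prop where
  r_pos : 0 < r
  r_lt : r < π / 2
  mem_iff : ∀ y, y ∈ D ↔ ‖y‖ = 1 ∧ ∀ x ∈ D, cos r ≤ ⟪x, y⟫

lemma exists_comp {r : ℝ} (h0 : 0 < r) (h1 : r < π / 2) {M : Set (E 2)} (hM : ∀ x ∈ M, ‖x‖ = 1)
    (hMM : ∀ x ∈ M, ∀ y ∈ M, cos r ≤ ⟪x, y⟫) : ∃ D, M ⊆ D ∧ IsComp r D := by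
  let F : Set (Set (E 2)) := {X | (∀ x ∈ X, ‖x‖ = 1) ∧ ∀ x ∈ X, ∀ y ∈ X, cos r ≤ ⟪x, y⟫}
  obtain ⟨D, hMD, hD⟩ := zorn_subset_nonempty F (by
    intro c hc hch hne
    refine ⟨⋃₀ c, ⟨?_, ?_⟩, fun s hs => Set.subset_sUnion_of_mem hs⟩
    · rintro x ⟨X, hX, hx⟩
      exact (hc hX).1 x hx
    · rintro x ⟨X, hX, hx⟩ y ⟨Y, hY, hy⟩
      rcases hch.total hX hY with h | h
      · exact (hc hY).2 x (h hx) y hy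
      · exact (hc hX).2 x hx y (h hy)) M ⟨hM, hMM⟩
  refine ⟨D, hMD, h0, h1, fun y => ⟨fun hy => ⟨hD.prop.1 y hy, fun x hx => hD.prop.2 x hx y hy⟩, ?_⟩⟩
  rintro ⟨hy, hyD⟩
  have hins : insert y D ∈ F := by
    refine ⟨?_, ?_⟩
    · rintro x (rfl | hx)
      · exact hy
      · exact hD.prop.1 x hx
    · rintro x (rfl | hx) z (rfl | hz)
      · rw [us_inner_self hy]; exact Real.cos_le_one r
      · rw [real_inner_comm]; exact hyD z hz
      · exact hyD x hx
      · exact hD.prop.2 x hx z hz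
  exact hD.le_of_ge hins (Set.subset_insert y D) (Set.mem_insert y D)

/-- the cone over a complete set -/
def dcone (r : ℝ) (D : Set (E 2)) : Set (E 2) := {y | ∀ x ∈ D, cos r * ‖y‖ ≤ ⟪x, y⟫}

lemma IsComp.cos_pos {r : ℝ} {D : Set (E 2)} (hD : IsComp r D) : 0 < cos r :=
  Real.cos_pos_of_mem_Ioo ⟨by linarith [hD.r_pos, Real.pi_pos], hD.r_lt⟩

lemma IsComp.sin_pos {r : ℝ} {D : Set (E 2)} (hD : IsComp r D) : 0 < sin r :=
  Real.sin_pos_of_pos_of_lt_pi hD.r_pos (by linarith [hD.r_lt, Real.pi_pos])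

variable {r : ℝ} {D : Set (E 2)}

lemma IsComp.norm (hD : IsComp r D) {x : E 2} (hx : x ∈ D) : ‖x‖ = 1 := ((hD.mem_iff x).1 hx).1

lemma IsComp.inner (hD : IsComp r D) {x y : E 2} (hx : x ∈ D) (hy : y ∈ D) : cos r ≤ ⟪x, y⟫ :=
  ((hD.mem_iff y).1 hy).2 x hx

lemma IsComp.nonempty (hD : IsComp r D) : D.Nonempty := by
  by_contra h
  rw [Set.not_nonempty_iff_eq_empty] at h
  have : (EuclideanSpace.single 0 1 : E 2) ∈ D := by
    rw [hD.mem_iff, h]; simp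
  rw [h] at this; exact this

lemma IsComp.cc (hD : IsComp r D) : IsCC (dcone r D) where
  closed := by
    have : dcone r D = ⋂ x ∈ D, {y : E 2 | cos r * ‖y‖ ≤ ⟪x, y⟫} := by
      ext y; simp [dcone]
    rw [this]
    exact isClosed_biInter fun x _ => isClosed_le (by fun_prop) (by fun_prop)
  zero := by intro x _; simp
  smul := by
    intro t ht y hy x hx
    rw [norm_smul, inner_smul_right, Real.norm_of_nonneg ht]
    have := hy x hx
    nlinarith
  add := by
    intro y hy z hz x hx
    have h1 := hy x hx
    have h2 := hz x hx
    rw [inner_add_right]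
    have := mul_le_mul_of_nonneg_left (norm_add_le y z) hD.cos_pos.le
    linarith

lemma IsComp.mem_cone (hD : IsComp r D) {y : E 2} (hy : y ∈ D) : y ∈ dcone r D := by
  intro x hx
  rw [hD.norm hy, mul_one]; exact hD.inner hx hy

lemma IsComp.nz_mem (hD : IsComp r D) {y : E 2} (hy : y ∈ dcone r D) (h0 : y ≠ 0) : nz y ∈ D := by
  rw [hD.mem_iff]
  refine ⟨nz_norm h0, fun x hx => ?_⟩
  have h1 := hy x hx
  have h2 : 0 < ‖y‖ := norm_pos_iff.2 h0
  rw [nz, inner_smul_right, le_inv_mul_iff₀ h2]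
  linarith

lemma IsComp.mem_of_cone (hD : IsComp r D) {y : E 2} (hy : y ∈ dcone r D) (h0 : ‖y‖ = 1) : y ∈ D := by
  have := hD.nz_mem hy (by rintro rfl; simp at h0)
  rwa [nz_of_unit h0] at this

/-- ball hull lemma -/
lemma IsComp.hull (hD : IsComp r D) {p z x₀ : E 2} (hp : p ∈ D) (hz : z ∈ D) (hx₀ : ‖x₀‖ = 1)
    {a b : ℝ} (ha : 0 ≤ a) (hb : 0 ≤ b) (hab : 1 ≤ a + b)
    (hn : ‖a • p + b • z - ((a + b - 1) * cos r) • x₀‖ ≤ 1) :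
    a • p + b • z - ((a + b - 1) * cos r) • x₀ ∈ dcone r D := by
  intro x hx
  have h1 := hD.inner hx hp
  have h2 := hD.inner hx hz
  have h3 : ⟪x, x₀⟫ ≤ 1 := by
    have := real_inner_le_norm x x₀
    rwa [hD.norm hx, hx₀, mul_one] at this
  have hc := hD.cos_pos
  have h4 : cos r * ‖a • p + b • z - ((a + b - 1) * cos r) • x₀‖ ≤ cos r := by nlinarith
  refine h4.trans ?_
  rw [inner_sub_right, inner_add_right, inner_smul_right, inner_smul_right, inner_smul_right]
  have h5 := mul_le_mul_of_nonneg_left h1 ha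
  have h6 := mul_le_mul_of_nonneg_left h2 hb
  have h7 := mul_le_mul_of_nonneg_left h3 (mul_nonneg (sub_nonneg.2 hab) hc.le)
  linarith

/-- constant width property of complete sets -/
lemma IsComp.cw (hD : IsComp r D) {p q : E 2} (hp : p ∈ D) (hq : ‖q‖ = 1) (hpq : ⟪p, q⟫ = 0)
    (hz : ∀ z ∈ D, ⟪z, q⟫ ≤ 0) : cos r • p - sin r • q ∈ D := by
  have hc := hD.cos_pos
  have hs := hD.sin_pos
  have sc := Real.sin_sq_add_cos_sq r
  have hpn := hD.norm hp
  set x := cos r • p - sin r • q with hx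
  have hxn : ‖x‖ = 1 := by
    have : ‖x‖ ^ 2 = 1 := by
      rw [hx, norm_sub_sq_real, norm_smul, norm_smul, inner_smul_left, inner_smul_right, hpq, hq, hpn,
        Real.norm_of_nonneg hc.le, Real.norm_of_nonneg hs.le]
      nlinarith
    nlinarith [norm_nonneg x]
  by_contra hxD
  rw [hD.mem_iff] at hxD
  push Not at hxD
  obtain ⟨z, hzD, hzx⟩ := hxD hxn
  have hzn := hD.norm hzD
  have hzq := hz z hzD
  rw [hx, inner_sub_right, inner_smul_right, inner_smul_right] at hzx
  set zp := ⟪z, p⟫ with hzp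
  set zq := ⟪z, q⟫ with hzq'
  obtain ⟨k, hk1, hk2⟩ : ∃ k, -zq / (cos r * sin r) < k ∧ k < (1 - zp) / sin r ^ 2 := by
    apply exists_between
    rw [div_lt_div_iff₀ (by positivity) (by positivity)]
    nlinarith
  rw [div_lt_iff₀ (by positivity)] at hk1
  rw [lt_div_iff₀ (by positivity)] at hk2
  have hk0 : 0 < k := by
    by_contra! h
    have : k * (cos r * sin r) ≤ 0 := mul_nonpos_of_nonpos_of_nonneg h (by positivity)
    linarith
  set w := z - (1 - k * sin r ^ 2) • p + (k * (cos r * sin r)) • q with hw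
  have hpw : ⟪p, w⟫ < 0 := by
    rw [hw, inner_add_right, inner_sub_right, inner_smul_right, inner_smul_right, hpq,
      us_inner_self hpn, real_inner_comm, ← hzp]
    linarith
  set b := min 1 (-⟪p, w⟫ / (‖w‖ ^ 2 + 1)) with hb
  have hb0 : 0 < b := lt_min one_pos (div_pos (by linarith) (by positivity))
  have hb1 : b ≤ 1 := min_le_left _ _
  have hb2 : b * (‖w‖ ^ 2 + 1) ≤ -⟪p, w⟫ := by
    rw [← le_div_iff₀ (by positivity)]; exact min_le_right _ _
  set a := 1 - b + b * k with ha
  have hy : a • p + b • z - ((a + b - 1) * cos r) • x = p + b • w := by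
    have e : a + b - 1 = b * k := by rw [ha]; ring
    rw [e, hw, hx, ha]
    have e2 : sin r ^ 2 = 1 - cos r ^ 2 := by linarith
    rw [e2]
    module
  have hyn : ‖p + b • w‖ ≤ 1 := by
    have : ‖p + b • w‖ ^ 2 ≤ 1 := by
      rw [norm_add_sq_real, norm_smul, inner_smul_right, hpn, Real.norm_of_nonneg hb0.le]
      nlinarith [sq_nonneg ‖w‖]
    nlinarith [norm_nonneg (p + b • w)]
  have hyC := hD.hull hp hzD hxn (a := a) (b := b) (by rw [ha]; nlinarith) hb0.le
    (by rw [ha]; nlinarith) (by rw [hy]; exact hyn)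
  rw [hy] at hyC
  have hyq : 0 < ⟪p + b • w, q⟫ := by
    rw [inner_add_left, hpq, inner_smul_left, hw, inner_add_left, inner_sub_left, inner_smul_left,
      inner_smul_left, hpq, us_inner_self hq, ← hzq']
    simp only [conj_trivial]
    nlinarith
  have hy0 : p + b • w ≠ 0 := by
    intro h; rw [h, inner_zero_left] at hyq; exact lt_irrefl _ hyq
  have := hz _ (hD.nz_mem hyC hy0)
  rw [nz, inner_smul_left] at this
  simp only [conj_trivial] at this
  have h2 : 0 < ‖p + b • w‖⁻¹ := inv_pos.2 (norm_pos_iff.2 hy0)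
  nlinarith

lemma IsComp.no_orth (hD : IsComp r D) {u : E 2} (hu : ‖u‖ = 1) (h : ∀ z ∈ D, ⟪z, u⟫ = 0) : False := by
  obtain ⟨p, hp⟩ := hD.nonempty
  have h1 := hD.cw hp hu (h p hp) (fun z hz => (h z hz).le)
  have h2 := h _ h1
  rw [inner_sub_left, inner_smul_left, inner_smul_left, h p hp, us_inner_self hu] at h2
  simp at h2
  exact hD.sin_pos.ne' h2

lemma IsCC.inner_pr {C : Set (E 2)} (hC : IsCC C) {x v : E 2} (hx : x ∈ C) (hxn : ‖x‖ = 1) :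
    ⟪v, x⟫ ≤ ‖hC.pr v‖ := by
  have h1 := hC.pr_le v x hx
  have h2 := real_inner_le_norm x (hC.pr v)
  rw [inner_sub_right] at h1
  rw [hxn, one_mul] at h2
  rw [real_inner_comm]; linarith

lemma IsCC.inner_nz {C : Set (E 2)} (hC : IsCC C) (v : E 2) (h0 : hC.pr v ≠ 0) :
    ⟪v, nz (hC.pr v)⟫ = ‖hC.pr v‖ := by
  have h1 := hC.pr_orth v
  rw [inner_sub_right, real_inner_self_eq_norm_sq] at h1
  have : 0 < ‖hC.pr v‖ := norm_pos_iff.2 h0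
  rw [nz, inner_smul_right, real_inner_comm]
  field_simp
  linarith

/-- angle addition in terms of inner products -/
lemma inner_cos_add {x y z : E 2} (hx : ‖x‖ = 1) (hy : ‖y‖ = 1) (hz : ‖z‖ = 1) {a b : ℝ}
    (ha : 0 ≤ a) (hb : 0 ≤ b) (hab : a + b ≤ π) (h1 : cos a ≤ ⟪x, y⟫) (h2 : cos b ≤ ⟪y, z⟫) :
    cos (a + b) ≤ ⟪x, z⟫ := by
  have e : ∀ u v : E 2, ‖u‖ = 1 → ‖v‖ = 1 → cos (InnerProductGeometry.angle u v) = ⟪u, v⟫ := by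
    intro u v hu hv
    rw [InnerProductGeometry.cos_angle, hu, hv]; simp
  have t := InnerProductGeometry.angle_le_angle_add_angle x y z
  have f : ∀ u v : E 2, ‖u‖ = 1 → ‖v‖ = 1 → ∀ c : ℝ, 0 ≤ c → c ≤ π → cos c ≤ ⟪u, v⟫ →
      InnerProductGeometry.angle u v ≤ c := by
    intro u v hu hv c hc0 hc h
    rw [← e u v hu hv] at h
    by_contra! hlt
    have := Real.cos_lt_cos_of_nonneg_of_le_pi hc0 (InnerProductGeometry.angle_le_pi u v) hlt
    linarith
  have h3 := f x y hx hy a ha (by linarith) h1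
  have h4 := f y z hy hz b hb (by linarith) h2
  rw [← e x z hx hz]
  exact Real.cos_le_cos_of_nonneg_of_le_pi (InnerProductGeometry.angle_nonneg _ _) hab (by linarith)

/-- points close to `D` -/
lemma IsComp.near (hD : IsComp r D) {u : E 2} (hu : ‖u‖ = 1) {τ : ℝ} (h0 : 0 < τ) (h1 : τ < π / 2)
    (h : cos τ ≤ ‖hD.cc.pr u‖) {z : E 2} (hz : z ∈ D) : cos (τ + r) ≤ ⟪u, z⟫ := by
  have hc : 0 < cos τ := Real.cos_pos_of_mem_Ioo ⟨by linarith, h1⟩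
  have hp0 : hD.cc.pr u ≠ 0 := norm_pos_iff.1 (hc.trans_le h)
  have hpD := hD.nz_mem (hD.cc.pr_mem u) hp0
  refine inner_cos_add hu (hD.norm hpD) (hD.norm hz) h0.le hD.r_pos.le (by linarith [hD.r_lt]) ?_
    (hD.inner hpD hz)
  rwa [hD.cc.inner_nz u hp0]

/-- points away from `D` -/
lemma IsComp.far (hD : IsComp r D) {u : E 2} (hu : ‖u‖ = 1) {τ : ℝ} (h0 : 0 < τ)
    (h1 : τ < π / 2) (h : ‖hD.cc.pr u‖ < cos τ) (hp0 : hD.cc.pr u ≠ 0) :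
    ∃ z ∈ D, ⟪u, z⟫ < cos (τ + r) := by
  have hpD := hD.nz_mem (hD.cc.pr_mem u) hp0
  have hpos : 0 < ‖hD.cc.pr u‖ := norm_pos_iff.2 hp0
  have hn := hD.cc.norm_sq u
  rw [hu] at hn
  have hq : hD.cc.rs u ≠ 0 := by
    intro h3
    rw [h3, norm_zero] at hn
    have := Real.cos_le_one τ
    nlinarith
  have hqpos : 0 < ‖hD.cc.rs u‖ := norm_pos_iff.2 hq
  have horth : ⟪hD.cc.pr u, hD.cc.rs u⟫ = 0 := hD.cc.pr_orth u
  have hpq : ⟪nz (hD.cc.pr u), nz (hD.cc.rs u)⟫ = 0 := by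
    rw [nz, nz, inner_smul_left, inner_smul_right, horth]; simp
  have hx := hD.cw hpD (nz_norm hq) hpq (by
    intro z hz
    rw [nz, inner_smul_right]
    exact mul_nonpos_of_nonneg_of_nonpos (by positivity) (hD.cc.pr_le u z (hD.mem_cone hz)))
  refine ⟨_, hx, ?_⟩
  have hq2 : ⟪u, nz (hD.cc.rs u)⟫ = ‖hD.cc.rs u‖ := by
    have e := congrArg (fun v => ⟪v, hD.cc.rs u⟫) (hD.cc.pr_add_rs u)
    simp only [inner_add_left, horth, real_inner_self_eq_norm_sq, zero_add] at e
    rw [nz, inner_smul_right, ← e]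
    field_simp
  rw [inner_sub_right, inner_smul_right, inner_smul_right, hD.cc.inner_nz u hp0, hq2, Real.cos_add]
  have hsq : sin τ < ‖hD.cc.rs u‖ := by
    have hst : 0 < sin τ := Real.sin_pos_of_pos_of_lt_pi h0 (by linarith [Real.pi_pos])
    have := Real.sin_sq_add_cos_sq τ
    have : ‖hD.cc.pr u‖ ^ 2 < cos τ ^ 2 := by gcongr
    by_contra! h5
    have : ‖hD.cc.rs u‖ ^ 2 ≤ sin τ ^ 2 := by gcongr
    linarith
  nlinarith [hD.cos_pos, hD.sin_pos]

/-- dual body of a complete set -/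
def dual (D : Set (E 2)) : Set (E 2) := {y | ‖y‖ = 1 ∧ ∀ x ∈ D, 0 ≤ ⟪x, y⟫}

lemma dual_closed (D : Set (E 2)) : IsClosed (dual D) := by
  have : dual D = {y : E 2 | ‖y‖ = 1} ∩ ⋂ x ∈ D, {y : E 2 | 0 ≤ ⟪x, y⟫} := by
    ext y; simp [dual]
  rw [this]
  exact (isClosed_eq continuous_norm continuous_const).inter
    (isClosed_biInter fun x _ => isClosed_le (by fun_prop) (by fun_prop))

lemma IsComp.closed (hD : IsComp r D) : IsClosed D := by
  have : D = {y : E 2 | ‖y‖ = 1} ∩ ⋂ x ∈ D, {y : E 2 | cos r ≤ ⟪x, y⟫} := by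
    ext y
    rw [hD.mem_iff y]; simp
  rw [this]
  exact (isClosed_eq continuous_norm continuous_const).inter
    (isClosed_biInter fun x _ => isClosed_le (by fun_prop) (by fun_prop))

lemma IsComp.mem_dual (hD : IsComp r D) {u : E 2} (hu : ‖u‖ = 1) :
    u ∈ dual D ↔ cos (π / 2 - r) ≤ ‖hD.cc.pr u‖ := by
  have hr := hD.r_pos
  have hr2 := hD.r_lt
  constructor
  · rintro ⟨-, h⟩
    by_contra! hlt
    by_cases h0 : hD.cc.pr u = 0
    · refine hD.no_orth hu fun z hz => le_antisymm ?_ (h z hz)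
      have := hD.cc.pr_le u z (hD.mem_cone hz)
      rwa [h0, sub_zero] at this
    · obtain ⟨z, hz, hz2⟩ := hD.far hu (by linarith) (by linarith) hlt h0
      rw [sub_add_cancel, Real.cos_pi_div_two, real_inner_comm] at hz2
      linarith [h z hz]
  · intro h
    refine ⟨hu, fun x hx => ?_⟩
    have := hD.near hu (by linarith) (by linarith) h hx
    rwa [sub_add_cancel, Real.cos_pi_div_two, real_inner_comm] at this

/-- area of the dual body of a complete set -/
lemma IsComp.area_dual (hD : IsComp r D) : (sm (dual D)).toReal =
    (sm Set.univ).toReal / 2 - ((sm Set.univ).toReal / 2 - (sm D).toReal) * tan (r / 2) := by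
  have hr := hD.r_pos
  have hr2 := hD.r_lt
  obtain ⟨k, P, Q, hst, hst0⟩ := hD.cc.steiner
  set S := (sm Set.univ).toReal
  have hmeas : ∀ c : ℝ, MeasurableSet {u | c ≤ ‖hD.cc.pr u‖} := fun c =>
    (isClosed_le continuous_const hD.cc.pr_cont.norm).measurableSet
  have hDk : (sm D).toReal = k - Q := by
    rw [← hst0]
    congr 1
    refine sm_congr hD.closed.measurableSet (hmeas 1) fun u hu => ⟨fun h => ?_, fun h => ?_⟩
    · show 1 ≤ ‖hD.cc.pr u‖
      rw [hD.cc.pr_of_mem (hD.mem_cone h), hu]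
    · have h : 1 ≤ ‖hD.cc.pr u‖ := h
      have hn := hD.cc.norm_sq u
      rw [hu] at hn
      have : ‖hD.cc.rs u‖ = 0 := by nlinarith [norm_nonneg (hD.cc.rs u)]
      rw [norm_eq_zero] at this
      have h2 := hD.cc.pr_add_rs u
      rw [this, add_zero] at h2
      have h3 := hD.cc.pr_mem u
      rw [h2] at h3
      exact hD.mem_of_cone h3 hu
  have hLk : (sm (dual D)).toReal = k + P * cos r - Q * sin r := by
    have := hst (π / 2 - r) (by linarith) (by linarith)
    rw [Real.sin_pi_div_two_sub] at this
    nth_rewrite 2 [Real.cos_pi_div_two_sub] at this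
    rw [← this]
    congr 1
    exact sm_congr (dual_closed D).measurableSet (hmeas _) fun u hu => hD.mem_dual hu
  -- the two inequalities
  have hsum : ∀ X Y : Set (E 2), MeasurableSet X → MeasurableSet Y →
      (∀ u : E 2, ‖u‖ = 1 → u ∉ X → -u ∈ Y) → S ≤ (sm X).toReal + (sm Y).toReal := by
    intro X Y hX hY h
    rw [← sm_neg hY]
    have hY' : MeasurableSet {u | -u ∈ Y} := measurable_neg hY
    have h1 : S ≤ (sm (X ∪ {u | -u ∈ Y})).toReal := by
      apply sm_mono MeasurableSet.univ (hX.union hY')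
      intro u hu _
      by_cases hx : u ∈ X
      · exact Or.inl hx
      · exact Or.inr (h u hu hx)
    refine h1.trans ?_
    rw [← ENNReal.toReal_add (measure_ne_top _ _) (measure_ne_top _ _)]
    exact ENNReal.toReal_mono (by finiteness) (measure_union_le _ _)
  have hsum2 : ∀ X Y : Set (E 2), MeasurableSet X → MeasurableSet Y →
      (∀ u : E 2, ‖u‖ = 1 → u ∈ X → -u ∉ Y) → (sm X).toReal + (sm Y).toReal ≤ S := by
    intro X Y hX hY h
    rw [← sm_neg hY]
    have hY' : MeasurableSet {u | -u ∈ Y} := measurable_neg hY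
    have h1 : (sm X).toReal ≤ (sm {u | -u ∈ Y}ᶜ).toReal := sm_mono hX hY'.compl (fun u hu hx => h u hu hx)
    have h2 : (sm {u | -u ∈ Y}ᶜ).toReal = S - (sm {u | -u ∈ Y}).toReal := by
      rw [measure_compl hY' (measure_ne_top _ _),
        ENNReal.toReal_sub_of_le (measure_mono (Set.subset_univ _)) (measure_ne_top _ _)]
    linarith
  have hge : ∀ τ, π / 2 - r < τ → τ < π / 2 →
      S ≤ (k + P * sin τ - Q * cos τ) + (k + P * sin (τ + r) + Q * cos (τ + r)) := by
    intro τ h1 h2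
    have e1 : sin (τ + r) = sin (π - r - τ) := by
      rw [← Real.sin_pi_sub (τ + r)]; congr 1; ring
    have e2 : cos (τ + r) = -cos (π - r - τ) := by
      rw [← Real.cos_pi_sub, ]; congr 1; ring
    have h3 := hst τ (by linarith) h2
    have h4 := hst (π - r - τ) (by linarith) (by linarith)
    rw [e1, e2, mul_neg, ← sub_eq_add_neg, ← h3, ← h4]
    apply hsum _ _ (hmeas _) (hmeas _)
    intro u hu hX
    have hX : ‖hD.cc.pr u‖ < cos τ := not_le.1 hX
    show cos (π - r - τ) ≤ ‖hD.cc.pr (-u)‖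
    by_cases h0 : hD.cc.pr u = 0
    · by_contra! hlt
      have hu' : ‖-u‖ = 1 := by rw [norm_neg, hu]
      by_cases h0' : hD.cc.pr (-u) = 0
      · refine hD.no_orth hu fun z hz => le_antisymm ?_ ?_
        · have := hD.cc.pr_le u z (hD.mem_cone hz)
          rwa [h0, sub_zero] at this
        · have := hD.cc.pr_le (-u) z (hD.mem_cone hz)
          rw [h0', sub_zero, inner_neg_right] at this
          linarith
      · obtain ⟨z, hz, hz2⟩ := hD.far hu' (by linarith) (by linarith) hlt h0'
        rw [show π - r - τ + r = π - τ by ring, Real.cos_pi_sub, inner_neg_left] at hz2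
        have h5 := hD.cc.inner_pr (v := u) (hD.mem_cone hz) (hD.norm hz)
        rw [h0, norm_zero] at h5
        have : 0 < cos τ := Real.cos_pos_of_mem_Ioo ⟨by linarith, h2⟩
        linarith
    · obtain ⟨z, hz, hz2⟩ := hD.far hu (by linarith) h2 hX h0
      have h5 := hD.cc.inner_pr (v := -u) (hD.mem_cone hz) (hD.norm hz)
      rw [inner_neg_left] at h5
      rw [e2] at hz2
      linarith
  have hle : ∀ τ₁ τ, π / 2 - r < τ₁ → τ₁ < τ → τ < π / 2 →
      (k + P * sin τ₁ - Q * cos τ₁) + (k + P * sin (τ + r) + Q * cos (τ + r)) ≤ S := by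
    intro τ₁ τ h1 h12 h2
    have e1 : sin (τ + r) = sin (π - r - τ) := by
      rw [← Real.sin_pi_sub (τ + r)]; congr 1; ring
    have e2 : cos (τ + r) = -cos (π - r - τ) := by
      rw [← Real.cos_pi_sub, ]; congr 1; ring
    have h3 := hst τ₁ (by linarith) (by linarith)
    have h4 := hst (π - r - τ) (by linarith) (by linarith)
    rw [e1, e2, mul_neg, ← sub_eq_add_neg, ← h3, ← h4]
    apply hsum2 _ _ (hmeas _) (hmeas _)
    intro u hu hX hY
    have hX : cos τ₁ ≤ ‖hD.cc.pr u‖ := hX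
    have hY : cos (π - r - τ) ≤ ‖hD.cc.pr (-u)‖ := hY
    have hpos : 0 < cos (π - r - τ) := Real.cos_pos_of_mem_Ioo ⟨by linarith, by linarith⟩
    have hp0 : hD.cc.pr (-u) ≠ 0 := norm_pos_iff.1 (hpos.trans_le hY)
    have hpD := hD.nz_mem (hD.cc.pr_mem (-u)) hp0
    have h5 := hD.near hu (by linarith) (by linarith) hX hpD
    have h6 := hD.cc.inner_nz (-u) hp0
    rw [inner_neg_left] at h6
    have h7 : cos (τ + r) < cos (τ₁ + r) :=
      Real.cos_lt_cos_of_nonneg_of_le_pi (by linarith) (by linarith) (by linarith)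
    linarith
  have heq : ∀ τ, π / 2 - r < τ → τ < π / 2 →
      (k + P * sin τ - Q * cos τ) + (k + P * sin (τ + r) + Q * cos (τ + r)) = S := by
    intro τ h1 h2
    apply le_antisymm _ (hge τ h1 h2)
    have hc : Continuous fun t => (k + P * sin t - Q * cos t) + (k + P * sin (τ + r) + Q * cos (τ + r)) := by
      fun_prop
    have hlim := (hc.tendsto τ).mono_left (nhdsWithin_le_nhds (s := Set.Iio τ))
    refine le_of_tendsto hlim ?_
    filter_upwards [Ioo_mem_nhdsLT h1] with t ht
    exact hle t τ ht.1 ht.2 h2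
  have hform : ∀ τ, (k + P * sin τ - Q * cos τ) + (k + P * sin (τ + r) + Q * cos (τ + r)) =
      2 * k + 2 * sin (τ + r / 2) * (P * cos (r / 2) - Q * sin (r / 2)) := by
    intro τ
    have e1 : sin τ = sin (τ + r / 2) * cos (r / 2) - cos (τ + r / 2) * sin (r / 2) := by
      rw [← Real.sin_sub]; congr 1; ring
    have e2 : cos τ = cos (τ + r / 2) * cos (r / 2) + sin (τ + r / 2) * sin (r / 2) := by
      rw [← Real.cos_sub]; congr 1; ring
    have e3 : sin (τ + r) = sin (τ + r / 2) * cos (r / 2) + cos (τ + r / 2) * sin (r / 2) := by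
      rw [← Real.sin_add]; congr 1; ring
    have e4 : cos (τ + r) = cos (τ + r / 2) * cos (r / 2) - sin (τ + r / 2) * sin (r / 2) := by
      rw [← Real.cos_add]; congr 1; ring
    rw [e1, e2, e3, e4]; ring
  have q1 := heq (π / 2 - r / 2) (by linarith) (by linarith)
  have q2 := heq (π / 2 - r / 4) (by linarith) (by linarith)
  rw [hform, sub_add_cancel, Real.sin_pi_div_two] at q1
  rw [hform, show π / 2 - r / 4 + r / 2 = π / 2 - (-(r / 4)) by ring, Real.sin_pi_div_two_sub, Real.cos_neg] at q2
  have hlt : cos (r / 4) < 1 := by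
    have := Real.cos_lt_cos_of_nonneg_of_le_pi (le_refl 0) (show r / 4 ≤ π by linarith) (by linarith)
    rwa [Real.cos_zero] at this
  have hz : P * cos (r / 2) - Q * sin (r / 2) = 0 := by
    have : (1 - cos (r / 4)) * (P * cos (r / 2) - Q * sin (r / 2)) = 0 := by linarith
    rcases mul_eq_zero.1 this with h | h
    · linarith
    · exact h
  rw [hz] at q1
  have hc2 : 0 < cos (r / 2) := Real.cos_pos_of_mem_Ioo ⟨by linarith, by linarith⟩
  have hP : P = Q * (sin (r / 2) / cos (r / 2)) := by field_simp; linarith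
  rw [hLk, hDk, Real.tan_eq_sin_div_cos]
  have er : cos r = 2 * cos (r / 2) ^ 2 - 1 := by rw [← Real.cos_two_mul]; congr 1; ring
  have es : sin r = 2 * sin (r / 2) * cos (r / 2) := by rw [← Real.sin_two_mul]; congr 1; ring
  rw [hP, er, es]
  have : k = S / 2 := by linarith
  rw [this]
  field_simp
  ring

end SphericalPal

namespace SphericalPal

/-! ### areas of sectors -/

/-- planar coordinate in a frame -/
def pc (b : OrthonormalBasis (Fin 3) ℝ (E 2)) (x : E 2) : ℂ := ⟨⟪b 0, x⟫, ⟪b 1, x⟫⟩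

/-- coordinates in a frame -/
def fr (b : OrthonormalBasis (Fin 3) ℝ (E 2)) (x : E 2) : ℝ × ℂ := (⟪b 2, x⟫, pc b x)

lemma fr_mp (b : OrthonormalBasis (Fin 3) ℝ (E 2)) : MeasurePreserving (fr b) := by
  have h1 := b.measurePreserving_repr
  have h2 := PiLp.volume_preserving_ofLp (Fin 3)
  have h3 := volume_preserving_piFinSuccAbove (fun _ : Fin 3 => ℝ) 2
  have h4 := (MeasurePreserving.id (volume : Measure ℝ)).prod
    (Complex.volume_preserving_equiv_pi.symm)
  have h5 := h4.comp (h3.comp (h2.comp h1))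
  have e : fr b = Prod.map id ⇑Complex.measurableEquivPi.symm ∘
      ⇑(MeasurableEquiv.piFinSuccAbove (fun _ : Fin 3 => ℝ) 2) ∘ WithLp.ofLp ∘ ⇑b.repr := by
    funext x
    refine Prod.ext ?_ (Complex.ext ?_ ?_)
    · exact (b.repr_apply_apply x 2).symm
    · change ⟪b 0, x⟫ = (Complex.measurableEquivPi.symm (fun j => b.repr x (Fin.succAbove 2 j))).re
      rw [Complex.measurableEquivPi_symm_apply, ← b.repr_apply_apply]
      simp [Fin.succAbove]
    · change ⟪b 1, x⟫ = (Complex.measurableEquivPi.symm (fun j => b.repr x (Fin.succAbove 2 j))).im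
      rw [Complex.measurableEquivPi_symm_apply, ← b.repr_apply_apply]
      simp [Fin.succAbove]
  rw [e]
  exact h5

lemma pc_cont (b : OrthonormalBasis (Fin 3) ℝ (E 2)) : Continuous (pc b) := by
  have : pc b = fun x => Complex.equivRealProdCLM.symm (⟪b 0, x⟫, ⟪b 1, x⟫) := by
    funext x; apply Complex.ext <;> simp [pc, Complex.equivRealProdCLM_symm_apply]
  rw [this]; fun_prop

lemma pc_smul (b : OrthonormalBasis (Fin 3) ℝ (E 2)) (t : ℝ) (x : E 2) :
    pc b (t • x) = t * pc b x := by
  apply Complex.ext <;> simp [pc, inner_smul_right]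

lemma fr_norm (b : OrthonormalBasis (Fin 3) ℝ (E 2)) (x : E 2) :
    ‖x‖ ^ 2 = ⟪b 2, x⟫ ^ 2 + ‖pc b x‖ ^ 2 := by
  rw [← b.sum_sq_inner_right x, Fin.sum_univ_three, ← Complex.normSq_eq_norm_sq, Complex.normSq_apply]
  simp only [pc]; ring

/-- volume of a radial slice -/
lemma slice_int {h : ℝ} (h0 : 0 < h) (h1 : h < 1) :
    ∫⁻ s in Set.Ioi (0 : ℝ), ENNReal.ofReal s *
      ENNReal.ofReal (√(1 - s ^ 2) - s * h / √(1 - h ^ 2)) = ENNReal.ofReal ((1 - h) / 3) := by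
  set s0 := √(1 - h ^ 2) with hs0
  have hpos : 0 < s0 := Real.sqrt_pos.2 (by nlinarith)
  have hsq : s0 ^ 2 = 1 - h ^ 2 := Real.sq_sqrt (by nlinarith)
  have hs1 : s0 < 1 := by nlinarith
  have hnn : ∀ s ∈ Set.Ioc 0 s0, 0 ≤ √(1 - s ^ 2) - s * h / s0 := by
    intro s hs
    have h3 : s * h / s0 ≤ h := by
      rw [div_le_iff₀ hpos]; nlinarith [hs.2]
    have h4 : h ≤ √(1 - s ^ 2) := Real.le_sqrt_of_sq_le (by nlinarith [hs.1, hs.2])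
    linarith
  have hneg : ∀ s ∈ Set.Ioi s0, √(1 - s ^ 2) - s * h / s0 ≤ 0 := by
    intro s hs
    have hs : s0 < s := hs
    have h3 : h ≤ s * h / s0 := by
      rw [le_div_iff₀ hpos]; nlinarith
    have h4 : √(1 - s ^ 2) ≤ h := by
      apply Real.sqrt_le_iff.2 ⟨h0.le, by nlinarith⟩
    linarith
  rw [← Set.Ioc_union_Ioi_eq_Ioi hpos.le, lintegral_union measurableSet_Ioi (Set.Ioc_disjoint_Ioi le_rfl)]
  have e2 : ∫⁻ s in Set.Ioi s0, ENNReal.ofReal s * ENNReal.ofReal (√(1 - s ^ 2) - s * h / s0) = 0 := by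
    rw [setLIntegral_congr_fun (g := fun _ => 0) measurableSet_Ioi]
    · simp
    · intro s hs
      simp only [ENNReal.ofReal_of_nonpos (hneg s hs), mul_zero]
  rw [e2, add_zero]
  have e1 : ∫⁻ s in Set.Ioc 0 s0, ENNReal.ofReal s * ENNReal.ofReal (√(1 - s ^ 2) - s * h / s0)
      = ∫⁻ s in Set.Ioc 0 s0, ENNReal.ofReal (s * (√(1 - s ^ 2) - s * h / s0)) := by
    apply setLIntegral_congr_fun measurableSet_Ioc
    intro s hs
    simp only [ENNReal.ofReal_mul hs.1.le]
  have hc : Continuous (fun s : ℝ => s * (√(1 - s ^ 2) - s * h / s0)) := by fun_prop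
  rw [e1, ← ofReal_integral_eq_lintegral_ofReal, ← intervalIntegral.integral_of_le hpos.le]
  · congr 1
    have hd : ∀ s ∈ Set.uIcc 0 s0, HasDerivAt
        (fun s : ℝ => -(√(1 - s ^ 2)) ^ 3 / 3 - s ^ 3 * h / (3 * s0))
        (s * (√(1 - s ^ 2) - s * h / s0)) s := by
      intro s hs
      rw [Set.uIcc_of_le hpos.le] at hs
      have hp : 0 < 1 - s ^ 2 := by nlinarith [hs.1, hs.2]
      have d1 : HasDerivAt (fun s : ℝ => 1 - s ^ 2) (-(2 * s)) s := by
        simpa using ((hasDerivAt_id s).pow 2).const_sub 1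
      have d2 := (((d1.sqrt hp.ne').pow 3).neg.div_const 3).sub
        ((((hasDerivAt_id s).pow 3).mul_const h).div_const (3 * s0))
      refine d2.congr_deriv ?_
      have := (Real.sqrt_pos.2 hp).ne'
      simp only [id]
      field_simp
      norm_num
      ring
    rw [intervalIntegral.integral_eq_sub_of_hasDerivAt hd (hc.intervalIntegrable _ _)]
    have : √(1 - s0 ^ 2) = h := by
      rw [hsq]; simp [Real.sqrt_sq h0.le]
    rw [this]
    simp
    field_simp
    rw [hsq]; ring
  · exact (hc.integrableOn_Icc).mono_set Set.Ioc_subset_Icc_self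
  · exact (ae_restrict_iff' measurableSet_Ioc).2 (Filter.Eventually.of_forall fun s hs =>
      mul_nonneg hs.1.le (hnn s hs))

lemma slice_set {h s : ℝ} (h0 : 0 < h) (h1 : h < 1) (hs : 0 < s) :
    {z : ℝ | z ^ 2 + s ^ 2 ≤ 1 ∧ h * √(z ^ 2 + s ^ 2) ≤ z} =
      Set.Icc (s * h / √(1 - h ^ 2)) (√(1 - s ^ 2)) := by
  have hpos : 0 < √(1 - h ^ 2) := Real.sqrt_pos.2 (by nlinarith)
  have hsq : √(1 - h ^ 2) ^ 2 = 1 - h ^ 2 := Real.sq_sqrt (by nlinarith)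
  set s0 := √(1 - h ^ 2)
  ext z
  simp only [Set.mem_ofPred_eq, Set.mem_Icc]
  rw [div_le_iff₀ hpos]
  have hn : 0 ≤ √(z ^ 2 + s ^ 2) := Real.sqrt_nonneg _
  have hnsq : √(z ^ 2 + s ^ 2) ^ 2 = z ^ 2 + s ^ 2 := Real.sq_sqrt (by positivity)
  constructor
  · rintro ⟨h2, h3⟩
    have hz : 0 ≤ z := le_trans (by positivity) h3
    refine ⟨?_, Real.le_sqrt_of_sq_le (by linarith)⟩
    refine (pow_le_pow_iff_left₀ (by positivity) (by positivity) two_ne_zero).1 ?_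
    have : (h * √(z ^ 2 + s ^ 2)) ^ 2 ≤ z ^ 2 := by gcongr
    rw [mul_pow, hnsq] at this
    rw [mul_pow, mul_pow, hsq]; nlinarith
  · rintro ⟨h2, h3⟩
    have hz : 0 < z := by
      by_contra! hz
      nlinarith [mul_pos hs h0]
    have h5 : z ^ 2 ≤ 1 - s ^ 2 := by
      have h6 : 0 < √(1 - s ^ 2) := lt_of_lt_of_le hz h3
      have h7 := Real.sqrt_pos.1 h6
      calc z ^ 2 ≤ √(1 - s ^ 2) ^ 2 := by gcongr
        _ = _ := Real.sq_sqrt h7.le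
    refine ⟨by linarith, ?_⟩
    refine (pow_le_pow_iff_left₀ (by positivity) (by positivity) two_ne_zero).1 ?_
    rw [mul_pow, hnsq]
    have : (s * h) ^ 2 ≤ (z * s0) ^ 2 := by gcongr
    rw [mul_pow, mul_pow, hsq] at this
    nlinarith

/-- region above the graph of a height function -/
def sect (b : OrthonormalBasis (Fin 3) ℝ (E 2)) (Θ : Set ℝ) (H : ℝ → ℝ) : Set (E 2) :=
  {x | (pc b x).arg ∈ Θ ∧ H (pc b x).arg ≤ ⟪b 2, x⟫}

lemma sect_meas (b : OrthonormalBasis (Fin 3) ℝ (E 2)) {Θ : Set ℝ} (hΘ : MeasurableSet Θ)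
    {H : ℝ → ℝ} (hH : Measurable H) : MeasurableSet (sect b Θ H) := by
  have h1 : Measurable fun x => (pc b x).arg := Complex.measurable_arg.comp (pc_cont b).measurable
  exact (h1 hΘ).inter (measurableSet_le (hH.comp h1) (by fun_prop))

lemma sm_sect (b : OrthonormalBasis (Fin 3) ℝ (E 2)) {Θ : Set ℝ} (hΘ : MeasurableSet Θ)
    {H : ℝ → ℝ} (hH : Measurable H) (h0 : ∀ t, 0 < H t) (h1 : ∀ t, H t < 1) :
    sm (sect b Θ H) = ∫⁻ θ in Set.Ioo (-π) π ∩ Θ, ENNReal.ofReal ((1 - H θ) / 3) := by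
  let T : Set (ℝ × ℂ) := {p | p ≠ 0 ∧ p.1 ^ 2 + ‖p.2‖ ^ 2 ≤ 1 ∧ p.2.arg ∈ Θ ∧
    H p.2.arg * √(p.1 ^ 2 + ‖p.2‖ ^ 2) ≤ p.1}
  have ha : Measurable fun p : ℝ × ℂ => p.2.arg := Complex.measurable_arg.comp measurable_snd
  have hT : MeasurableSet T := by
    have m1 : Measurable fun p : ℝ × ℂ => p.1 ^ 2 + ‖p.2‖ ^ 2 := by fun_prop
    exact (measurableSet_singleton (0 : ℝ × ℂ)).compl.inter (MeasurableSet.inter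
      (measurableSet_le m1 measurable_const) (MeasurableSet.inter (ha hΘ)
      (measurableSet_le ((hH.comp ha).mul m1.sqrt) measurable_fst)))
  have hset : nz ⁻¹' (sect b Θ H) ∩ pball = fr b ⁻¹' T := by
    ext x
    have hn := fr_norm b x
    have hsq : √(⟪b 2, x⟫ ^ 2 + ‖pc b x‖ ^ 2) = ‖x‖ := by rw [← hn, Real.sqrt_sq (norm_nonneg x)]
    have hz : fr b x = 0 ↔ x = 0 := by
      constructor
      · intro h
        have e1 : ⟪b 2, x⟫ = 0 := congrArg Prod.fst h
        have e2 : pc b x = 0 := congrArg Prod.snd h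
        rw [e1, e2] at hn
        simpa using hn
      · rintro rfl
        refine Prod.ext ?_ (Complex.ext ?_ ?_) <;> simp [fr, pc]
    change (((pc b (nz x)).arg ∈ Θ ∧ H (pc b (nz x)).arg ≤ ⟪b 2, nz x⟫) ∧ x ≠ 0 ∧ ‖x‖ ≤ 1) ↔
      (fr b x ≠ 0 ∧ ⟪b 2, x⟫ ^ 2 + ‖pc b x‖ ^ 2 ≤ 1 ∧ (pc b x).arg ∈ Θ ∧
        H (pc b x).arg * √(⟪b 2, x⟫ ^ 2 + ‖pc b x‖ ^ 2) ≤ ⟪b 2, x⟫)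
    rw [hsq, ← hn, ne_eq (fr b x), hz]
    by_cases hx : x = 0
    · simp [hx]
    have hpos : 0 < ‖x‖ := norm_pos_iff.2 hx
    have e3 : (pc b (nz x)).arg = (pc b x).arg := by
      rw [nz, pc_smul, Complex.arg_real_mul _ (by positivity)]
    have e4 : ⟪b 2, nz x⟫ = ⟪b 2, x⟫ / ‖x‖ := by rw [nz, inner_smul_right]; field_simp
    rw [e3, e4, le_div_iff₀ hpos, sq_le_one_iff₀ hpos.le]
    tauto
  rw [sm_apply (sect_meas b hΘ hH), hset, (fr_mp b).measure_preimage hT.nullMeasurableSet]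
  change (volume : Measure ℝ).prod (volume : Measure ℂ) T = _
  rw [Measure.prod_apply_symm hT, ← Complex.lintegral_comp_polarCoord_symm]
  have hval : ∀ p ∈ polarCoord.target, ENNReal.ofReal p.1 •
      (volume : Measure ℝ) ((fun x => (x, Complex.polarCoord.symm p)) ⁻¹' T) =
      Set.indicator Θ (fun θ => ENNReal.ofReal p.1 *
        ENNReal.ofReal (√(1 - p.1 ^ 2) - p.1 * H θ / √(1 - H θ ^ 2))) p.2 := by
    rintro ⟨s, θ⟩ ⟨hs, hθ⟩
    have hs : 0 < s := hs
    have harg : (Complex.polarCoord.symm (s, θ)).arg = θ := by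
      rw [Complex.polarCoord_symm_apply]
      push_cast
      rw [Complex.arg_mul_cos_add_sin_mul_I hs ⟨hθ.1, hθ.2.le⟩]
    have hnorm : ‖Complex.polarCoord.symm (s, θ)‖ = s := by
      rw [Complex.norm_polarCoord_symm, abs_of_pos hs]
    have hne : Complex.polarCoord.symm (s, θ) ≠ 0 := by
      rw [← norm_pos_iff, hnorm]; exact hs
    by_cases hm : θ ∈ Θ
    · rw [Set.indicator_of_mem hm]
      have : (fun x => (x, Complex.polarCoord.symm (s, θ))) ⁻¹' T =
          {z : ℝ | z ^ 2 + s ^ 2 ≤ 1 ∧ H θ * √(z ^ 2 + s ^ 2) ≤ z} := by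
        ext z
        change ((z, Complex.polarCoord.symm (s, θ)) ≠ 0 ∧
          z ^ 2 + ‖Complex.polarCoord.symm (s, θ)‖ ^ 2 ≤ 1 ∧
          (Complex.polarCoord.symm (s, θ)).arg ∈ Θ ∧ H (Complex.polarCoord.symm (s, θ)).arg *
          √(z ^ 2 + ‖Complex.polarCoord.symm (s, θ)‖ ^ 2) ≤ z) ↔ _
        rw [harg, hnorm]
        have : (z, Complex.polarCoord.symm (s, θ)) ≠ 0 := fun h => hne (congrArg Prod.snd h)
        change _ ↔ (z ^ 2 + s ^ 2 ≤ 1 ∧ H θ * √(z ^ 2 + s ^ 2) ≤ z)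
        tauto
      rw [this, slice_set (h0 θ) (h1 θ) hs, Real.volume_Icc, smul_eq_mul]
    · rw [Set.indicator_of_notMem hm]
      have : (fun x => (x, Complex.polarCoord.symm (s, θ))) ⁻¹' T = ∅ := by
        ext z
        refine ⟨fun h => ?_, fun h => h.elim⟩
        have h : (Complex.polarCoord.symm (s, θ)).arg ∈ Θ := h.2.2.1
        rw [harg] at h
        exact hm h
      rw [this]; simp
  rw [setLIntegral_congr_fun polarCoord.open_target.measurableSet hval]
  have htar : polarCoord.target = Set.Ioi (0 : ℝ) ×ˢ Set.Ioo (-π) π := rfl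
  have hmeas : Measurable fun p : ℝ × ℝ => Set.indicator Θ (fun θ => ENNReal.ofReal p.1 *
        ENNReal.ofReal (√(1 - p.1 ^ 2) - p.1 * H θ / √(1 - H θ ^ 2))) p.2 := by
    have e : (fun p : ℝ × ℝ => Set.indicator Θ (fun θ => ENNReal.ofReal p.1 *
        ENNReal.ofReal (√(1 - p.1 ^ 2) - p.1 * H θ / √(1 - H θ ^ 2))) p.2) =
        Set.indicator (Prod.snd ⁻¹' Θ) (fun p : ℝ × ℝ => ENNReal.ofReal p.1 *
        ENNReal.ofReal (√(1 - p.1 ^ 2) - p.1 * H p.2 / √(1 - H p.2 ^ 2))) := by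
      funext p
      by_cases hm : p.2 ∈ Θ
      · rw [Set.indicator_of_mem hm, Set.indicator_of_mem (show p ∈ Prod.snd ⁻¹' Θ from hm)]
      · rw [Set.indicator_of_notMem hm, Set.indicator_of_notMem (show p ∉ Prod.snd ⁻¹' Θ from hm)]
    rw [e]
    exact Measurable.indicator (by fun_prop) (measurable_snd hΘ)
  rw [htar, Measure.volume_eq_prod, ← Measure.prod_restrict, lintegral_prod_symm' _ hmeas]
  have hin : ∀ θ : ℝ, ∫⁻ s in Set.Ioi (0 : ℝ), Set.indicator Θ (fun θ => ENNReal.ofReal s *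
        ENNReal.ofReal (√(1 - s ^ 2) - s * H θ / √(1 - H θ ^ 2))) θ =
        Set.indicator Θ (fun θ => ENNReal.ofReal ((1 - H θ) / 3)) θ := by
    intro θ
    by_cases hm : θ ∈ Θ
    · simp only [Set.indicator_of_mem hm]
      exact slice_int (h0 θ) (h1 θ)
    · simp only [Set.indicator_of_notMem hm, lintegral_zero]
  simp only [hin]
  rw [lintegral_indicator hΘ, Measure.restrict_restrict hΘ, Set.inter_comm]

lemma sm_sect' (b : OrthonormalBasis (Fin 3) ℝ (E 2)) {Θ : Set ℝ} (hΘ : MeasurableSet Θ)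
    {H : ℝ → ℝ} (hH : Measurable H) (h0 : ∀ t ∈ Θ, 0 < H t) (h1 : ∀ t ∈ Θ, H t < 1) :
    sm (sect b Θ H) = ∫⁻ θ in Set.Ioo (-π) π ∩ Θ, ENNReal.ofReal ((1 - H θ) / 3) := by
  classical
  let H' : ℝ → ℝ := fun t => if t ∈ Θ then H t else 1 / 2
  have hH' : Measurable H' := Measurable.ite hΘ hH measurable_const
  have e : sect b Θ H = sect b Θ H' := by
    ext x
    change (_ ∧ _) ↔ (_ ∧ _)
    refine and_congr_right fun hx => ?_
    change _ ↔ (if _ then _ else _) ≤ _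
    rw [if_pos hx]
  rw [e, sm_sect b hΘ hH']
  · apply setLIntegral_congr_fun (measurableSet_Ioo.inter hΘ)
    intro t ht
    simp only [H', if_pos ht.2]
  · intro t
    by_cases ht : t ∈ Θ
    · simpa only [H', if_pos ht] using h0 t ht
    · simp only [H', if_neg ht]; norm_num
  · intro t
    by_cases ht : t ∈ Θ
    · simpa only [H', if_pos ht] using h1 t ht
    · simp only [H', if_neg ht]; norm_num

lemma sm_sect_int (b : OrthonormalBasis (Fin 3) ℝ (E 2)) {ψ : ℝ} (hψ0 : 0 < ψ) (hψ : ψ ≤ π)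
    {H : ℝ → ℝ} (hH : Continuous H) (h0 : ∀ t ∈ Set.Ioo (-ψ) ψ, 0 < H t)
    (h1 : ∀ t ∈ Set.Ioo (-ψ) ψ, H t < 1) :
    (sm (sect b (Set.Ioo (-ψ) ψ) H)).toReal = ∫ t in (-ψ)..ψ, (1 - H t) / 3 := by
  have hc : Continuous fun t => (1 - H t) / 3 := by fun_prop
  rw [sm_sect' b measurableSet_Ioo hH.measurable h0 h1, Set.inter_eq_right.2
    (Set.Ioo_subset_Ioo (by linarith) hψ), ← ofReal_integral_eq_lintegral_ofReal,
    intervalIntegral.integral_of_le (by linarith), integral_Ioc_eq_integral_Ioo,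
    ENNReal.toReal_ofReal]
  · apply setIntegral_nonneg measurableSet_Ioo
    intro t ht
    have := h1 t ht
    linarith
  · exact (hc.integrableOn_Icc).mono_set Set.Ioo_subset_Icc_self
  · refine (ae_restrict_iff' measurableSet_Ioo).2 (Filter.Eventually.of_forall fun t ht => ?_)
    have := h1 t ht
    change 0 ≤ (1 - H t) / 3
    linarith

lemma int_even' {f : ℝ → ℝ} (hf : Continuous f) {ψ : ℝ} (h : 0 ≤ ψ) :
    ∫ t in (-ψ)..ψ, f (ψ - |t|) = 2 * ∫ t in (0 : ℝ)..ψ, f t := by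
  have hc : Continuous fun t => f (ψ - |t|) := by fun_prop
  rw [← intervalIntegral.integral_add_adjacent_intervals (b := 0) (hc.intervalIntegrable _ _)
    (hc.intervalIntegrable _ _)]
  have e1 : ∫ t in (0 : ℝ)..ψ, f (ψ - |t|) = ∫ t in (0 : ℝ)..ψ, f t := by
    rw [intervalIntegral.integral_congr (g := fun t => f (ψ - t))]
    · simp
    · intro t ht
      rw [Set.uIcc_of_le h] at ht
      simp only [abs_of_nonneg ht.1]
  have e2 : ∫ t in (-ψ)..0, f (ψ - |t|) = ∫ t in (0 : ℝ)..ψ, f (ψ - |t|) := by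
    have := intervalIntegral.integral_comp_neg (a := 0) (b := ψ) (fun t => f (ψ - |t|))
    simp only [abs_neg, neg_zero] at this
    exact this.symm
  rw [e2, e1]; ring

/-- the symmetric spike -/
def spike (b : OrthonormalBasis (Fin 3) ℝ (E 2)) (ψ c : ℝ) (h : ℝ → ℝ) : Set (E 2) :=
  {x | |(pc b x).arg| < ψ ∧ h (ψ - |(pc b x).arg|) ≤ ⟪b 2, x⟫ ∧ ⟪b 2, x⟫ < c}

lemma spike_eq (b : OrthonormalBasis (Fin 3) ℝ (E 2)) (ψ c : ℝ) (h : ℝ → ℝ) :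
    spike b ψ c h = sect b (Set.Ioo (-ψ) ψ) (fun t => h (ψ - |t|)) \
      sect b (Set.Ioo (-ψ) ψ) (fun _ => c) := by
  ext x
  change (|(pc b x).arg| < ψ ∧ h (ψ - |(pc b x).arg|) ≤ ⟪b 2, x⟫ ∧ ⟪b 2, x⟫ < c) ↔
    (((pc b x).arg ∈ Set.Ioo (-ψ) ψ ∧ h (ψ - |(pc b x).arg|) ≤ ⟪b 2, x⟫) ∧
      ¬ ((pc b x).arg ∈ Set.Ioo (-ψ) ψ ∧ c ≤ ⟪b 2, x⟫))
  rw [abs_lt, Set.mem_Ioo, not_and, not_le]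
  tauto

lemma spike_meas (b : OrthonormalBasis (Fin 3) ℝ (E 2)) (ψ c : ℝ) {h : ℝ → ℝ} (hh : Continuous h) :
    MeasurableSet (spike b ψ c h) := by
  rw [spike_eq]
  exact (sect_meas b measurableSet_Ioo (by fun_prop)).diff (sect_meas b measurableSet_Ioo
    measurable_const)

lemma sm_spike (b : OrthonormalBasis (Fin 3) ℝ (E 2)) {ψ c : ℝ} (hψ0 : 0 < ψ) (hψ : ψ ≤ π)
    (hc : c < 1) {h : ℝ → ℝ} (hh : Continuous h) (h0 : ∀ t ∈ Set.Icc 0 ψ, 0 < h t ∧ h t ≤ c) :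
    (sm (spike b ψ c h)).toReal = 2 / 3 * (ψ * c - ∫ t in (0 : ℝ)..ψ, h t) := by
  have hmem : ∀ t ∈ Set.Ioo (-ψ) ψ, ψ - |t| ∈ Set.Icc 0 ψ := fun t ht => by
    have := abs_lt.2 ⟨ht.1, ht.2⟩
    exact ⟨by linarith, by linarith [abs_nonneg t]⟩
  have hc0 : 0 < c := by
    obtain ⟨h2, h3⟩ := h0 0 ⟨le_rfl, hψ0.le⟩
    linarith
  rw [spike_eq, measure_sdiff _ (sect_meas b measurableSet_Ioo measurable_const).nullMeasurableSet
    (measure_ne_top _ _), ENNReal.toReal_sub_of_le _ (measure_ne_top _ _)]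
  · rw [sm_sect_int b hψ0 hψ (by fun_prop) (fun t ht => (h0 _ (hmem t ht)).1)
      (fun t ht => (h0 _ (hmem t ht)).2.trans_lt hc),
      sm_sect_int b hψ0 hψ (by fun_prop) (fun t ht => hc0) (fun t ht => hc)]
    have := int_even' (f := fun t => (1 - h t) / 3) (by fun_prop) hψ0.le
    rw [this]
    have hi : ∀ a b, IntervalIntegrable h volume a b := fun a b => hh.intervalIntegrable a b
    rw [intervalIntegral.integral_div, intervalIntegral.integral_sub (by simp) (hi _ _)]
    simp
    ring
  · apply measure_mono
    rintro x ⟨h1, h2⟩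
    exact ⟨h1, (h0 _ (hmem _ h1)).2.trans h2⟩
  · rintro x ⟨h1, h2⟩
    exact ⟨h1, (h0 _ (hmem _ h1)).2.trans h2⟩

lemma exists_frame {f o : E 2} (hf : ‖f‖ = 1) (ho : ‖o‖ = 1) (hfo : ⟪f, o⟫ = 0) :
    ∃ b : OrthonormalBasis (Fin 3) ℝ (E 2), b 0 = f ∧ b 2 = o := by
  have hv : Orthonormal ℝ (Set.domRestrict {0, 2} (![f, 0, o] : Fin 3 → E 2)) := by
    constructor
    · rintro ⟨i, rfl | rfl⟩ 
      · exact hf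
      · exact ho
    · rintro ⟨i, rfl | rfl⟩ ⟨j, rfl | rfl⟩ hij
      · exact absurd rfl hij
      · exact hfo
      · exact (real_inner_comm _ _).trans hfo
      · exact absurd rfl hij
  obtain ⟨b, hb⟩ := hv.exists_orthonormalBasis_extension_of_card_eq (by simp)
  exact ⟨b, by simpa using hb 0 (by simp), by simpa using hb 2 (by simp)⟩

lemma exists_frame' {o : E 2} (ho : ‖o‖ = 1) :
    ∃ b : OrthonormalBasis (Fin 3) ℝ (E 2), b 2 = o := by
  have hv : Orthonormal ℝ (Set.domRestrict {2} (![0, 0, o] : Fin 3 → E 2)) := by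
    constructor
    · rintro ⟨i, rfl⟩; exact ho
    · rintro ⟨i, rfl⟩ ⟨j, rfl⟩ hij
      exact absurd rfl hij
  obtain ⟨b, hb⟩ := hv.exists_orthonormalBasis_extension_of_card_eq (by simp)
  exact ⟨b, by simpa using hb 2 (by simp)⟩

lemma sm_cap {o : E 2} (ho : ‖o‖ = 1) {c : ℝ} (h0 : 0 < c) (h1 : c < 1) :
    (sm {x | c ≤ ⟪o, x⟫}).toReal = 2 * π / 3 * (1 - c) := by
  obtain ⟨b, hb⟩ := exists_frame' ho
  have e : {x : E 2 | c ≤ ⟪o, x⟫} = sect b Set.univ fun _ => c := by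
    ext x
    change _ ↔ (_ ∧ c ≤ _)
    rw [hb]; simp
  rw [e, sm_sect b MeasurableSet.univ measurable_const (fun _ => h0) (fun _ => h1), Set.inter_univ,
    setLIntegral_const, Real.volume_Ioo, ENNReal.toReal_mul, ENNReal.toReal_ofReal (by linarith),
    ENNReal.toReal_ofReal (by linarith [Real.pi_pos])]
  ring

end SphericalPal

namespace SphericalPal

/-! ### the boundary arc in polar coordinates -/

/-- auxiliary function -/
def hP (r R t : ℝ) : ℝ := √(sin r ^ 2 - sin R ^ 2 * sin t ^ 2)

/-- height of the arc of the circle of radius `r` around a point at distance `R` from the pole -/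
def hh (r R t : ℝ) : ℝ :=
  (cos r * hP r R t + cos R * (sin R * cos t)) / (cos R * hP r R t + cos r * (sin R * cos t))

/-- admissible parameters -/
structure Par (r R : ℝ) : Prop where
  R0 : 0 < R
  Rr : R < r
  r2 : r < π / 2

variable {r R : ℝ}

namespace Par

lemma trig_id {A c C : ℝ} (h : C ^ 2 = 1 - (1 - A ^ 2) * c ^ 2) :
    (2 * c ^ 2 * A - 2 * c ^ 2 + 1) * (C + A * c) *
      (1 + (2 * C ^ 2 - 1) * A + 2 * C * c * (1 - A ^ 2)) =
    (A + 2 * C ^ 2 - 1) * (C + (2 * c ^ 2 - 1) * A * c + 2 * c * (1 - c ^ 2)) := by grind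

lemma tan_half' {x : ℝ} (h : 0 < cos (x / 2)) : tan (x / 2) = sin x / (1 + cos x) := by
  have e1 : sin x = 2 * sin (x / 2) * cos (x / 2) := by rw [← Real.sin_two_mul]; congr 1; ring
  have e2 : cos x = 2 * cos (x / 2) ^ 2 - 1 := by rw [← Real.cos_two_mul]; congr 1; ring
  rw [e1, e2, Real.tan_eq_sin_div_cos]
  field_simp
  ring

lemma sR (h : Par r R) : 0 < sin R := Real.sin_pos_of_pos_of_lt_pi h.R0 (by linarith [h.Rr, h.r2, Real.pi_pos])
lemma sr (h : Par r R) : 0 < sin r := Real.sin_pos_of_pos_of_lt_pi (h.R0.trans h.Rr) (by linarith [h.r2, Real.pi_pos])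
lemma cr (h : Par r R) : 0 < cos r := Real.cos_pos_of_mem_Ioo ⟨by linarith [h.R0, h.Rr, Real.pi_pos], h.r2⟩
lemma cRr (h : Par r R) : cos r < cos R :=
  Real.cos_lt_cos_of_nonneg_of_le_pi h.R0.le (by linarith [h.r2, Real.pi_pos]) h.Rr
lemma cR (h : Par r R) : 0 < cos R := h.cr.trans h.cRr
lemma sRr (h : Par r R) : sin R < sin r := by
  apply Real.sin_lt_sin_of_lt_of_le_pi_div_two <;> linarith [h.R0, h.r2, h.Rr, Real.pi_pos]

lemma P_arg_pos (h : Par r R) (t : ℝ) : 0 < sin r ^ 2 - sin R ^ 2 * sin t ^ 2 := by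
  have h1 := Real.sin_sq_le_one t
  have h2 := h.sR
  have h3 := h.sRr
  nlinarith [sq_nonneg (sin R)]

lemma P_sq (h : Par r R) (t : ℝ) : hP r R t ^ 2 = sin r ^ 2 - sin R ^ 2 * sin t ^ 2 :=
  Real.sq_sqrt (h.P_arg_pos t).le

lemma P_pos (h : Par r R) (t : ℝ) : 0 < hP r R t := Real.sqrt_pos.2 (h.P_arg_pos t)

lemma PQ (h : Par r R) (t : ℝ) : hP r R t ^ 2 - (sin R * cos t) ^ 2 = cos R ^ 2 - cos r ^ 2 := by
  rw [h.P_sq, mul_pow, Real.cos_sq' t, Real.cos_sq' R, Real.cos_sq' r]; ring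

lemma abs_Q (h : Par r R) (t : ℝ) : |sin R * cos t| < hP r R t := by
  apply abs_lt_of_sq_lt_sq _ (h.P_pos t).le
  have := h.PQ t
  nlinarith [h.cr, h.cRr]

lemma den_pos (h : Par r R) (t : ℝ) : 0 < cos R * hP r R t + cos r * (sin R * cos t) := by
  have h1 := abs_lt.1 (h.abs_Q t)
  nlinarith [h.cr, h.cRr, h.P_pos t]

lemma cont (h : Par r R) : Continuous (hh r R) := by
  unfold hh
  refine Continuous.div ?_ ?_ fun t => (h.den_pos t).ne'
  all_goals unfold hP; fun_prop

lemma hh_pos (h : Par r R) {t : ℝ} (ht : 0 ≤ cos t) : 0 < hh r R t := by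
  have := h.P_pos t
  have := h.den_pos t
  have := h.cr
  have := h.cR
  have := h.sR
  unfold hh
  positivity

lemma hh_le (h : Par r R) (t : ℝ) (ht : 0 ≤ cos t) : hh r R t ≤ cos (r - R) := by
  rw [hh, div_le_iff₀ (h.den_pos t)]
  have hsin : 0 < sin (r - R) := Real.sin_pos_of_pos_of_lt_pi (by linarith [h.Rr]) (by
    linarith [h.R0, h.r2, Real.pi_pos])
  have h1 : sin r * cos t ≤ hP r R t := by
    apply Real.le_sqrt_of_sq_le
    rw [mul_pow, Real.cos_sq' t]
    have : sin R ^ 2 ≤ sin r ^ 2 := by nlinarith [h.sR, h.sRr]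
    nlinarith [sq_nonneg (sin t)]
  have e1 : cos r - cos (r - R) * cos R = - sin R * sin (r - R) := by
    rw [Real.cos_sub, Real.sin_sub]
    have := Real.sin_sq_add_cos_sq R
    linear_combination (cos r) * (-1) * this
  have e2 : cos R - cos (r - R) * cos r = sin r * sin (r - R) := by
    rw [Real.cos_sub, Real.sin_sub]
    have := Real.sin_sq_add_cos_sq r
    linear_combination (cos R) * (-1) * this
  have : (cos r * hP r R t + cos R * (sin R * cos t)) -
      cos (r - R) * (cos R * hP r R t + cos r * (sin R * cos t)) =
      sin R * sin (r - R) * (sin r * cos t - hP r R t) := by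
    linear_combination hP r R t * e1 + sin R * cos t * e2
  have h3 : sin R * sin (r - R) * (sin r * cos t - hP r R t) ≤ 0 :=
    mul_nonpos_of_nonneg_of_nonpos (by have := h.sR; positivity) (by linarith)
  linarith

/-- the point of the arc -/
lemma hh_arc (h : Par r R) (t : ℝ) : ∃ s > 0, hh r R t ^ 2 + s ^ 2 = 1 ∧
    cos R * hh r R t - sin R * cos t * s = cos r := by
  have hd := h.den_pos t
  have hpq := h.PQ t
  refine ⟨(cos R ^ 2 - cos r ^ 2) / (cos R * hP r R t + cos r * (sin R * cos t)),
    div_pos (by nlinarith [h.cr, h.cRr]) hd, ?_, ?_⟩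
  · unfold hh
    rw [div_pow, div_pow, ← add_div, div_eq_one_iff_eq (by positivity)]
    linear_combination (cos r ^ 2 - cos R ^ 2) * hpq
  · unfold hh
    rw [mul_div_assoc', mul_div_assoc', ← sub_div, div_eq_iff hd.ne']
    ring

lemma arc_mono (h : Par r R) {q z s z' s' : ℝ} (hq : 0 ≤ q) (hs : 0 ≤ s) (hs' : 0 ≤ s')
    (h1 : z ^ 2 + s ^ 2 = 1) (h1' : z' ^ 2 + s' ^ 2 = 1) (hz : 0 ≤ z) (hzz : z < z') :
    cos R * z - q * s < cos R * z' - q * s' := by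
  have : s' ≤ s := by
    apply abs_le_of_sq_le_sq' _ hs |>.2
    nlinarith
  nlinarith [h.cR]

lemma hh_le_of (h : Par r R) {t z s : ℝ} (ht : 0 ≤ cos t) (hs : 0 ≤ s) (h1 : z ^ 2 + s ^ 2 = 1)
    (hc : cos r ≤ cos R * z - sin R * cos t * s) : hh r R t ≤ z := by
  obtain ⟨s', hs', e1, e2⟩ := h.hh_arc t
  have hq : 0 ≤ sin R * cos t := mul_nonneg h.sR.le ht
  by_contra! hlt
  have hz : 0 ≤ z := by
    by_contra! hz
    nlinarith [h.cr, h.cR, mul_nonneg hq hs]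
  have := h.arc_mono hq hs hs'.le h1 e1 hz hlt
  linarith

lemma hh_le_iff (h : Par r R) {t z s : ℝ} (ht : 0 ≤ cos t) (hs : 0 ≤ s) (h1 : z ^ 2 + s ^ 2 = 1)
    (hc : hh r R t ≤ z) : cos r ≤ cos R * z - sin R * cos t * s := by
  obtain ⟨s', hs', e1, e2⟩ := h.hh_arc t
  have hq : 0 ≤ sin R * cos t := mul_nonneg h.sR.le ht
  rcases hc.eq_or_lt with rfl | hlt
  · have : s = s' := by
      have : s ^ 2 = s' ^ 2 := by linarith
      exact (pow_left_inj₀ hs hs'.le two_ne_zero).1 this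
    rw [this, e2]
  · have := h.arc_mono hq hs'.le hs e1 h1 (h.hh_pos ht).le hlt
    linarith

lemma alg {A B P Q : ℝ} (hB : 0 < B) (hA : B < A) (hP : |Q| < P) (e : P ^ 2 - Q ^ 2 = A ^ 2 - B ^ 2) :
    Q / P + B * ((1 - Q / P) * ((A + B) / (A * (A + B) - Q * (P - Q)))) =
      (B * P + A * Q) / (A * P + B * Q) := by
  have h1 := abs_lt.1 hP
  have hP0 : 0 < P := lt_of_le_of_lt (abs_nonneg _) hP
  have hd : 0 < A * P + B * Q := by nlinarith
  have hpq : 0 < P - Q := by linarith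
  have e2 : A * (A + B) - Q * (P - Q) = (P - Q) * (A * P + B * Q) / (A - B) := by
    rw [eq_div_iff (by linarith)]
    linear_combination (-A) * e
  have hAB : 0 < A - B := by linarith
  have e3 : (1 - Q / P) * ((A + B) / (A * (A + B) - Q * (P - Q))) =
      (A ^ 2 - B ^ 2) / (P * (A * P + B * Q)) := by
    rw [e2, one_sub_div hP0.ne', div_div_eq_mul_div, div_mul_div_comm, div_eq_div_iff
      (mul_pos hP0 (mul_pos hpq hd)).ne' (mul_pos hP0 hd).ne']
    ring
  rw [e3, mul_div_assoc', div_add_div _ _ hP0.ne' (mul_pos hP0 hd).ne', div_eq_div_iff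
    (mul_pos hP0 (mul_pos hP0 hd)).ne' hd.ne']
  linear_combination (-B * P * (A * P + B * Q)) * e

end Par

/-- the angle at the arc point -/
def hη (r R t : ℝ) : ℝ := arcsin (sin R / sin r * sin t)

/-- Napier constant -/
def hk (r R : ℝ) : ℝ := (cos R + cos r) / (1 + cos (r - R))

/-- the primitive of `hh` -/
def hF (r R t : ℝ) : ℝ := hη r R t + cos r * (2 * arctan (tan ((t - hη r R t) / 2) / hk r R))

namespace Par

lemma q_lt (h : Par r R) (t : ℝ) : |sin R / sin r * sin t| < 1 := by
  rw [abs_mul]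
  have h1 := Real.abs_sin_le_one t
  have h2 : |sin R / sin r| < 1 := by
    rw [abs_of_pos (div_pos h.sR h.sr), div_lt_one h.sr]; exact h.sRr
  nlinarith [abs_nonneg (sin t), abs_nonneg (sin R / sin r)]

lemma sin_η (h : Par r R) (t : ℝ) : sin (hη r R t) = sin R / sin r * sin t := by
  have := abs_lt.1 (h.q_lt t)
  exact Real.sin_arcsin this.1.le this.2.le

lemma cos_η (h : Par r R) (t : ℝ) : cos (hη r R t) = hP r R t / sin r := by
  rw [hη, Real.cos_arcsin, hP, ← Real.sqrt_sq h.sr.le, ← Real.sqrt_div (by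
    rw [Real.sqrt_sq h.sr.le]; exact (h.P_arg_pos t).le), Real.sqrt_sq h.sr.le]
  congr 1
  have := h.sr.ne'
  field_simp

lemma den1 (h : Par r R) : 0 < 1 + cos (r - R) := by
  have : 0 < cos (r - R) := Real.cos_pos_of_mem_Ioo ⟨by linarith [h.Rr, Real.pi_pos], by linarith [h.r2, h.R0]⟩
  linarith

lemma k_pos (h : Par r R) : 0 < hk r R := div_pos (by linarith [h.cR, h.cr]) h.den1

lemma k_sq (h : Par r R) : hk r R ^ 2 = (1 + cos (r + R)) / (1 + cos (r - R)) := by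
  rw [hk, div_pow, div_eq_div_iff (by have := h.den1; positivity) h.den1.ne', Real.cos_add,
    Real.cos_sub]
  have h1 := Real.sin_sq_add_cos_sq R
  have h2 := Real.sin_sq_add_cos_sq r
  have e : (cos R + cos r) ^ 2 = (1 + (cos r * cos R - sin r * sin R)) *
      (1 + (cos r * cos R + sin r * sin R)) := by
    linear_combination sin r ^ 2 * h1 + (1 - cos R ^ 2) * h2
  rw [e]; ring

lemma hF_deriv (h : Par r R) {t : ℝ} (h0 : -(π / 2) < t) (h1 : t < π / 2) :
    HasDerivAt (hF r R) (hh r R t) t := by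
  have hq := abs_lt.1 (h.q_lt t)
  have hPp := h.P_pos t
  have d1 : HasDerivAt (hη r R) (sin R * cos t / hP r R t) t := by
    have := (Real.hasDerivAt_arcsin hq.1.ne' hq.2.ne).comp t
      ((Real.hasDerivAt_sin t).const_mul (sin R / sin r))
    refine this.congr_deriv ?_
    rw [← Real.cos_arcsin, ← hη, h.cos_η]
    have := h.sr.ne'
    field_simp
  set u := (t - hη r R t) / 2 with hu
  have hη1 := Real.neg_pi_div_two_le_arcsin (sin R / sin r * sin t)
  have hη2 := Real.arcsin_le_pi_div_two (sin R / sin r * sin t)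
  have hcu : 0 < cos u := by
    apply Real.cos_pos_of_mem_Ioo
    rw [← hη] at hη1 hη2
    constructor <;> rw [hu] <;> linarith
  have d2 : HasDerivAt (fun t => (t - hη r R t) / 2) ((1 - sin R * cos t / hP r R t) / 2) t :=
    ((hasDerivAt_id t).sub d1).div_const 2
  have d3 := (((Real.hasDerivAt_tan hcu.ne').comp t d2).div_const (hk r R)).arctan
  have d4 := d1.add ((d3.const_mul 2).const_mul (cos r))
  refine d4.congr_deriv ?_
  have hk0 := h.k_pos
  have hC : cos (2 * u) = cos t * (hP r R t / sin r) + sin t * (sin R / sin r * sin t) := by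
    rw [← h.sin_η, ← h.cos_η, ← Real.cos_sub]; congr 1; rw [hu]; ring
  have e1 : 1 / (1 + (tan u / hk r R) ^ 2) * (1 / cos u ^ 2 *
      ((1 - sin R * cos t / hP r R t) / 2) / hk r R) =
      (1 - sin R * cos t / hP r R t) / 2 * (hk r R / (hk r R ^ 2 * cos u ^ 2 + sin u ^ 2)) := by
    have hd : 0 < hk r R ^ 2 * cos u ^ 2 + sin u ^ 2 := by positivity
    rw [Real.tan_eq_sin_div_cos]
    generalize (1 - sin R * cos t / hP r R t) / 2 = w
    have : 1 + (sin u / cos u / hk r R) ^ 2 =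
        (hk r R ^ 2 * cos u ^ 2 + sin u ^ 2) / (hk r R ^ 2 * cos u ^ 2) := by
      field_simp
    rw [this]
    field_simp
  have e2 : hk r R / (hk r R ^ 2 * cos u ^ 2 + sin u ^ 2) = (cos R + cos r) /
      (cos R * (cos R + cos r) - (sin R * cos t) * (hP r R t - sin R * cos t)) := by
    have hs2 : sin u ^ 2 = (1 - cos (2 * u)) / 2 := by
      rw [Real.cos_two_mul, Real.sin_sq]; ring
    have hc2 : cos u ^ 2 = (1 + cos (2 * u)) / 2 := by rw [Real.cos_two_mul]; ring
    have hd1 := h.den1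
    have e3 : hk r R ^ 2 * cos u ^ 2 + sin u ^ 2 = (cos R * (cos R + cos r) -
        (sin R * cos t) * (hP r R t - sin R * cos t)) / (1 + cos (r - R)) := by
      rw [h.k_sq, hs2, hc2, eq_div_iff hd1.ne', add_mul, div_mul_eq_mul_div, div_mul_cancel₀ _ hd1.ne',
        Real.cos_add, Real.cos_sub]
      have hs := h.sr.ne'
      have hC' : sin r * sin R * cos (2 * u) = sin R * cos t * hP r R t + sin R ^ 2 * sin t ^ 2 := by
        rw [hC]; field_simp
      have h3 := Real.sin_sq_add_cos_sq R
      have h4 := Real.sin_sq_add_cos_sq t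
      linear_combination (-1) * hC' - h3 - sin R ^ 2 * h4
    rw [e3, hk, div_div_div_cancel_right₀ hd1.ne']
  change sin R * cos t / hP r R t + cos r * (2 * (1 / (1 + (tan u / hk r R) ^ 2) * (1 / cos u ^ 2 *
      ((1 - sin R * cos t / hP r R t) / 2) / hk r R))) = _
  rw [e1, e2]
  have := alg h.cr h.cRr (h.abs_Q t) (h.PQ t)
  rw [hh, ← this]
  ring

lemma hh_int (h : Par r R) {ψ : ℝ} (h0 : 0 ≤ ψ) (h1 : ψ < π / 2) :
    ∫ t in (0 : ℝ)..ψ, hh r R t = hF r R ψ := by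
  rw [intervalIntegral.integral_eq_sub_of_hasDerivAt (f := hF r R)
    (fun t ht => ?_) (h.cont.intervalIntegrable _ _)]
  · simp [hF, hη]
  · rw [Set.uIcc_of_le h0] at ht
    exact h.hF_deriv (by linarith [ht.1, Real.pi_pos]) (by linarith [ht.2])

/-- value of the primitive at the vertex -/
lemma hF_val (h : Par r R) {ψ : ℝ} (h0 : 0 < ψ) (h1 : ψ < π / 2)
    (e : sin R * cos (ψ / 2) = sin (r / 2)) :
    hF r R ψ = (1 + cos r) * arcsin (sin (ψ / 2) / cos (r / 2)) := by
  have hc : 0 < cos (ψ / 2) := Real.cos_pos_of_mem_Ioo ⟨by linarith [Real.pi_pos], by linarith [Real.pi_pos]⟩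
  have hC : 0 < cos (r / 2) := Real.cos_pos_of_mem_Ioo ⟨by linarith [Real.pi_pos, h.R0, h.Rr], by linarith [Real.pi_pos, h.r2]⟩
  have hs : 0 < sin (ψ / 2) := Real.sin_pos_of_pos_of_lt_pi (by linarith) (by linarith [Real.pi_pos])
  have hS : 0 < sin (r / 2) := by rw [← e]; exact mul_pos h.sR hc
  have hr : sin r = 2 * sin (r / 2) * cos (r / 2) := by rw [← Real.sin_two_mul]; congr 1; ring
  have hψ : sin ψ = 2 * sin (ψ / 2) * cos (ψ / 2) := by rw [← Real.sin_two_mul]; congr 1; ring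
  have hη' : hη r R ψ = arcsin (sin (ψ / 2) / cos (r / 2)) := by
    rw [hη]
    congr 1
    rw [hr, hψ, ← e]
    have := h.sR
    field_simp
  have hsin := h.sin_η ψ
  have hsα : sin (hη r R ψ) = sin (ψ / 2) / cos (r / 2) := by
    rw [hsin, hr, hψ, ← e]
    have := h.sR
    field_simp
  have hcα : cos (hη r R ψ) = cos R * cos (ψ / 2) / cos (r / 2) := by
    have h2 : 0 ≤ cos (hη r R ψ) := Real.cos_arcsin_nonneg _
    have h3 := h.cR
    refine (pow_left_inj₀ h2 (by positivity) two_ne_zero).1 ?_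
    rw [Real.cos_sq', hsα, div_pow, div_pow, mul_pow, one_sub_div (by positivity)]
    congr 1
    have a1 := Real.sin_sq_add_cos_sq (ψ / 2)
    have a2 := Real.sin_sq_add_cos_sq (r / 2)
    have a3 := Real.sin_sq_add_cos_sq R
    rw [← e] at a2
    linear_combination a2 - a1 - cos (ψ / 2) ^ 2 * a3
  set α := hη r R ψ with hα
  have hα1 : α ≤ π / 2 := Real.arcsin_le_pi_div_two _
  have hα0 : 0 ≤ α := by
    rw [hη'] ; exact Real.arcsin_nonneg.2 (by positivity)
  have key : tan ((ψ - α) / 2) / hk r R = tan (α / 2) := by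
    have hc1 : 0 < cos (α / 2) :=
      Real.cos_pos_of_mem_Ioo ⟨by linarith [Real.pi_pos], by linarith [Real.pi_pos]⟩
    have hc2 : 0 < cos ((ψ - α) / 2) :=
      Real.cos_pos_of_mem_Ioo ⟨by linarith [Real.pi_pos], by linarith [Real.pi_pos]⟩
    have hd1 : 0 < 1 + cos α := by
      have : cos α = 2 * cos (α / 2) ^ 2 - 1 := by rw [← Real.cos_two_mul]; congr 1; ring
      rw [this]; nlinarith [sq_pos_of_pos hc1]
    have hd2 : 0 < 1 + cos (ψ - α) := by
      have : cos (ψ - α) = 2 * cos ((ψ - α) / 2) ^ 2 - 1 := by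
        rw [← Real.cos_two_mul]; congr 1; ring
      rw [this]; nlinarith [sq_pos_of_pos hc2]
    have hk0 := h.k_pos
    rw [div_eq_iff hk0.ne', tan_half' hc1, tan_half' hc2, hk, div_mul_div_comm,
      div_eq_div_iff hd2.ne' (mul_pos hd1 h.den1).ne', Real.sin_sub, Real.cos_sub, Real.cos_sub,
      hsα, hcα, hψ, hr]
    have b1 : cos ψ = 2 * cos (ψ / 2) ^ 2 - 1 := by rw [← Real.cos_two_mul]; congr 1; ring
    have b2 : cos r = 2 * cos (r / 2) ^ 2 - 1 := by rw [← Real.cos_two_mul]; congr 1; ring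
    have a1 := Real.sin_sq_add_cos_sq (ψ / 2)
    have a2 := Real.sin_sq_add_cos_sq (r / 2)
    have a3 := Real.sin_sq_add_cos_sq R
    rw [← e] at a2
    have a4 : cos (r / 2) ^ 2 = 1 - (1 - cos R ^ 2) * cos (ψ / 2) ^ 2 := by
      linear_combination a2 - cos (ψ / 2) ^ 2 * a3
    have a5 : sin (ψ / 2) ^ 2 = 1 - cos (ψ / 2) ^ 2 := by linarith
    have a6 : sin R ^ 2 = 1 - cos R ^ 2 := by linarith
    have id := trig_id a4
    rw [b1, b2, ← e]
    have hC0 := hC.ne'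
    field_simp
    generalize cos (ψ / 2) = c at *
    generalize cos (r / 2) = C at *
    generalize cos R = A at *
    generalize sin (ψ / 2) = s at *
    generalize sin R = q at *
    rw [a5, a6]
    linear_combination id
  rw [hF, ← hα, key, Real.arctan_tan (by linarith [Real.pi_pos]) (by linarith [Real.pi_pos]), ← hη']
  ring

end Par
end SphericalPal

namespace SphericalPal

/-! ### the lower bound as a function of the opening angle -/

/-- circumradius as a function of the opening angle -/
def gR (r ψ : ℝ) : ℝ := arcsin (sin (r / 2) / cos (ψ / 2))

/-- arc angle as a function of the opening angle -/
def gα (r ψ : ℝ) : ℝ := arcsin (sin (ψ / 2) / cos (r / 2))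

/-- the lower bound (three times the measure `sm`) -/
def gG (r ψ : ℝ) : ℝ :=
  2 * π * (1 - cos (r - gR r ψ)) + 6 * (ψ * cos (r - gR r ψ) - (1 + cos r) * gα r ψ)

section
variable {r ψ : ℝ}

lemma g_cr (h0 : 0 < r) (h1 : r < π / 2) : 1 / 2 < cos (r / 2) ^ 2 := by
  have : 0 < cos r := Real.cos_pos_of_mem_Ioo ⟨by linarith [Real.pi_pos], h1⟩
  rw [show r = 2 * (r / 2) by ring, Real.cos_two_mul] at this
  linarith

lemma g_cr0 (h0 : 0 < r) (h1 : r < π / 2) : 0 < cos (r / 2) :=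
  Real.cos_pos_of_mem_Ioo ⟨by linarith [Real.pi_pos], by linarith⟩

lemma g_sr0 (h0 : 0 < r) (h1 : r < π / 2) : 0 < sin (r / 2) :=
  Real.sin_pos_of_pos_of_lt_pi (by linarith) (by linarith [Real.pi_pos])

lemma g_cψ0 (h0 : 0 ≤ ψ) (h1 : ψ ≤ π / 3) : 0 < cos (ψ / 2) :=
  Real.cos_pos_of_mem_Ioo ⟨by linarith [Real.pi_pos], by linarith [Real.pi_pos]⟩

lemma g_cψ (h0 : 0 ≤ ψ) (h1 : ψ ≤ π / 3) : 3 / 4 ≤ cos (ψ / 2) ^ 2 := by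
  have : cos (π / 3) ≤ cos ψ := Real.cos_le_cos_of_nonneg_of_le_pi h0 (by linarith [Real.pi_pos]) h1
  rw [Real.cos_pi_div_three] at this
  rw [show ψ = 2 * (ψ / 2) by ring, Real.cos_two_mul] at this
  linarith

lemma g_lt (h0 : 0 < r) (h1 : r < π / 2) (h2 : 0 ≤ ψ) (h3 : ψ ≤ π / 3) :
    1 < 2 * cos (r / 2) * cos (ψ / 2) := by
  have a := g_cr h0 h1
  have b := g_cψ h2 h3
  have c := g_cr0 h0 h1
  have d := g_cψ0 h2 h3
  have : 1 < (2 * cos (r / 2) * cos (ψ / 2)) ^ 2 := by nlinarith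
  nlinarith [mul_pos c d]

lemma g_x1 (h0 : 0 < r) (h1 : r < π / 2) (h2 : 0 ≤ ψ) (h3 : ψ ≤ π / 3) :
    sin (r / 2) / cos (ψ / 2) < sin r := by
  rw [div_lt_iff₀ (g_cψ0 h2 h3), show sin r = 2 * sin (r / 2) * cos (r / 2) by
    rw [← Real.sin_two_mul]; congr 1; ring]
  nlinarith [g_lt h0 h1 h2 h3, g_sr0 h0 h1]

lemma g_x0 (h0 : 0 < r) (h1 : r < π / 2) (h2 : 0 ≤ ψ) (h3 : ψ ≤ π / 3) :
    0 < sin (r / 2) / cos (ψ / 2) := div_pos (g_sr0 h0 h1) (g_cψ0 h2 h3)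

lemma g_sinR (h0 : 0 < r) (h1 : r < π / 2) (h2 : 0 ≤ ψ) (h3 : ψ ≤ π / 3) :
    sin (gR r ψ) = sin (r / 2) / cos (ψ / 2) :=
  Real.sin_arcsin (by linarith [g_x0 h0 h1 h2 h3])
    (by linarith [g_x1 h0 h1 h2 h3, Real.sin_le_one r])

lemma g_par (h0 : 0 < r) (h1 : r < π / 2) (h2 : 0 ≤ ψ) (h3 : ψ ≤ π / 3) : Par r (gR r ψ) where
  R0 := Real.arcsin_pos.2 (g_x0 h0 h1 h2 h3)
  Rr := (Real.arcsin_lt_iff_lt_sin' ⟨by linarith [Real.pi_pos], h1.le⟩).2 (g_x1 h0 h1 h2 h3)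
  r2 := h1

lemma g_y1 (h0 : 0 < r) (h1 : r < π / 2) (h2 : 0 ≤ ψ) (h3 : ψ ≤ π / 3) :
    sin (ψ / 2) / cos (r / 2) < 1 := by
  rw [div_lt_one (g_cr0 h0 h1)]
  have a := g_cr h0 h1
  have b := g_cψ h2 h3
  have c := g_cr0 h0 h1
  have d := Real.sin_sq_add_cos_sq (ψ / 2)
  nlinarith

lemma g_y0 (h0 : 0 < r) (h1 : r < π / 2) (h2 : 0 ≤ ψ) (h3 : ψ ≤ π / 3) :
    0 ≤ sin (ψ / 2) / cos (r / 2) := by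
  have := g_cr0 h0 h1
  have : 0 ≤ sin (ψ / 2) := Real.sin_nonneg_of_nonneg_of_le_pi (by linarith) (by linarith [Real.pi_pos])
  positivity

lemma g_cosα (h0 : 0 < r) (h1 : r < π / 2) (h2 : 0 ≤ ψ) (h3 : ψ ≤ π / 3) :
    √(1 - (sin (ψ / 2) / cos (r / 2)) ^ 2) = cos (gR r ψ) * cos (ψ / 2) / cos (r / 2) := by
  have hc := g_cr0 h0 h1
  have hψ := g_cψ0 h2 h3
  have hR := (g_par h0 h1 h2 h3).cR
  rw [Real.sqrt_eq_iff_mul_self_eq_of_pos (by positivity)]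
  have e := g_sinR h0 h1 h2 h3
  rw [eq_div_iff hψ.ne'] at e
  have a1 := Real.sin_sq_add_cos_sq (ψ / 2)
  have a2 := Real.sin_sq_add_cos_sq (r / 2)
  have a3 := Real.sin_sq_add_cos_sq (gR r ψ)
  rw [← e] at a2
  field_simp
  linear_combination a1 - a2 + cos (ψ / 2) ^ 2 * a3

lemma gG_deriv (h0 : 0 < r) (h1 : r < π / 2) (h2 : 0 ≤ ψ) (h3 : ψ ≤ π / 3) :
    HasDerivAt (gG r) (-(2 * π - 6 * ψ) * (sin (r - gR r ψ) * (sin (r / 2) * sin (ψ / 2) /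
      (2 * cos (ψ / 2) ^ 2) / cos (gR r ψ))) + 6 * (cos (r - gR r ψ) -
      (1 + cos r) / (2 * cos (gR r ψ)))) ψ := by
  have hp := g_par h0 h1 h2 h3
  have hc := g_cr0 h0 h1
  have hψ := g_cψ0 h2 h3
  have hR := hp.cR
  have hhalf : HasDerivAt (fun x : ℝ => x / 2) (1 / 2) ψ := (hasDerivAt_id ψ).div_const 2
  have dc : HasDerivAt (fun x : ℝ => cos (x / 2)) (-sin (ψ / 2) * (1 / 2)) ψ := hhalf.cos
  have ds : HasDerivAt (fun x : ℝ => sin (x / 2)) (cos (ψ / 2) * (1 / 2)) ψ := hhalf.sin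
  have dR : HasDerivAt (gR r) (sin (r / 2) * sin (ψ / 2) / (2 * cos (ψ / 2) ^ 2) / cos (gR r ψ)) ψ := by
    have n0 := g_x0 h0 h1 h2 h3
    have n1 : sin (r / 2) / cos (ψ / 2) ≠ -1 := by intro h; linarith
    have n2 : sin (r / 2) / cos (ψ / 2) ≠ 1 := by
      intro h; linarith [g_x1 h0 h1 h2 h3, Real.sin_le_one r]
    have d := HasDerivAt.comp (h₂ := arcsin) ψ (Real.hasDerivAt_arcsin n1 n2)
      (show HasDerivAt (fun x => sin (r / 2) / cos (x / 2)) _ ψ from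
        (hasDerivAt_const ψ (sin (r / 2))).div dc hψ.ne')
    refine d.congr_deriv ?_
    change 1 / √(1 - (sin (r / 2) / cos (ψ / 2)) ^ 2) * _ = _
    rw [← Real.cos_arcsin, ← gR]
    field_simp
    ring
  have dα : HasDerivAt (gα r) (1 / (2 * cos (gR r ψ))) ψ := by
    have d := (Real.hasDerivAt_arcsin (by linarith [g_y0 h0 h1 h2 h3])
      (by linarith [g_y1 h0 h1 h2 h3])).comp ψ (ds.div_const (cos (r / 2)))
    refine d.congr_deriv ?_
    rw [g_cosα h0 h1 h2 h3]
    field_simp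
  have dρ : HasDerivAt (fun x => cos (r - gR r x)) (sin (r - gR r ψ) * (sin (r / 2) * sin (ψ / 2) /
      (2 * cos (ψ / 2) ^ 2) / cos (gR r ψ))) ψ := by
    refine (dR.const_sub r).cos.congr_deriv ?_
    ring
  have := ((dρ.const_sub 1).const_mul (2 * π)).add
    ((((hasDerivAt_id ψ).mul dρ).sub (dα.const_mul (1 + cos r))).const_mul 6)
  refine this.congr_deriv ?_
  simp only [id]
  ring

lemma gG_anti (h0 : 0 < r) (h1 : r < π / 2) : StrictAntiOn (gG r) (Set.Icc 0 (π / 3)) := by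
  apply strictAntiOn_of_deriv_neg (convex_Icc _ _)
  · intro x hx
    exact (gG_deriv h0 h1 hx.1 hx.2).continuousAt.continuousWithinAt
  · intro x hx
    rw [interior_Icc] at hx
    have hp := g_par h0 h1 hx.1.le hx.2.le
    rw [(gG_deriv h0 h1 hx.1.le hx.2.le).deriv]
    have a1 : 0 < sin (r - gR r x) := Real.sin_pos_of_pos_of_lt_pi (by linarith [hp.Rr])
      (by linarith [hp.R0, Real.pi_pos])
    have a2 := hp.cR
    have a3 := g_sr0 h0 h1
    have a4 := g_cψ0 hx.1.le hx.2.le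
    have a5 : 0 < sin (x / 2) := Real.sin_pos_of_pos_of_lt_pi (by linarith [hx.1])
      (by linarith [hx.2, Real.pi_pos])
    have a6 : 0 < 2 * π - 6 * x := by linarith [hx.2]
    have b1 : 0 < (2 * π - 6 * x) * (sin (r - gR r x) * (sin (r / 2) * sin (x / 2) /
      (2 * cos (x / 2) ^ 2) / cos (gR r x))) := by positivity
    have b2 : cos (r - gR r x) ≤ (1 + cos r) / (2 * cos (gR r x)) := by
      rw [le_div_iff₀ (by positivity)]
      have e := Real.two_mul_cos_mul_cos (r - gR r x) (gR r x)
      rw [sub_add_cancel] at e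
      have := Real.cos_le_one (r - gR r x - gR r x)
      linarith
    linarith

end
end SphericalPal

namespace SphericalPal

/-! ### the minimal enclosing ball of a complete set -/

section
variable {r : ℝ} {D : Set (E 2)}

lemma convexHull_compact {A : Set (E 2)} (hA : IsCompact A) : IsCompact (convexHull ℝ A) := by
  have key : convexHull ℝ A = ⋃ n ∈ Finset.range 5,
      (fun p : (Fin n → ℝ) × (Fin n → E 2) => ∑ i, p.1 i • p.2 i) ''
        (stdSimplex ℝ (Fin n) ×ˢ Set.pi Set.univ (fun _ => A)) := by
    ext x
    simp only [Set.mem_iUnion, exists_prop, Set.mem_image, Finset.mem_range]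
    constructor
    · intro hx
      obtain ⟨ι, _, z, w, hz, hai, hw, hw1, hwm⟩ := eq_pos_convex_span_of_mem_convexHull hx
      have hcard : Fintype.card ι < 5 := by
        have a := hai.card_le_finrank_succ
        have b := Submodule.finrank_le (vectorSpan ℝ (Set.range z))
        have c : Module.finrank ℝ (E 2) = 3 := by simp [E]
        omega
      let e := Fintype.equivFin ι
      refine ⟨Fintype.card ι, hcard, (fun i => w (e.symm i), fun i => z (e.symm i)), ⟨⟨fun i =>
        (hw _).le, ?_⟩, fun i _ => hz ⟨_, rfl⟩⟩, ?_⟩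
      · rw [← hw1]; exact Equiv.sum_comp e.symm w
      · rw [← hwm]; exact Equiv.sum_comp e.symm (fun i => w i • z i)
    · rintro ⟨n, _, p, ⟨⟨h1, h2⟩, h3⟩, rfl⟩
      exact (convex_convexHull ℝ A).sum_mem (fun i _ => h1 i) h2
        (fun i _ => subset_convexHull ℝ A (h3 i (Set.mem_univ i)))
  rw [key]
  refine Finset.isCompact_biUnion _ fun n _ => ?_
  refine IsCompact.image ((isCompact_stdSimplex ℝ (Fin n)).prod (isCompact_univ_pi fun _ => hA)) ?_
  fun_prop

lemma IsComp.compact (hD : IsComp r D) : IsCompact D :=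
  Metric.isCompact_of_isClosed_isBounded hD.closed
    ((Metric.isBounded_closedBall (x := (0 : E 2)) (r := 1)).subset fun x hx => by
      simp [hD.norm hx])

/-- nearest point of the convex hull to the origin, with Carathéodory weights -/
lemma IsComp.nearest (hD : IsComp r D) : ∃ m : E 2, cos r ≤ ⟪m, m⟫ ∧ (∀ x ∈ D, ⟪m, m⟫ ≤ ⟪m, x⟫) ∧
    ∃ n ≤ 3, ∃ (c : Fin n → E 2) (l : Fin n → ℝ), (∀ i, c i ∈ D) ∧ (∀ i, 0 < l i) ∧
      ∑ i, l i = 1 ∧ ∑ i, l i • c i = m ∧ ∀ i, ⟪m, c i⟫ = ⟪m, m⟫ := by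
  have hK : IsCompact (convexHull ℝ D) := convexHull_compact hD.compact
  have hcv : Convex ℝ (convexHull ℝ D) := convex_convexHull ℝ D
  obtain ⟨m, hm, hmin⟩ := exists_norm_eq_iInf_of_complete_convex
    (hD.nonempty.mono (subset_convexHull ℝ D)) hK.isComplete hcv (0 : E 2)
  rw [norm_eq_iInf_iff_real_inner_le_zero hcv hm] at hmin
  have h1 : ∀ x ∈ convexHull ℝ D, ⟪m, m⟫ ≤ ⟪m, x⟫ := by
    intro x hx
    have := hmin x hx
    rw [zero_sub, inner_neg_left, inner_sub_right] at this
    linarith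
  have h2 : ∀ x ∈ D, ∀ y ∈ convexHull ℝ D, cos r ≤ ⟪x, y⟫ := by
    intro x hx
    have : convexHull ℝ D ⊆ {y | cos r ≤ ⟪x, y⟫} := by
      refine convexHull_min (fun y hy => hD.inner hx hy) ?_
      exact convex_halfSpace_ge ⟨fun a b => inner_add_right _ _ _, fun a b => by
        simp [inner_smul_right]⟩ _
    exact this
  have h3 : cos r ≤ ⟪m, m⟫ := by
    have : convexHull ℝ D ⊆ {y | cos r ≤ ⟪y, m⟫} := by
      refine convexHull_min (fun y hy => h2 y hy m hm) ?_
      exact convex_halfSpace_ge ⟨fun a b => inner_add_left _ _ _, fun a b => by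
        simp [inner_smul_left]⟩ _
    exact this hm
  refine ⟨m, h3, fun x hx => h1 x (subset_convexHull ℝ D hx), ?_⟩
  obtain ⟨ι, _, z, w, hz, hai, hw, hw1, hwm⟩ := eq_pos_convex_span_of_mem_convexHull hm
  have hzD : ∀ i, z i ∈ D := fun i => hz ⟨i, rfl⟩
  have hct : ∀ i, ⟪m, z i⟫ = ⟪m, m⟫ := by
    have hs : ∑ i, w i * (⟪m, z i⟫ - ⟪m, m⟫) = 0 := by
      have : ⟪m, ∑ i, w i • z i⟫ = ⟪m, m⟫ := by rw [hwm]
      rw [inner_sum] at this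
      simp only [inner_smul_right] at this
      simp only [mul_sub, Finset.sum_sub_distrib, ← Finset.sum_mul, hw1, this]
      ring
    rw [Finset.sum_eq_zero_iff_of_nonneg] at hs
    · intro i
      have := hs i (Finset.mem_univ i)
      rcases mul_eq_zero.1 this with h | h
      · exact absurd h (hw i).ne'
      · linarith
    · intro i _
      exact mul_nonneg (hw i).le (by linarith [h1 (z i) (subset_convexHull ℝ D (hzD i))])
  have hm0 : m ≠ 0 := by
    rintro rfl
    rw [inner_zero_left] at h3
    linarith [hD.cos_pos]
  have hcard : Fintype.card ι ≤ 3 := by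
    have a := hai.card_le_finrank_succ
    have b : vectorSpan ℝ (Set.range z) ≤ (Submodule.span ℝ {m})ᗮ := by
      rw [vectorSpan_def, Submodule.span_le]
      rintro _ ⟨_, ⟨i, rfl⟩, _, ⟨j, rfl⟩, rfl⟩
      change z i -ᵥ z j ∈ (Submodule.span ℝ {m})ᗮ
      rw [Submodule.mem_orthogonal_singleton_iff_inner_right, vsub_eq_sub, inner_sub_right, hct, hct,
        sub_self]
    have c := Submodule.finrank_mono b
    have : Fact (Module.finrank ℝ (E 2) = 2 + 1) := ⟨by simp [E]⟩
    rw [Submodule.finrank_orthogonal_span_singleton (n := 2) hm0] at c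
    omega
  let e := Fintype.equivFin ι
  refine ⟨Fintype.card ι, hcard, fun i => z (e.symm i), fun i => w (e.symm i), fun i => hzD _,
    fun i => hw _, ?_, ?_, fun i => hct _⟩
  · rw [← hw1]; exact Equiv.sum_comp e.symm w
  · rw [← hwm]; exact Equiv.sum_comp e.symm (fun i => w i • z i)

lemma IsComp.minball (hD : IsComp r D) : ∃ (o : E 2) (R : ℝ), ‖o‖ = 1 ∧ 0 ≤ R ∧ R < r ∧
    (∀ x ∈ D, cos R ≤ ⟪x, o⟫) ∧ (R ≤ r / 2 ∨ (r / 2 < R ∧ ∃ (f : Fin 3 → E 2) (l : Fin 3 → ℝ),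
      (∀ i, ‖f i‖ = 1) ∧ (∀ i, ⟪f i, o⟫ = 0) ∧ (∀ i, 0 < l i) ∧ (∑ i, l i • f i = 0) ∧
      ∀ i, cos R • o + sin R • f i ∈ D)) := by
  obtain ⟨m, hm, hmD, n, hn, c, l, hc, hl, hl1, hlm, hcm⟩ := hD.nearest
  have hc0 := hD.cos_pos
  have hmm : ⟪m, m⟫ = ‖m‖ ^ 2 := real_inner_self_eq_norm_sq m
  have hn0 : 0 < ‖m‖ := by
    rw [norm_pos_iff]; rintro rfl; rw [inner_zero_left] at hm; linarith
  have hcr1 : cos r < 1 := by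
    have := hD.sin_pos
    nlinarith [Real.sin_sq_add_cos_sq r]
  obtain ⟨x₀, hx₀⟩ := hD.nonempty
  have hm1 : ‖m‖ ≤ 1 := by
    have a := hmD x₀ hx₀
    have b := real_inner_le_norm m x₀
    rw [hD.norm hx₀] at b
    nlinarith
  have hmr : cos r < ‖m‖ := by nlinarith
  set R := arccos ‖m‖ with hR
  have hcR : cos R = ‖m‖ := Real.cos_arccos (by linarith) hm1
  have hR0 : 0 ≤ R := Real.arccos_nonneg _
  have hRr : R < r := by
    by_contra hcon
    push Not at hcon
    have := Real.cos_le_cos_of_nonneg_of_le_pi hD.r_pos.le (Real.arccos_le_pi ‖m‖) hcon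
    rw [← hR, hcR] at this
    linarith
  have hno : ‖nz m‖ = 1 := nz_norm (norm_pos_iff.1 hn0)
  have hmo : m = ‖m‖ • nz m := (norm_smul_nz m).symm
  refine ⟨nz m, R, hno, hR0, hRr, ?_, ?_⟩
  · intro x hx
    have a := hmD x hx
    rw [hmm, real_inner_comm] at a
    rw [hcR, nz, inner_smul_right, le_inv_mul_iff₀ hn0]
    nlinarith
  rcases le_or_gt R (r / 2) with h | h
  · exact Or.inl h
  refine Or.inr ⟨h, ?_⟩
  have hsR : 0 < sin R := Real.sin_pos_of_pos_of_lt_pi (by linarith [hD.r_pos])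
    (by linarith [hD.r_lt, Real.pi_pos])
  have sc := Real.sin_sq_add_cos_sq R
  have hvn : ∀ i, ‖c i - m‖ = sin R := by
    intro i
    have : ‖c i - m‖ ^ 2 = sin R ^ 2 := by
      rw [norm_sub_sq_real, hD.norm (hc i), real_inner_comm, hcm i, hmm]
      rw [hcR] at sc
      linarith
    exact (pow_left_inj₀ (norm_nonneg _) hsR.le two_ne_zero).1 this
  have hsum : ∑ i, l i • (c i - m) = 0 := by
    simp only [smul_sub, Finset.sum_sub_distrib, ← Finset.sum_smul, hl1, hlm]
    simp
  have hn3 : n = 3 := by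
    interval_cases n
    · simp at hl1
    · exfalso
      simp only [Fin.sum_univ_one] at hsum
      have := hvn 0
      rcases smul_eq_zero.1 hsum with h' | h'
      · exact (hl 0).ne' h'
      · rw [h', norm_zero] at this; linarith
    · exfalso
      rw [Fin.sum_univ_two] at hsum
      have e : l 0 • (c 0 - m) = -(l 1 • (c 1 - m)) := eq_neg_of_add_eq_zero_left hsum
      have e2 := congrArg (fun x => ‖x‖) e
      simp only [norm_neg, norm_smul, hvn] at e2
      rw [Real.norm_of_nonneg (hl 0).le,
        Real.norm_of_nonneg (hl 1).le] at e2
      have e3 : l 0 = l 1 := mul_right_cancel₀ hsR.ne' e2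
      rw [e3, ← smul_neg] at e
      have e4 : c 0 - m = -(c 1 - m) := smul_right_injective _ (hl 1).ne' e
      have a := hD.inner (hc 0) (hc 1)
      have b : ⟪c 0, c 1⟫ = cos R ^ 2 - sin R ^ 2 := by
        have h0 : c 0 = m + -(c 1 - m) := by rw [← e4]; abel
        have k : ⟪c 1 - m, c 1 - m⟫ = sin R ^ 2 := by
          rw [real_inner_self_eq_norm_sq, hvn]
        have k2 := hcm 1
        simp only [inner_sub_left, inner_sub_right] at k
        rw [h0]
        simp only [inner_add_left, inner_neg_left, inner_sub_left]
        rw [hcR, ← hmm]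
        rw [real_inner_comm] at k2
        have k3 := real_inner_comm m (c 1)
        linarith
      have k4 := Real.cos_two_mul' R
      have : cos r ≤ cos (2 * R) := by rw [k4]; linarith
      have h5 := Real.cos_lt_cos_of_nonneg_of_le_pi hD.r_pos.le
        (show 2 * R ≤ π by linarith [hD.r_lt]) (show r < 2 * R by linarith)
      linarith
    · rfl
  subst hn3
  refine ⟨fun i => (sin R)⁻¹ • (c i - m), l, ?_, ?_, hl, ?_, ?_⟩
  · intro i
    rw [norm_smul, hvn, Real.norm_of_nonneg (inv_nonneg.2 hsR.le), inv_mul_cancel₀ hsR.ne']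
  · intro i
    rw [nz, inner_smul_left, inner_smul_right, inner_sub_left, real_inner_comm, hcm i, sub_self]
    simp
  · simp only [smul_comm _ (sin R)⁻¹, ← Finset.smul_sum, hsum, smul_zero]
  · intro i
    have : cos R • nz m + sin R • (sin R)⁻¹ • (c i - m) = c i := by
      rw [smul_smul, mul_inv_cancel₀ hsR.ne', one_smul, hcR, ← hmo]; abel
    rw [this]; exact hc i

end
end SphericalPal

namespace SphericalPal

/-! ### spikes over contact points -/

section
variable {r R ψ : ℝ} {D : Set (E 2)}

lemma norm_on3 {o g k : E 2} (ho : ‖o‖ = 1) (hg : ‖g‖ = 1) (hk : ‖k‖ = 1) (h1 : ⟪o, g⟫ = 0)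
    (h2 : ⟪o, k⟫ = 0) (h3 : ⟪g, k⟫ = 0) (a b c : ℝ) :
    ‖a • o + b • g + c • k‖ ^ 2 = a ^ 2 + b ^ 2 + c ^ 2 := by
  rw [← real_inner_self_eq_norm_sq]
  have e1 : ⟪o, o⟫ = 1 := by rw [real_inner_self_eq_norm_sq, ho]; norm_num
  have e2 : ⟪g, g⟫ = 1 := by rw [real_inner_self_eq_norm_sq, hg]; norm_num
  have e3 : ⟪k, k⟫ = 1 := by rw [real_inner_self_eq_norm_sq, hk]; norm_num
  have h1' := real_inner_comm o g
  have h2' := real_inner_comm o k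
  have h3' := real_inner_comm g k
  simp only [inner_add_left, inner_add_right, inner_smul_left, inner_smul_right, e1, e2, e3, h1, h2,
    h3, h1', h2', h3', RCLike.conj_to_real]
  ring

lemma norm_ray {o g k : E 2} (ho : ‖o‖ = 1) (hg : ‖g‖ = 1) (hk : ‖k‖ = 1) (h1 : ⟪o, g⟫ = 0)
    (h2 : ⟪o, k⟫ = 0) (h3 : ⟪g, k⟫ = 0) {z s : ℝ} (hzs : z ^ 2 + s ^ 2 = 1) (t : ℝ) :
    ‖z • o + s • (cos t • g + sin t • k)‖ = 1 := by
  have e3 : z • o + s • (cos t • g + sin t • k) = z • o + (s * cos t) • g + (s * sin t) • k := by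
    module
  have : ‖z • o + s • (cos t • g + sin t • k)‖ ^ 2 = 1 ^ 2 := by
    rw [e3, norm_on3 ho hg hk h1 h2 h3]
    linear_combination hzs + s ^ 2 * Real.sin_sq_add_cos_sq t
  exact (pow_left_inj₀ (norm_nonneg _) zero_le_one two_ne_zero).1 this

lemma spike_scalar (hp : Par r R) (h0 : 0 < ψ) (h1 : ψ ≤ π / 3)
    (he : cos r = cos R ^ 2 - sin R ^ 2 * cos ψ) {t h s₀ : ℝ} (ht0 : 0 ≤ t) (ht1 : t ≤ ψ)
    (hs₀ : 0 < s₀) (hh0 : 0 < h) (e1 : h ^ 2 + s₀ ^ 2 = 1)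
    (e2 : cos R * h - sin R * cos t * s₀ = cos r) :
    ∃ a b : ℝ, 0 ≤ a ∧ 0 ≤ b ∧ 1 ≤ a + b ∧ s₀ * sin t = b * (sin R * sin ψ) ∧
      h = a * cos (r - R) + b * cos R - (a + b - 1) * cos r * cos R ∧
      s₀ * cos t = a * sin (r - R) + b * (sin R * cos ψ) + (a + b - 1) * cos r * sin R := by
  have pp := Real.pi_pos
  have hct : 0 ≤ cos t := Real.cos_nonneg_of_mem_Icc ⟨by linarith, by linarith⟩
  have hst : 0 ≤ sin t := Real.sin_nonneg_of_nonneg_of_le_pi ht0 (by linarith)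
  have hcψ : 0 ≤ cos ψ := Real.cos_nonneg_of_mem_Icc ⟨by linarith, by linarith⟩
  have hsψ : 0 < sin ψ := Real.sin_pos_of_pos_of_lt_pi h0 (by linarith)
  have hctψ : cos ψ ≤ cos t := Real.cos_le_cos_of_nonneg_of_le_pi ht0 (by linarith) ht1
  have hstψ : sin t ≤ sin ψ := Real.sin_le_sin_of_le_of_le_pi_div_two (by linarith) (by linarith) ht1
  have hsψt : 0 ≤ sin (ψ - t) := Real.sin_nonneg_of_nonneg_of_le_pi (by linarith) (by linarith)
  have hsR := hp.sR
  have hcR := hp.cR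
  have hsr := hp.sr
  have scR := Real.sin_sq_add_cos_sq R
  have scr := Real.sin_sq_add_cos_sq r
  have sct := Real.sin_sq_add_cos_sq t
  have scψ := Real.sin_sq_add_cos_sq ψ
  have hhR : cos R ≤ h := by
    by_contra! hlt
    have : sin R ≤ s₀ := by
      refine (pow_le_pow_iff_left₀ hsR.le hs₀.le two_ne_zero).1 ?_
      nlinarith
    have a1 : cos R * h < cos R * cos R := mul_lt_mul_of_pos_left hlt hcR
    have a2 : sin R * cos ψ * sin R ≤ sin R * cos t * s₀ := by gcongr
    linarith [sq (cos R), sq (sin R), mul_comm (sin R * cos ψ) (sin R), mul_assoc (sin R) (sin R) (cos ψ), mul_assoc (sin R) (cos ψ) (sin R), mul_comm (cos ψ) (sin R)]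
  have hsR0 : s₀ ≤ sin R := by
    refine (pow_le_pow_iff_left₀ hs₀.le hsR.le two_ne_zero).1 ?_
    nlinarith
  -- coefficients
  set b := s₀ * sin t / (sin R * sin ψ) with hb
  have hb0 : 0 ≤ b := by positivity
  have hbk : s₀ * sin t = b * (sin R * sin ψ) := by
    rw [hb, div_mul_cancel₀ _ (by positivity)]
  set a := (sin R * h + cos R * s₀ * cos t - b * (sin R * cos R * (1 + cos ψ))) / sin r with ha
  have haq : a * sin r = sin R * h + cos R * s₀ * cos t - b * (sin R * cos R * (1 + cos ψ)) := by
    rw [ha, div_mul_cancel₀ _ hsr.ne']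
  have ha0 : 0 ≤ a := by
    have k1 : a * sin r * sin ψ = sin R * h * sin ψ + cos R * s₀ * (sin (ψ - t) - sin t) := by
      rw [haq, Real.sin_sub]
      linear_combination (cos R * (1 + cos ψ)) * hbk
    have k2 : cos R * s₀ ≤ sin R * h :=
      (mul_le_mul_of_nonneg_left hsR0 hcR.le).trans (by rw [mul_comm]; exact mul_le_mul_of_nonneg_left hhR hsR.le)
    have k3 : 0 ≤ a * sin r * sin ψ := by
      rw [k1]
      have : cos R * s₀ * (-sin ψ) ≤ cos R * s₀ * (sin (ψ - t) - sin t) := by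
        apply mul_le_mul_of_nonneg_left (by linarith) (by positivity)
      have := mul_le_mul_of_nonneg_right k2 hsψ.le
      linarith
    exact nonneg_of_mul_nonneg_left (nonneg_of_mul_nonneg_left k3 hsψ) hsr
  have hab : 1 ≤ a + b := by
    have n1 : (sin R * cos R * (1 + cos ψ)) ^ 2 + (sin R * sin ψ) ^ 2 = sin r ^ 2 := by
      rw [show sin r ^ 2 = 1 - cos r ^ 2 by linarith, he]
      have x1 : sin ψ ^ 2 = 1 - cos ψ ^ 2 := by linarith
      have x2 : cos R ^ 2 = 1 - sin R ^ 2 := by linarith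
      rw [mul_pow, mul_pow, mul_pow, x1, x2]; ring
    have n2 : (sin R * h + cos R * s₀ * cos t) ^ 2 + (s₀ * sin t) ^ 2 = sin r ^ 2 := by
      have : (sin R * h + cos R * s₀ * cos t) ^ 2 + (s₀ * sin t) ^ 2 = (sin R ^ 2 + cos R ^ 2) *
        (h ^ 2 + s₀ ^ 2 * cos t ^ 2) + s₀ ^ 2 * sin t ^ 2 - (cos R * h - sin R * cos t * s₀) ^ 2 := by
        ring
      rw [this, e2, scR]
      linear_combination e1 + s₀ ^ 2 * sct - scr
    set p := sin R * cos R * (1 + cos ψ) with hpdef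
    have n3 : (a * sin r + b * p) ^ 2 + (b * (sin R * sin ψ)) ^ 2 = sin r ^ 2 := by
      rw [← n2, ← hbk, haq]; ring
    have n4 : p ≤ sin r := by 
      exact (abs_le_of_sq_le_sq' (show p ^ 2 ≤ sin r ^ 2 by linarith [sq_nonneg (sin R * sin ψ)]) hsr.le).2
    have n5 : sin r ^ 2 ≤ ((a + b) * sin r) ^ 2 := by
      have : a * b * sin r * p ≤ a * b * sin r * sin r := by gcongr
      have x1 : sin r ^ 2 = a ^ 2 * sin r ^ 2 + 2 * (a * b * sin r * p) + b ^ 2 * sin r ^ 2 := by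
        linear_combination -n3 + b ^ 2 * n1
      linarith [show ((a + b) * sin r) ^ 2 = a ^ 2 * sin r ^ 2 + 2 * (a * b * sin r * sin r) + b ^ 2 * sin r ^ 2 by ring]
    have n6 := (pow_le_pow_iff_left₀ hsr.le (by positivity) two_ne_zero).1 n5
    by_contra! hlt
    have := mul_lt_mul_of_pos_right hlt hsr
    linarith
  have c1 : h = a * cos (r - R) + b * cos R - (a + b - 1) * cos r * cos R := by
    rw [Real.cos_sub]
    linear_combination (-h) * scR + cos R * e2 - sin R * haq + b * cos R * (he + scR)
  have c2 : s₀ * cos t = a * sin (r - R) + b * (sin R * cos ψ) + (a + b - 1) * cos r * sin R := by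
    rw [Real.sin_sub]
    linear_combination (-(s₀ * cos t)) * scR - sin R * e2 - cos R * haq + b * sin R * (cos ψ * scR - he)
  exact ⟨a, b, ha0, hb0, hab, hbk, c1, c2⟩

lemma IsComp.spike_core (hD : IsComp r D) (hp : Par r R) (h0 : 0 < ψ) (h1 : ψ ≤ π / 3)
    (he : cos r = cos R ^ 2 - sin R ^ 2 * cos ψ)
    {o g k : E 2} (ho : ‖o‖ = 1) (hg : ‖g‖ = 1) (hk : ‖k‖ = 1) (hog : ⟪o, g⟫ = 0)
    (hok : ⟪o, k⟫ = 0) (hgk : ⟪g, k⟫ = 0)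
    (hoD : o ∈ D) (hc : cos R • o + sin R • (cos ψ • g + sin ψ • k) ∈ D)
    (ht₀ : cos (r - R) • o + sin (r - R) • g ∈ D)
    {t z s : ℝ} (ht0 : 0 ≤ t) (ht1 : t ≤ ψ) (hs : 0 ≤ s) (hzs : z ^ 2 + s ^ 2 = 1)
    (hz : hh r R t ≤ z) : z • o + s • (cos t • g + sin t • k) ∈ D := by
  have pp := Real.pi_pos
  have hct : 0 ≤ cos t := Real.cos_nonneg_of_mem_Icc ⟨by linarith, by linarith⟩
  have hh0 := hp.hh_pos hct
  obtain ⟨s₀, hs₀, e1, e2⟩ := hp.hh_arc t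
  obtain ⟨a, b, ha0, hb0, hab, hbk, c1, c2⟩ := spike_scalar hp h0 h1 he ht0 ht1 hs₀ hh0 e1 e2
  set h := hh r R t with hhdef
  have scR := Real.sin_sq_add_cos_sq R
  have sct := Real.sin_sq_add_cos_sq t
  have key : h • o + s₀ • (cos t • g + sin t • k) =
      a • (cos (r - R) • o + sin (r - R) • g) +
      b • (cos R • o + sin R • (cos ψ • g + sin ψ • k)) -
      ((a + b - 1) * cos r) • (cos R • o - sin R • g) := by
    have e3 : h • o + s₀ • (cos t • g + sin t • k) = h • o + (s₀ * cos t) • g + (s₀ * sin t) • k := by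
      module
    rw [e3, c2, hbk]
    nth_rewrite 1 [c1]
    module
  have hyn : ‖h • o + s₀ • (cos t • g + sin t • k)‖ = 1 := norm_ray ho hg hk hog hok hgk e1 t
  have hen : ‖cos R • o - sin R • g‖ = 1 := by
    have e3 : cos R • o - sin R • g = cos R • o + (-sin R) • g + (0 : ℝ) • k := by module
    have : ‖cos R • o - sin R • g‖ ^ 2 = 1 ^ 2 := by
      rw [e3, norm_on3 ho hg hk hog hok hgk]
      linear_combination scR
    exact (pow_left_inj₀ (norm_nonneg _) zero_le_one two_ne_zero).1 this
  have hy : h • o + s₀ • (cos t • g + sin t • k) ∈ dcone r D := by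
    rw [key]
    exact hD.hull ht₀ hc hen ha0 hb0 hab (by rw [← key, hyn])
  -- from the arc point to x
  have hss : s ≤ s₀ := by
    refine (pow_le_pow_iff_left₀ hs hs₀.le two_ne_zero).1 ?_
    nlinarith
  have hx : z • o + s • (cos t • g + sin t • k) = (s / s₀) • (h • o + s₀ • (cos t • g + sin t • k)) +
      (z - s / s₀ * h) • o := by
    have : s = s / s₀ * s₀ := by rw [div_mul_cancel₀ _ hs₀.ne']
    nth_rewrite 1 [this]
    module
  have hxn : ‖z • o + s • (cos t • g + sin t • k)‖ = 1 := norm_ray ho hg hk hog hok hgk hzs t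
  refine hD.mem_of_cone ?_ hxn
  rw [hx]
  refine hD.cc.add _ (hD.cc.smul _ (by positivity) _ hy) _ (hD.cc.smul _ ?_ _ (hD.mem_cone hoD))
  have : s / s₀ ≤ 1 := (div_le_one hs₀).2 hss
  nlinarith

end
end SphericalPal

namespace SphericalPal

section
variable {r R ψ : ℝ} {D : Set (E 2)}

lemma frame_inner (b : OrthonormalBasis (Fin 3) ℝ (E 2)) (i j : Fin 3) (h : i ≠ j) : ⟪b i, b j⟫ = 0 :=
  b.orthonormal.2 h

lemma frame_norm (b : OrthonormalBasis (Fin 3) ℝ (E 2)) (i : Fin 3) : ‖b i‖ = 1 := b.orthonormal.1 i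

lemma frame_repr (b : OrthonormalBasis (Fin 3) ℝ (E 2)) (x : E 2) :
    x = ⟪b 2, x⟫ • b 2 + ‖pc b x‖ • (cos (pc b x).arg • b 0 + sin (pc b x).arg • b 1) := by
  have h := b.sum_repr' x
  rw [Fin.sum_univ_three] at h
  have h0 : ‖pc b x‖ * cos (pc b x).arg = ⟪b 0, x⟫ := Complex.norm_mul_cos_arg _
  have h1 : ‖pc b x‖ * sin (pc b x).arg = ⟪b 1, x⟫ := Complex.norm_mul_sin_arg _
  rw [smul_add, smul_smul, smul_smul, h0, h1]
  nth_rewrite 1 [← h]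
  abel

lemma norm_comb2 {a b : E 2} (ha : ‖a‖ = 1) (hb : ‖b‖ = 1) (hab : ⟪a, b⟫ = 0) {p q : ℝ}
    (h : p ^ 2 + q ^ 2 = 1) : ‖p • a + q • b‖ = 1 := by
  have : ‖p • a + q • b‖ ^ 2 = 1 ^ 2 := by
    rw [norm_add_sq_real, norm_smul, norm_smul, ha, hb, inner_smul_left, inner_smul_right, hab]
    simp only [mul_zero, add_zero, mul_one, Real.norm_eq_abs, sq_abs, one_pow]
    exact h
  exact (pow_left_inj₀ (norm_nonneg _) zero_le_one two_ne_zero).1 this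

lemma IsComp.spike_sub (hD : IsComp r D) (hp : Par r R) (h0 : 0 < ψ) (h1 : ψ ≤ π / 3)
    (he : cos r = cos R ^ 2 - sin R ^ 2 * cos ψ) (b : OrthonormalBasis (Fin 3) ℝ (E 2))
    (hball : ∀ x : E 2, ‖x‖ = 1 → cos (r - R) ≤ ⟪b 2, x⟫ → x ∈ D)
    (hc : cos R • b 2 + sin R • b 0 ∈ D) {x : E 2} (hx : ‖x‖ = 1) (harg : |(pc b x).arg| < ψ)
    (hz : hh r R (ψ - |(pc b x).arg|) ≤ ⟪b 2, x⟫) : x ∈ D := by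
  obtain ⟨ε, hε, hεa⟩ : ∃ ε : ℝ, ε ^ 2 = 1 ∧ (pc b x).arg = ε * |(pc b x).arg| ∧ (ε = 1 ∨ ε = -1) := by
    rcases le_total 0 (pc b x).arg with h | h
    · exact ⟨1, by norm_num, by rw [abs_of_nonneg h, one_mul], Or.inl rfl⟩
    · exact ⟨-1, by norm_num, by rw [abs_of_nonpos h]; ring, Or.inr rfl⟩
  obtain ⟨hεa, hε'⟩ := hεa
  set β := |(pc b x).arg| with hβ
  have hcosβ : cos (pc b x).arg = cos β := by rw [hβ, Real.cos_abs]
  have hsinβ : sin (pc b x).arg = ε * sin β := by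
    rw [hεa]; rcases hε' with rfl | rfl
    · rw [one_mul, one_mul]
    · rw [neg_one_mul, neg_one_mul, Real.sin_neg]
  have n0 := frame_norm b 0
  have n1 := frame_norm b 1
  have n2 := frame_norm b 2
  have i01 := frame_inner b 0 1 (by decide)
  have i10 := frame_inner b 1 0 (by decide)
  have i20 := frame_inner b 2 0 (by decide)
  have i21 := frame_inner b 2 1 (by decide)
  have scψ := Real.sin_sq_add_cos_sq ψ
  set g := cos ψ • b 0 + (ε * sin ψ) • b 1 with hg
  set k := sin ψ • b 0 + (-(ε * cos ψ)) • b 1 with hk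
  have hgn : ‖g‖ = 1 := norm_comb2 n0 n1 i01 (by linear_combination scψ + sin ψ ^ 2 * hε)
  have hkn : ‖k‖ = 1 := norm_comb2 n0 n1 i01 (by linear_combination scψ + cos ψ ^ 2 * hε)
  have hog : ⟪b 2, g⟫ = 0 := by
    rw [hg, inner_add_right, inner_smul_right, inner_smul_right, i20, i21]; ring
  have hok : ⟪b 2, k⟫ = 0 := by
    rw [hk, inner_add_right, inner_smul_right, inner_smul_right, i20, i21]; ring
  have e0 : ⟪b 0, b 0⟫ = 1 := by rw [real_inner_self_eq_norm_sq, n0]; norm_num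
  have e1 : ⟪b 1, b 1⟫ = 1 := by rw [real_inner_self_eq_norm_sq, n1]; norm_num
  have hgk : ⟪g, k⟫ = 0 := by
    rw [hg, hk]
    simp only [inner_add_left, inner_add_right, inner_smul_left, inner_smul_right, e0, e1, i01, i10,
      RCLike.conj_to_real]
    linear_combination (-(sin ψ * cos ψ)) * hε
  have hb0 : cos ψ • g + sin ψ • k = b 0 := by
    rw [hg, hk]
    have : cos ψ • (cos ψ • b 0 + (ε * sin ψ) • b 1) + sin ψ • (sin ψ • b 0 + (-(ε * cos ψ)) • b 1)
      = (sin ψ ^ 2 + cos ψ ^ 2) • b 0 := by module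
    rw [this, scψ, one_smul]
  have hd : cos (ψ - β) • g + sin (ψ - β) • k = cos (pc b x).arg • b 0 + sin (pc b x).arg • b 1 := by
    rw [hcosβ, hsinβ]
    have q1 : cos β = cos (ψ - β) * cos ψ + sin (ψ - β) * sin ψ := by
      rw [← Real.cos_sub, ← Real.cos_neg]; congr 1; ring
    have q2 : sin β = sin ψ * cos (ψ - β) - cos ψ * sin (ψ - β) := by
      rw [← Real.sin_sub]; congr 1; ring
    rw [hg, hk]
    rw [q1, q2]
    module
  have hfr := fr_norm b x
  rw [hx] at hfr
  have hX := frame_repr b x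
  rw [← hd] at hX
  rw [hX]
  have hoD : b 2 ∈ D := hball _ n2 (by
    rw [real_inner_self_eq_norm_sq, n2]; simpa using Real.cos_le_one _)
  have ht0 : cos (r - R) • b 2 + sin (r - R) • g ∈ D := by
    refine hball _ (norm_comb2 n2 hgn hog (by linear_combination Real.sin_sq_add_cos_sq (r - R))) ?_
    rw [inner_add_right, inner_smul_right, inner_smul_right, hog, real_inner_self_eq_norm_sq, n2]
    simp
  refine hD.spike_core hp h0 h1 he n2 hgn hkn hog hok hgk hoD (by rw [hb0]; exact hc) ht0
    (by linarith) (by linarith [abs_nonneg (pc b x).arg]) (norm_nonneg _) (by linarith) hz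

/-- three spikes over directions with a vanishing positive combination are disjoint -/
lemma spike_disj {o f₁ f₂ f₃ : E 2} (ho : ‖o‖ = 1) (n3 : ‖f₃‖ = 1) (o3 : ⟪f₃, o⟫ = 0)
    {l₁ l₂ l₃ C : ℝ} (p1 : 0 < l₁) (p2 : 0 < l₂) (p3 : 0 < l₃)
    (hs : l₁ • f₁ + l₂ • f₂ + l₃ • f₃ = 0) (c13 : -C ≤ ⟪f₁, f₃⟫) (c23 : -C ≤ ⟪f₂, f₃⟫)
    {x : E 2} (hx : ‖x‖ = 1) {s : ℝ} (hs0 : 0 < s) (hsx : ⟪o, x⟫ ^ 2 + s ^ 2 = 1)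
    (h1 : s * C < ⟪f₁, x⟫) (h2 : s * C < ⟪f₂, x⟫) : False := by
  have a1 : l₁ * ⟪f₁, f₃⟫ + l₂ * ⟪f₂, f₃⟫ + l₃ = 0 := by
    have := congrArg (fun y => ⟪y, f₃⟫) hs
    simp only [inner_add_left, inner_smul_left, RCLike.conj_to_real, inner_zero_left,
      real_inner_self_eq_norm_sq, n3] at this
    linarith
  have a2 : l₁ * ⟪f₁, x⟫ + l₂ * ⟪f₂, x⟫ + l₃ * ⟪f₃, x⟫ = 0 := by
    have := congrArg (fun y => ⟪y, x⟫) hs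
    simpa only [inner_add_left, inner_smul_left, RCLike.conj_to_real, inner_zero_left] using this
  have a3 : -s ≤ ⟪f₃, x⟫ := by
    have e : ⟪f₃, x⟫ = ⟪f₃, x - ⟪o, x⟫ • o⟫ := by
      rw [inner_sub_right, inner_smul_right, o3]; ring
    have q := abs_real_inner_le_norm f₃ (x - ⟪o, x⟫ • o)
    rw [n3, one_mul, ← e] at q
    have nn : ‖x - ⟪o, x⟫ • o‖ ^ 2 = s ^ 2 := by
      rw [norm_sub_sq_real, hx, norm_smul, ho, inner_smul_right, real_inner_comm x o]
      simp only [mul_one, Real.norm_eq_abs, sq_abs]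
      have hsx' : ⟪x, o⟫ ^ 2 + s ^ 2 = 1 := by rw [real_inner_comm]; exact hsx
      linear_combination -hsx'
    rw [(pow_left_inj₀ (norm_nonneg _) hs0.le two_ne_zero).1 nn] at q
    exact (abs_le.1 q).1
  have b1 : l₁ * (s * C) < l₁ * ⟪f₁, x⟫ := mul_lt_mul_of_pos_left h1 p1
  have b2 : l₂ * (s * C) < l₂ * ⟪f₂, x⟫ := mul_lt_mul_of_pos_left h2 p2
  have b3 : l₃ * (-s) ≤ l₃ * ⟪f₃, x⟫ := mul_le_mul_of_nonneg_left a3 p3.le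
  have b4 : l₁ * (-C) ≤ l₁ * ⟪f₁, f₃⟫ := mul_le_mul_of_nonneg_left c13 p1.le
  have b5 : l₂ * (-C) ≤ l₂ * ⟪f₂, f₃⟫ := mul_le_mul_of_nonneg_left c23 p2.le
  have b6 : s * l₃ ≤ s * ((l₁ + l₂) * C) := mul_le_mul_of_nonneg_left (by linarith) hs0.le
  linarith [mul_comm l₃ s, show s * ((l₁ + l₂) * C) = l₁ * (s * C) + l₂ * (s * C) by ring]

lemma spike_info (hp : Par r R) (h0 : 0 < ψ) (h1 : ψ ≤ π / 3) (b : OrthonormalBasis (Fin 3) ℝ (E 2))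
    {x : E 2} (hx : ‖x‖ = 1) (h : x ∈ spike b ψ (cos (r - R)) (hh r R)) :
    0 < √(1 - ⟪b 2, x⟫ ^ 2) ∧ √(1 - ⟪b 2, x⟫ ^ 2) * cos ψ < ⟪b 0, x⟫ := by
  obtain ⟨a1, a2, a3⟩ := h
  have pp := Real.pi_pos
  have hct : 0 ≤ cos (ψ - |(pc b x).arg|) :=
    Real.cos_nonneg_of_mem_Icc ⟨by linarith, by linarith [abs_nonneg (pc b x).arg]⟩
  have hz := hp.hh_pos hct
  have hfr := fr_norm b x
  rw [hx] at hfr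
  have e : √(1 - ⟪b 2, x⟫ ^ 2) = ‖pc b x‖ := by
    rw [show 1 - ⟪b 2, x⟫ ^ 2 = ‖pc b x‖ ^ 2 by linarith, Real.sqrt_sq (norm_nonneg _)]
  have hpos : 0 < √(1 - ⟪b 2, x⟫ ^ 2) := by
    apply Real.sqrt_pos.2
    have := Real.cos_le_one (r - R)
    nlinarith
  refine ⟨hpos, ?_⟩
  have h0 : ‖pc b x‖ * cos (pc b x).arg = ⟪b 0, x⟫ := Complex.norm_mul_cos_arg _
  rw [← h0, e]
  rw [e] at hpos
  apply mul_lt_mul_of_pos_left _ hpos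
  rw [← Real.cos_abs (pc b x).arg]
  exact Real.cos_lt_cos_of_nonneg_of_le_pi (abs_nonneg _) (by linarith) a1

end
end SphericalPal

namespace SphericalPal

section
variable {r R ψ : ℝ} {D : Set (E 2)}

lemma sm_spike_val (h0 : 0 < r) (h1 : r < π / 2) (h2 : 0 < ψ) (h3 : ψ ≤ π / 3)
    (b : OrthonormalBasis (Fin 3) ℝ (E 2)) :
    3 * (sm (spike b ψ (cos (r - gR r ψ)) (hh r (gR r ψ)))).toReal =
      2 * (ψ * cos (r - gR r ψ) - (1 + cos r) * gα r ψ) := by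
  have hp := g_par h0 h1 h2.le h3
  have pp := Real.pi_pos
  have hc : cos (r - gR r ψ) < 1 := by
    rw [← Real.cos_zero]
    exact Real.cos_lt_cos_of_nonneg_of_le_pi le_rfl (by linarith [hp.R0]) (by linarith [hp.Rr])
  rw [sm_spike b h2 (by linarith) hc hp.cont]
  · rw [hp.hh_int h2.le (by linarith), hp.hF_val h2 (by linarith)]
    · rw [gα]; ring
    · rw [g_sinR h0 h1 h2.le h3, div_mul_cancel₀ _ (g_cψ0 h2.le h3).ne']
  · intro t ht
    have hct : 0 ≤ cos t := Real.cos_nonneg_of_mem_Icc ⟨by linarith [ht.1], by linarith [ht.2]⟩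
    exact ⟨hp.hh_pos hct, hp.hh_le t hct⟩

lemma cap_meas (o : E 2) (c : ℝ) : MeasurableSet {x : E 2 | c ≤ ⟪o, x⟫} :=
  (isClosed_le continuous_const (by fun_prop)).measurableSet

lemma IsComp.ball_sub (hD : IsComp r D) {o : E 2} (ho : ‖o‖ = 1) (hR0 : 0 ≤ R) (hRr : R < r)
    (hoD : ∀ x ∈ D, cos R ≤ ⟪x, o⟫) (x : E 2) (hx : ‖x‖ = 1) (h : cos (r - R) ≤ ⟪o, x⟫) : x ∈ D := by
  rw [hD.mem_iff]
  refine ⟨hx, fun y hy => ?_⟩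
  have := inner_cos_add (hD.norm hy) ho hx hR0 (by linarith : 0 ≤ r - R)
    (by linarith [hD.r_lt, Real.pi_pos]) (hoD y hy) h
  rwa [add_sub_cancel] at this

lemma gG_zero (h0 : 0 < r) (h1 : r < π / 2) : gG r 0 = 2 * π * (1 - cos (r / 2)) := by
  have : gR r 0 = r / 2 := by
    rw [gR]; simp only [zero_div, Real.cos_zero, div_one]
    exact Real.arcsin_sin (by linarith [Real.pi_pos]) (by linarith [Real.pi_pos])
  rw [gG, this, gα, sub_half]
  simp

lemma sum_lower {A₀ A₁ A₂ A₃ B : Set (E 2)} (m0 : MeasurableSet A₀) (m1 : MeasurableSet A₁)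
    (m2 : MeasurableSet A₂) (m3 : MeasurableSet A₃) (mB : MeasurableSet B)
    (d01 : ∀ x, ‖x‖ = 1 → x ∈ A₀ → x ∈ A₁ → False) (d02 : ∀ x, ‖x‖ = 1 → x ∈ A₀ → x ∈ A₂ → False)
    (d03 : ∀ x, ‖x‖ = 1 → x ∈ A₀ → x ∈ A₃ → False) (d12 : ∀ x, ‖x‖ = 1 → x ∈ A₁ → x ∈ A₂ → False)
    (d13 : ∀ x, ‖x‖ = 1 → x ∈ A₁ → x ∈ A₃ → False) (d23 : ∀ x, ‖x‖ = 1 → x ∈ A₂ → x ∈ A₃ → False)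
    (s0 : ∀ x, ‖x‖ = 1 → x ∈ A₀ → x ∈ B) (s1 : ∀ x, ‖x‖ = 1 → x ∈ A₁ → x ∈ B)
    (s2 : ∀ x, ‖x‖ = 1 → x ∈ A₂ → x ∈ B) (s3 : ∀ x, ‖x‖ = 1 → x ∈ A₃ → x ∈ B) :
    (sm A₀).toReal + (sm A₁).toReal + (sm A₂).toReal + (sm A₃).toReal ≤ (sm B).toReal := by
  have key : ∀ A : Set (E 2), MeasurableSet A → (sm A).toReal = sm.real (A ∩ unitSphere 2) := by
    intro A hA
    rw [Measure.real, sm_congr hA (hA.inter us_meas)]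
    intro u hu
    simp [mem_us, hu]
  rw [key _ m0, key _ m1, key _ m2, key _ m3]
  have M := fun (A : Set (E 2)) (hA : MeasurableSet A) => hA.inter us_meas
  have dd : ∀ A A' : Set (E 2), (∀ x, ‖x‖ = 1 → x ∈ A → x ∈ A' → False) →
      Disjoint (A ∩ unitSphere 2) (A' ∩ unitSphere 2) := by
    intro A A' h
    rw [Set.disjoint_left]
    rintro x ⟨hx, hu⟩ ⟨hx', _⟩
    exact h x (mem_us.1 hu) hx hx'
  rw [← measureReal_union (dd _ _ d01) (M _ m1),
    ← measureReal_union (Disjoint.union_left (dd _ _ d02) (dd _ _ d12)) (M _ m2),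
    ← measureReal_union (Disjoint.union_left (Disjoint.union_left (dd _ _ d03) (dd _ _ d13))
      (dd _ _ d23)) (M _ m3)]
  refine measureReal_mono ?_
  rintro x (((⟨h, hu⟩ | ⟨h, hu⟩) | ⟨h, hu⟩) | ⟨h, hu⟩)
  · exact s0 x (mem_us.1 hu) h
  · exact s1 x (mem_us.1 hu) h
  · exact s2 x (mem_us.1 hu) h
  · exact s3 x (mem_us.1 hu) h

lemma IsComp.lower (hD : IsComp r D) : ∃ ψ, 0 ≤ ψ ∧ ψ ≤ π / 3 ∧ gG r ψ ≤ 3 * (sm D).toReal ∧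
    (ψ = π / 3 → ∃ c₁ ∈ D, ∃ c₂ ∈ D, ∃ c₃ ∈ D, ⟪c₁, c₂⟫ = cos r ∧ ⟪c₂, c₃⟫ = cos r ∧
      ⟪c₁, c₃⟫ = cos r) := by
  obtain ⟨o, R, ho, hR0, hRr, hoD, hcase⟩ := hD.minball
  have pp := Real.pi_pos
  have r0 := hD.r_pos
  have r1 := hD.r_lt
  have hball := hD.ball_sub ho hR0 hRr hoD
  have hDm := hD.closed.measurableSet
  have hcapc : cos (r - R) < 1 := by
    rw [← Real.cos_zero]
    exact Real.cos_lt_cos_of_nonneg_of_le_pi le_rfl (by linarith) (by linarith)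
  have hcap0 : 0 < cos (r - R) := Real.cos_pos_of_mem_Ioo ⟨by linarith, by linarith⟩
  have hcap := sm_cap ho hcap0 hcapc
  rcases hcase with hle | ⟨hlt, f, l, hf, hfo, hl, hs, hfD⟩
  · refine ⟨0, le_rfl, by positivity, ?_, fun h => absurd h (by positivity)⟩
    rw [gG_zero r0 r1]
    have a := sm_mono (cap_meas o (cos (r - R))) hDm hball
    rw [hcap] at a
    have : cos (r - R) ≤ cos (r / 2) :=
      Real.cos_le_cos_of_nonneg_of_le_pi (by linarith) (by linarith) (by linarith)
    nlinarith
  have hp : Par r R := ⟨by linarith, hRr, r1⟩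
  have hsR := hp.sR
  have hcR := hp.cR
  have hsr := g_sr0 r0 r1
  have hq1 : sin (r / 2) / sin R < 1 := by
    rw [div_lt_one hsR]
    exact Real.sin_lt_sin_of_lt_of_le_pi_div_two (by linarith) (by linarith) hlt
  have hq0 : 0 < sin (r / 2) / sin R := by positivity
  set ψ := 2 * arccos (sin (r / 2) / sin R) with hψ
  have hcψ2 : cos (ψ / 2) = sin (r / 2) / sin R := by
    rw [hψ, mul_div_cancel_left₀ _ two_ne_zero, Real.cos_arccos (by linarith) hq1.le]
  have hψ0 : 0 < ψ := by
    have := Real.arccos_pos.2 hq1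
    positivity
  have hψπ : ψ < π := by
    have := Real.arccos_lt_pi_div_two.2 hq0
    linarith
  have he : cos r = cos R ^ 2 - sin R ^ 2 * cos ψ := by
    have a1 : cos r = 1 - 2 * sin (r / 2) ^ 2 := by
      have := Real.cos_two_mul (r / 2)
      rw [mul_div_cancel₀ _ two_ne_zero] at this
      have := Real.sin_sq_add_cos_sq (r / 2)
      linarith
    have a2 : cos ψ = 2 * cos (ψ / 2) ^ 2 - 1 := by
      have := Real.cos_two_mul (ψ / 2)
      rw [mul_div_cancel₀ _ two_ne_zero] at this
      linarith
    have a3 : sin (r / 2) = cos (ψ / 2) * sin R := by rw [hcψ2, div_mul_cancel₀ _ hsR.ne']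
    rw [a1, a2, a3]
    linear_combination -(Real.sin_sq_add_cos_sq R)
  have hin : ∀ i j, ⟪cos R • o + sin R • f i, cos R • o + sin R • f j⟫ =
      cos R ^ 2 + sin R ^ 2 * ⟪f i, f j⟫ := by
    intro i j
    have k1 := hfo i
    have k2 := hfo j
    have k3 : ⟪o, f j⟫ = 0 := by rw [real_inner_comm]; exact k2
    have k4 : ⟪o, o⟫ = 1 := by rw [real_inner_self_eq_norm_sq, ho]; norm_num
    simp only [inner_add_left, inner_add_right, inner_smul_left, inner_smul_right, k1, k3, k4,
      RCLike.conj_to_real]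
    ring
  have hff : ∀ i j, -cos ψ ≤ ⟪f i, f j⟫ := by
    intro i j
    have a := hD.inner (hfD i) (hfD j)
    rw [hin, he] at a
    have : 0 < sin R ^ 2 := by positivity
    by_contra! hcon
    nlinarith
  rw [Fin.sum_univ_three] at hs
  have hsum : ∀ j, l 0 * ⟪f 0, f j⟫ + l 1 * ⟪f 1, f j⟫ + l 2 * ⟪f 2, f j⟫ = 0 := by
    intro j
    have := congrArg (fun y => ⟪y, f j⟫) hs
    simpa only [inner_add_left, inner_smul_left, RCLike.conj_to_real, inner_zero_left] using this
  have hself : ∀ j, ⟪f j, f j⟫ = 1 := fun j => by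
    rw [real_inner_self_eq_norm_sq, hf]; norm_num
  have m : ∀ i i' j, l i * (-cos ψ) ≤ l i * ⟪f i', f j⟫ := fun i i' j =>
    mul_le_mul_of_nonneg_left (hff i' j) (hl i).le
  have t0 := hsum 0
  have t1 := hsum 1
  have t2 := hsum 2
  rw [hself] at t0 t1 t2
  have hC : 1 / 2 ≤ cos ψ := by
    have := m 1 1 0
    have := m 2 2 0
    have := m 0 0 1
    have := m 2 2 1
    have := m 0 0 2
    have := m 1 1 2
    have l0 := hl 0
    have l1 := hl 1
    have l2 := hl 2
    by_contra! hcon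
    nlinarith
  have hψ3 : ψ ≤ π / 3 := by
    by_contra! hcon
    have := Real.cos_lt_cos_of_nonneg_of_le_pi (by positivity) hψπ.le hcon
    rw [Real.cos_pi_div_three] at this
    linarith
  have hgR : gR r ψ = R := by
    rw [gR, hcψ2, div_div_cancel₀ hsr.ne']
    exact Real.arcsin_sin (by linarith) (by linarith)
  refine ⟨ψ, hψ0.le, hψ3, ?_, ?_⟩
  · choose b hb0 hb2 using fun i => exists_frame (hf i) ho (hfo i)
    have hsp := fun i => sm_spike_val r0 r1 hψ0 hψ3 (b i)
    rw [hgR] at hsp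
    have hmeas := fun i => spike_meas (b i) ψ (cos (r - R)) hp.cont
    have dcap : ∀ i, ∀ x : E 2, ‖x‖ = 1 → x ∈ {x : E 2 | cos (r - R) ≤ ⟪o, x⟫} →
        x ∈ spike (b i) ψ (cos (r - R)) (hh r R) → False := by
      intro i x _ h1 h2
      have h3 : ⟪b i 2, x⟫ < cos (r - R) := h2.2.2
      rw [hb2] at h3
      have h4 : cos (r - R) ≤ ⟪o, x⟫ := h1
      linarith
    have info : ∀ i, ∀ x : E 2, ‖x‖ = 1 → x ∈ spike (b i) ψ (cos (r - R)) (hh r R) →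
        0 < √(1 - ⟪o, x⟫ ^ 2) ∧ √(1 - ⟪o, x⟫ ^ 2) * cos ψ < ⟪f i, x⟫ := by
      intro i x hx h
      have := spike_info hp hψ0 hψ3 (b i) hx h
      rwa [hb2, hb0] at this
    have ssum : ∀ x : E 2, 0 < √(1 - ⟪o, x⟫ ^ 2) → ⟪o, x⟫ ^ 2 + √(1 - ⟪o, x⟫ ^ 2) ^ 2 = 1 := by
      intro x hx
      rw [Real.sq_sqrt (Real.sqrt_pos.1 hx).le]; ring
    have sub : ∀ i, ∀ x : E 2, ‖x‖ = 1 → x ∈ spike (b i) ψ (cos (r - R)) (hh r R) → x ∈ D := by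
      intro i x hx h
      refine hD.spike_sub hp hψ0 hψ3 he (b i) ?_ ?_ hx h.1 h.2.1
      · rw [hb2]; exact hball
      · rw [hb2, hb0]; exact hfD i
    have key := sum_lower (cap_meas o (cos (r - R))) (hmeas 0) (hmeas 1) (hmeas 2) hDm
      (dcap 0) (dcap 1) (dcap 2)
      (fun x hx h1 h2 => spike_disj ho (hf 2) (hfo 2) (hl 0) (hl 1) (hl 2) hs (hff 0 2) (hff 1 2) hx
        (info 0 x hx h1).1 (ssum x (info 0 x hx h1).1) (info 0 x hx h1).2 (info 1 x hx h2).2)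
      (fun x hx h1 h2 => spike_disj ho (hf 1) (hfo 1) (hl 0) (hl 2) (hl 1)
        (by rw [← hs]; abel) (hff 0 1) (hff 2 1) hx
        (info 0 x hx h1).1 (ssum x (info 0 x hx h1).1) (info 0 x hx h1).2 (info 2 x hx h2).2)
      (fun x hx h1 h2 => spike_disj ho (hf 0) (hfo 0) (hl 1) (hl 2) (hl 0)
        (by rw [← hs]; abel) (hff 1 0) (hff 2 0) hx
        (info 1 x hx h1).1 (ssum x (info 1 x hx h1).1) (info 1 x hx h1).2 (info 2 x hx h2).2)
      hball (sub 0) (sub 1) (sub 2)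
    have q0 := hsp 0
    have q1 := hsp 1
    have q2 := hsp 2
    rw [hcap] at key
    rw [gG, hgR]
    linarith
  · intro hψe
    have hC2 : cos ψ = 1 / 2 := by rw [hψe, Real.cos_pi_div_three]
    have hval : ∀ i j, ⟪f i, f j⟫ = -(1 / 2) →
        ⟪cos R • o + sin R • f i, cos R • o + sin R • f j⟫ = cos r := by
      intro i j h
      rw [hin, h, he, hC2]; ring
    have c01 := real_inner_comm (f 0) (f 1)
    have c02 := real_inner_comm (f 0) (f 2)
    have c12 := real_inner_comm (f 1) (f 2)
    have l0 := hl 0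
    have l1 := hl 1
    have l2 := hl 2
    have a01 := hff 0 1
    have a02 := hff 0 2
    have a12 := hff 1 2
    rw [hC2] at a01 a02 a12
    rw [c01, c02] at t0
    rw [c12] at t1
    have e01 : (l 0 + l 1) * (⟪f 0, f 1⟫ + 1 / 2) + (l 0 + l 2) * (⟪f 0, f 2⟫ + 1 / 2) +
      (l 1 + l 2) * (⟪f 1, f 2⟫ + 1 / 2) = 0 := by linear_combination t0 + t1 + t2
    have p1 : 0 ≤ (l 0 + l 1) * (⟪f 0, f 1⟫ + 1 / 2) := mul_nonneg (by linarith) (by linarith)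
    have p2 : 0 ≤ (l 0 + l 2) * (⟪f 0, f 2⟫ + 1 / 2) := mul_nonneg (by linarith) (by linarith)
    have p3 : 0 ≤ (l 1 + l 2) * (⟪f 1, f 2⟫ + 1 / 2) := mul_nonneg (by linarith) (by linarith)
    have z1 : ⟪f 0, f 1⟫ = -(1 / 2) := by
      rcases mul_eq_zero.1 (show (l 0 + l 1) * (⟪f 0, f 1⟫ + 1 / 2) = 0 by linarith) with h | h <;>
        linarith
    have z2 : ⟪f 0, f 2⟫ = -(1 / 2) := by
      rcases mul_eq_zero.1 (show (l 0 + l 2) * (⟪f 0, f 2⟫ + 1 / 2) = 0 by linarith) with h | h <;>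
        linarith
    have z3 : ⟪f 1, f 2⟫ = -(1 / 2) := by
      rcases mul_eq_zero.1 (show (l 1 + l 2) * (⟪f 1, f 2⟫ + 1 / 2) = 0 by linarith) with h | h <;>
        linarith
    exact ⟨_, hfD 0, _, hfD 1, _, hfD 2, hval _ _ z1, hval _ _ z3, hval _ _ z2⟩

end
end SphericalPal

namespace SphericalPal

/-! ### the Reuleaux triangle -/

section
variable {r : ℝ}

lemma hyper_null {n : E 2} (hn : n ≠ 0) : sm {x : E 2 | ⟪n, x⟫ = 0} = 0 := by
  have hm : MeasurableSet {x : E 2 | ⟪n, x⟫ = 0} :=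
    (isClosed_eq (by fun_prop) continuous_const).measurableSet
  rw [sm_apply hm]
  have hsub : nz ⁻¹' {x : E 2 | ⟪n, x⟫ = 0} ∩ pball ⊆ ((Submodule.span ℝ {n})ᗮ : Submodule ℝ (E 2)) := by
    rintro x ⟨h1, h2⟩
    have h1' : ⟪n, nz x⟫ = 0 := h1
    have h3 : ⟪n, x⟫ = 0 := by rw [← norm_smul_nz x, inner_smul_right, h1', mul_zero]
    exact (Submodule.mem_orthogonal_singleton_iff_inner_right).2 h3
  refine measure_mono_null hsub (Measure.addHaar_submodule _ _ ?_)
  intro h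
  have : n ∈ ((Submodule.span ℝ {n})ᗮ : Submodule ℝ (E 2)) := by rw [h]; trivial
  rw [Submodule.mem_orthogonal_singleton_iff_inner_right] at this
  exact hn (inner_self_eq_zero.1 this)

/-- Reuleaux triangle as a set -/
def reul (r : ℝ) (x : Fin 3 → E 2) : Set (E 2) := {y | ‖y‖ = 1 ∧ ∀ i, cos r ≤ ⟪x i, y⟫}

lemma reul_closed (x : Fin 3 → E 2) : IsClosed (reul r x) := by
  have : reul r x = {y : E 2 | ‖y‖ = 1} ∩ ⋂ i, {y : E 2 | cos r ≤ ⟪x i, y⟫} := by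
    ext y; simp [reul]
  rw [this]
  exact (isClosed_eq continuous_norm continuous_const).inter
    (isClosed_iInter fun i => isClosed_le (by fun_prop) (by fun_prop))

lemma gR_third (h0 : 0 < r) (h1 : r < π / 2) :
    sin (gR r (π / 3)) ^ 2 = 2 / 3 * (1 - cos r) ∧ cos (gR r (π / 3)) ^ 2 = (1 + 2 * cos r) / 3 := by
  have pp := Real.pi_pos
  have a := g_sinR h0 h1 (by positivity) (le_refl (π / 3))
  rw [show π / 3 / 2 = π / 6 by ring, Real.cos_pi_div_six] at a
  have b : sin (gR r (π / 3)) ^ 2 = 2 / 3 * (1 - cos r) := by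
    rw [a, div_pow, div_pow, Real.sq_sqrt (by norm_num)]
    have c := Real.cos_two_mul (r / 2)
    rw [mul_div_cancel₀ _ two_ne_zero] at c
    have d := Real.sin_sq_add_cos_sq (r / 2)
    rw [show sin (r / 2) ^ 2 = (1 - cos r) / 2 by linarith]
    ring
  refine ⟨b, ?_⟩
  have := Real.sin_sq_add_cos_sq (gR r (π / 3))
  linarith

lemma exists_tri (h0 : 0 < r) (h1 : r < π / 2) {x : Fin 3 → E 2} (hx : ∀ i, ‖x i‖ = 1)
    (hxx : ∀ i j, i ≠ j → ⟪x i, x j⟫ = cos r) : ∃ (o : E 2) (f : Fin 3 → E 2), ‖o‖ = 1 ∧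
      (∀ i, ‖f i‖ = 1) ∧ (∀ i, ⟪f i, o⟫ = 0) ∧ (∀ i j, i ≠ j → ⟪f i, f j⟫ = -(1 / 2)) ∧
      f 0 + f 1 + f 2 = 0 ∧
      ∀ i, x i = cos (gR r (π / 3)) • o + sin (gR r (π / 3)) • f i := by
  have hp := g_par h0 h1 (by positivity) (le_refl (π / 3))
  obtain ⟨es, ec⟩ := gR_third h0 h1
  set R := gR r (π / 3) with hR
  have hsR := hp.sR
  have hcR := hp.cR
  have hself : ∀ i, ⟪x i, x i⟫ = 1 := fun i => by rw [real_inner_self_eq_norm_sq, hx]; norm_num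
  have h01 := hxx 0 1 (by decide)
  have h02 := hxx 0 2 (by decide)
  have h12 := hxx 1 2 (by decide)
  have h10 := hxx 1 0 (by decide)
  have h20 := hxx 2 0 (by decide)
  have h21 := hxx 2 1 (by decide)
  set o := (3 * cos R)⁻¹ • (x 0 + x 1 + x 2) with ho
  have hxo : ∀ i, ⟪x i, o⟫ = cos R := by
    have : ∀ i, ⟪x i, x 0 + x 1 + x 2⟫ = 1 + 2 * cos r := by
      intro i
      simp only [inner_add_right]
      fin_cases i
      · have := hself 0; simp only [Fin.zero_eta]; linarith
      · have := hself 1; simp only [Fin.mk_one]; linarith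
      · have := hself 2; simp only [Fin.reduceFinMk]; linarith
    intro i
    rw [ho, inner_smul_right, this, inv_mul_eq_iff_eq_mul₀ (by positivity)]
    linarith
  have hoo : ⟪o, o⟫ = 1 := by
    nth_rewrite 1 [ho]
    rw [inner_smul_left]
    simp only [inner_add_left, hxo, RCLike.conj_to_real]
    field_simp
    norm_num
  have hon : ‖o‖ = 1 := by
    rw [real_inner_self_eq_norm_sq] at hoo
    exact (pow_left_inj₀ (norm_nonneg _) zero_le_one two_ne_zero).1 (by linarith)
  have hox : ∀ i, ⟪o, x i⟫ = cos R := fun i => by rw [real_inner_comm]; exact hxo i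
  have hin : ∀ i j, ⟪(sin R)⁻¹ • (x i - cos R • o), (sin R)⁻¹ • (x j - cos R • o)⟫ =
      (⟪x i, x j⟫ - cos R ^ 2) / sin R ^ 2 := by
    intro i j
    simp only [inner_smul_left, inner_smul_right, inner_sub_left, inner_sub_right, hxo, hox, hoo,
      RCLike.conj_to_real]
    field_simp
    ring
  have hs2 : sin R ^ 2 ≠ 0 := by positivity
  refine ⟨o, fun i => (sin R)⁻¹ • (x i - cos R • o), hon, ?_, ?_, ?_, ?_, ?_⟩
  · intro i
    have := hin i i
    rw [real_inner_self_eq_norm_sq, hself, show 1 - cos R ^ 2 = sin R ^ 2 by linarith,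
      div_self hs2] at this
    exact (pow_left_inj₀ (norm_nonneg _) zero_le_one two_ne_zero).1 (by linarith)
  · intro i
    rw [inner_smul_left, inner_sub_left, inner_smul_left, hxo, hoo]; simp
  · intro i j hij
    rw [hin, hxx i j hij, div_eq_iff hs2]
    linarith
  · simp only [← smul_add]
    have : x 0 - cos R • o + (x 1 - cos R • o) + (x 2 - cos R • o) = 0 := by
      have e : x 0 + x 1 + x 2 = (3 * cos R) • o := by
        rw [ho, smul_smul, mul_inv_cancel₀ (by positivity), one_smul]
      have : x 0 - cos R • o + (x 1 - cos R • o) + (x 2 - cos R • o) =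
        (x 0 + x 1 + x 2) - (3 * cos R) • o := by module
      rw [this, e, sub_self]
    rw [this, smul_zero]
  · intro i
    change x i = cos R • o + sin R • (sin R)⁻¹ • (x i - cos R • o)
    rw [smul_inv_smul₀ hsR.ne']; abel

lemma tri_sq {o : E 2} {f : Fin 3 → E 2} (ho : ‖o‖ = 1) (hf : ∀ i, ‖f i‖ = 1) (hfo : ∀ i, ⟪f i, o⟫ = 0)
    (hff : ∀ i j, i ≠ j → ⟪f i, f j⟫ = -(1 / 2)) (hs : f 0 + f 1 + f 2 = 0) (x : E 2) {s : ℝ}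
    (hx : ⟪o, x⟫ ^ 2 + s ^ 2 = ‖x‖ ^ 2) :
    ⟪f 0, x⟫ + ⟪f 1, x⟫ + ⟪f 2, x⟫ = 0 ∧ ⟪f 0, x⟫ ^ 2 + ⟪f 1, x⟫ ^ 2 + ⟪f 2, x⟫ ^ 2 = 3 / 2 * s ^ 2 := by
  have hsum : ⟪f 0, x⟫ + ⟪f 1, x⟫ + ⟪f 2, x⟫ = 0 := by
    rw [← inner_add_left, ← inner_add_left, hs, inner_zero_left]
  refine ⟨hsum, ?_⟩
  obtain ⟨b, hb0, hb2⟩ := exists_frame (hf 0) ho (hfo 0)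
  have hpars : ∀ y z : E 2, ⟪y, z⟫ = ⟪b 0, y⟫ * ⟪b 0, z⟫ + ⟪b 1, y⟫ * ⟪b 1, z⟫ + ⟪b 2, y⟫ * ⟪b 2, z⟫ := by
    intro y z
    have := b.sum_inner_mul_inner y z
    rw [Fin.sum_univ_three] at this
    rw [← this, real_inner_comm y (b 0), real_inner_comm y (b 1), real_inner_comm y (b 2)]
  have q1 := hpars (f 1) (f 1)
  have q2 := hpars (f 1) x
  have q3 := hpars x x
  have a1 : ⟪b 2, f 1⟫ = 0 := by rw [hb2, real_inner_comm]; exact hfo 1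
  have a2 : ⟪b 0, f 1⟫ = -(1 / 2) := by rw [hb0]; exact hff 0 1 (by decide)
  rw [a1, a2, real_inner_self_eq_norm_sq, hf] at q1
  rw [a1, a2, hb0] at q2
  rw [real_inner_self_eq_norm_sq, ← hx, hb2, hb0] at q3
  have e2 : ⟪f 2, x⟫ = -⟪f 0, x⟫ - ⟪f 1, x⟫ := by linarith
  rw [e2, q2]
  have e3 : ⟪b 1, f 1⟫ ^ 2 = 3 / 4 := by linarith
  linear_combination (2 * ⟪b 1, x⟫ ^ 2) * e3 - 3 / 2 * q3

lemma tri_dir {p₁ p₂ p₃ s β : ℝ} (h1 : p₁ + p₂ + p₃ = 0)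
    (h2 : p₁ ^ 2 + p₂ ^ 2 + p₃ ^ 2 = 3 / 2 * s ^ 2) (hs : 0 ≤ s) (hβ : 0 ≤ sin β)
    (hp : p₁ = s * cos β) : p₂ ≤ -(s * cos (π / 3 - β)) ∨ p₃ ≤ -(s * cos (π / 3 - β)) := by
  rw [Real.cos_sub, Real.cos_pi_div_three, Real.sin_pi_div_three]
  have e3 : (√3) ^ 2 = 3 := Real.sq_sqrt (by norm_num)
  have hd : (p₂ - p₃) ^ 2 = (√3 * (s * sin β)) ^ 2 := by
    rw [mul_pow, e3]
    have := Real.sin_sq_add_cos_sq β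
    have q : p₃ = -p₁ - p₂ := by linarith
    subst q; subst hp
    linear_combination 2 * h2 - 3 * s ^ 2 * this
  rcases le_total p₂ p₃ with h | h
  · left
    have k : p₃ - p₂ = √3 * (s * sin β) := by
      refine (pow_left_inj₀ (by linarith) (by positivity) two_ne_zero).1 ?_
      rw [← hd]; ring
    rw [show s * (1 / 2 * cos β + √3 / 2 * sin β) = (s * cos β + √3 * (s * sin β)) / 2 by ring]
    linarith
  · right
    have k : p₂ - p₃ = √3 * (s * sin β) := by
      refine (pow_left_inj₀ (by linarith) (by positivity) two_ne_zero).1 ?_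
      rw [← hd]
    rw [show s * (1 / 2 * cos β + √3 / 2 * sin β) = (s * cos β + √3 * (s * sin β)) / 2 by ring]
    linarith

lemma tri_max {p₁ p₂ p₃ s : ℝ} (h1 : p₁ + p₂ + p₃ = 0)
    (h2 : p₁ ^ 2 + p₂ ^ 2 + p₃ ^ 2 = 3 / 2 * s ^ 2) (n12 : p₁ ≠ p₂) (n13 : p₁ ≠ p₃) (n23 : p₂ ≠ p₃) :
    s / 2 < p₁ ∨ s / 2 < p₂ ∨ s / 2 < p₃ := by
  by_contra! hcon
  obtain ⟨a1, a2, a3⟩ := hcon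
  have b1 : 0 ≤ (s / 2 - p₁) * (s / 2 - p₂) := mul_nonneg (by linarith) (by linarith)
  have b2 : 0 ≤ (s / 2 - p₁) * (s / 2 - p₃) := mul_nonneg (by linarith) (by linarith)
  have b3 : 0 ≤ (s / 2 - p₂) * (s / 2 - p₃) := mul_nonneg (by linarith) (by linarith)
  have e : (s / 2 - p₁) * (s / 2 - p₂) + (s / 2 - p₁) * (s / 2 - p₃) + (s / 2 - p₂) * (s / 2 - p₃) = 0 := by
    have q : p₃ = -p₁ - p₂ := by linarith
    subst q
    linear_combination -1 / 2 * h2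
  have z1 := mul_eq_zero.1 (show (s / 2 - p₁) * (s / 2 - p₂) = 0 by linarith)
  have z2 := mul_eq_zero.1 (show (s / 2 - p₁) * (s / 2 - p₃) = 0 by linarith)
  have z3 := mul_eq_zero.1 (show (s / 2 - p₂) * (s / 2 - p₃) = 0 by linarith)
  rcases z1 with z | z
  · rcases z3 with z' | z'
    · exact n12 (by linarith)
    · exact n13 (by linarith)
  · rcases z2 with z' | z'
    · exact n12 (by linarith)
    · exact n23 (by linarith)

end
end SphericalPal

namespace SphericalPal

section
variable {r : ℝ}

lemma pc_re (b : OrthonormalBasis (Fin 3) ℝ (E 2)) (y : E 2) :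
    ⟪b 0, y⟫ = ‖pc b y‖ * cos |(pc b y).arg| := by
  rw [Real.cos_abs, Complex.norm_mul_cos_arg]
  rfl

/-- scalar membership criterion in a spike -/
lemma spike_of {R : ℝ} (hp : Par r R) (b : OrthonormalBasis (Fin 3) ℝ (E 2)) {y : E 2} (hy : ‖y‖ = 1)
    {p₂ p₃ c : ℝ} (h1 : ⟪b 0, y⟫ + p₂ + p₃ = 0)
    (h2 : ⟪b 0, y⟫ ^ 2 + p₂ ^ 2 + p₃ ^ 2 = 3 / 2 * ‖pc b y‖ ^ 2)
    (hm : ‖pc b y‖ / 2 < ⟪b 0, y⟫) (c2 : cos r ≤ cos R * ⟪b 2, y⟫ + sin R * p₂)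
    (c3 : cos r ≤ cos R * ⟪b 2, y⟫ + sin R * p₃) (hc : ⟪b 2, y⟫ < c) :
    y ∈ spike b (π / 3) c (hh r R) := by
  have pp := Real.pi_pos
  have hn := fr_norm b y
  rw [hy] at hn
  have hpc := pc_re b y
  have hs : 0 ≤ ‖pc b y‖ := norm_nonneg _
  set β := |(pc b y).arg| with hβ
  have hβ0 : 0 ≤ β := abs_nonneg _
  have hβπ : β ≤ π := Complex.abs_arg_le_pi _
  have hlt : β < π / 3 := by
    by_contra! hcon
    have := Real.cos_le_cos_of_nonneg_of_le_pi (by positivity) hβπ hcon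
    rw [Real.cos_pi_div_three] at this
    have := mul_le_mul_of_nonneg_left this hs
    linarith
  have hct : 0 ≤ cos (π / 3 - β) := Real.cos_nonneg_of_mem_Icc ⟨by linarith, by linarith⟩
  have hsin : 0 ≤ sin β := Real.sin_nonneg_of_nonneg_of_le_pi hβ0 hβπ
  refine ⟨hlt, ?_, hc⟩
  change hh r R (π / 3 - β) ≤ _
  have hsR := hp.sR
  refine hp.hh_le_of hct hs (by linarith) ?_
  rcases tri_dir h1 h2 hs hsin hpc with h | h
  · have := mul_le_mul_of_nonneg_left h hsR.le
    linarith
  · have := mul_le_mul_of_nonneg_left h hsR.le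
    linarith

lemma reul_upper (h0 : 0 < r) (h1 : r < π / 2) {x : Fin 3 → E 2} (hx : ∀ i, ‖x i‖ = 1)
    (hxx : ∀ i j, i ≠ j → ⟪x i, x j⟫ = cos r) : 3 * (sm (reul r x)).toReal ≤ gG r (π / 3) := by
  obtain ⟨o, f, ho, hf, hfo, hff, hs, hxf⟩ := exists_tri h0 h1 hx hxx
  have pp := Real.pi_pos
  have hp := g_par h0 h1 (by positivity) (le_refl (π / 3))
  choose b hb0 hb2 using fun i => exists_frame (hf i) ho (hfo i)
  set c := cos (r - gR r (π / 3)) with hc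
  have hc1 : c < 1 := by
    rw [hc, ← Real.cos_zero]
    exact Real.cos_lt_cos_of_nonneg_of_le_pi le_rfl (by linarith [hp.R0]) (by linarith [hp.Rr])
  have hc0 : 0 < c := Real.cos_pos_of_mem_Ioo ⟨by linarith [hp.Rr], by linarith [hp.R0]⟩
  have v := fun i => sm_spike_val h0 h1 (by positivity) (le_refl (π / 3)) (b i)
  have vc := sm_cap ho hc0 hc1
  have hne : ∀ i j, i ≠ j → f i - f j ≠ 0 := by
    intro i j hij h
    have e : f i = f j := sub_eq_zero.1 h
    have := hff i j hij
    rw [e, real_inner_self_eq_norm_sq, hf] at this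
    norm_num at this
  have n01 := hyper_null (hne 0 1 (by decide))
  have n02 := hyper_null (hne 0 2 (by decide))
  have n12 := hyper_null (hne 1 2 (by decide))
  have hcont := hp.cont
  have ms := fun i => spike_meas (b i) (π / 3) c hcont
  have mc := cap_meas o c
  have mh : ∀ n : E 2, MeasurableSet {x : E 2 | ⟪n, x⟫ = 0} := fun n =>
    (isClosed_eq (by fun_prop) continuous_const).measurableSet
  have hmono := sm_mono (reul_closed (r := r) x).measurableSet
    ((((((mc.union (ms 0)).union (ms 1)).union (ms 2)).union (mh (f 0 - f 1))).union
      (mh (f 0 - f 2))).union (mh (f 1 - f 2))) ?_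
  · have t : ∀ A B : Set (E 2), (sm (A ∪ B)).toReal ≤ (sm A).toReal + (sm B).toReal :=
      fun A B => measureReal_union_le A B
    have t1 := t (((((({x : E 2 | c ≤ ⟪o, x⟫} ∪ spike (b 0) (π / 3) c (hh r (gR r (π / 3)))) ∪ spike (b 1) (π / 3) c (hh r (gR r (π / 3)))) ∪ spike (b 2) (π / 3) c (hh r (gR r (π / 3)))) ∪ {x : E 2 | ⟪f 0 - f 1, x⟫ = 0}) ∪ {x : E 2 | ⟪f 0 - f 2, x⟫ = 0})) {x : E 2 | ⟪f 1 - f 2, x⟫ = 0}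
    have t2 := t ((((({x : E 2 | c ≤ ⟪o, x⟫} ∪ spike (b 0) (π / 3) c (hh r (gR r (π / 3)))) ∪ spike (b 1) (π / 3) c (hh r (gR r (π / 3)))) ∪ spike (b 2) (π / 3) c (hh r (gR r (π / 3)))) ∪ {x : E 2 | ⟪f 0 - f 1, x⟫ = 0})) {x : E 2 | ⟪f 0 - f 2, x⟫ = 0}
    have t3 := t (((({x : E 2 | c ≤ ⟪o, x⟫} ∪ spike (b 0) (π / 3) c (hh r (gR r (π / 3)))) ∪ spike (b 1) (π / 3) c (hh r (gR r (π / 3)))) ∪ spike (b 2) (π / 3) c (hh r (gR r (π / 3))))) {x : E 2 | ⟪f 0 - f 1, x⟫ = 0}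
    have t4 := t ((({x : E 2 | c ≤ ⟪o, x⟫} ∪ spike (b 0) (π / 3) c (hh r (gR r (π / 3)))) ∪ spike (b 1) (π / 3) c (hh r (gR r (π / 3))))) (spike (b 2) (π / 3) c (hh r (gR r (π / 3))))
    have t5 := t (({x : E 2 | c ≤ ⟪o, x⟫} ∪ spike (b 0) (π / 3) c (hh r (gR r (π / 3))))) (spike (b 1) (π / 3) c (hh r (gR r (π / 3))))
    have t6 := t ({x : E 2 | c ≤ ⟪o, x⟫}) (spike (b 0) (π / 3) c (hh r (gR r (π / 3))))
    rw [n12] at t1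
    rw [n02] at t2
    rw [n01] at t3
    rw [ENNReal.toReal_zero] at t1 t2 t3
    have v0 := v 0
    have v1 := v 1
    have v2 := v 2
    rw [vc] at t6
    rw [gG]
    rw [← hc] at v0 v1 v2 ⊢
    linarith
  · intro y hy hyU
    by_cases e01 : ⟪f 0 - f 1, y⟫ = 0
    · exact Or.inl (Or.inl (Or.inr e01))
    by_cases e02 : ⟪f 0 - f 2, y⟫ = 0
    · exact Or.inl (Or.inr e02)
    by_cases e12 : ⟪f 1 - f 2, y⟫ = 0
    · exact Or.inr e12
    refine Or.inl (Or.inl (Or.inl ?_))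
    by_cases hz : c ≤ ⟪o, y⟫
    · exact Or.inl (Or.inl (Or.inl hz))
    push Not at hz
    rw [inner_sub_left, sub_eq_zero] at e01 e02 e12
    have hsq : ∀ i, ⟪o, y⟫ ^ 2 + ‖pc (b i) y‖ ^ 2 = ‖y‖ ^ 2 := fun i => by
      rw [fr_norm (b i), hb2]
    have hpe : ∀ i, ‖pc (b i) y‖ = ‖pc (b 0) y‖ := fun i => by
      refine (pow_left_inj₀ (norm_nonneg _) (norm_nonneg _) two_ne_zero).1 ?_
      linarith [hsq i, hsq 0]
    obtain ⟨s1, s2⟩ := tri_sq ho hf hfo hff hs y (hsq 0)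
    have hcr : ∀ i, cos r ≤ cos (gR r (π / 3)) * ⟪o, y⟫ + sin (gR r (π / 3)) * ⟪f i, y⟫ := by
      intro i
      have := hyU.2 i
      rw [hxf i, inner_add_left, inner_smul_left, inner_smul_left] at this
      simpa using this
    rcases tri_max s1 s2 e01 e02 e12 with h | h | h
    · refine Or.inl (Or.inl (Or.inr ?_))
      refine spike_of hp (b 0) hy (p₂ := ⟪f 1, y⟫) (p₃ := ⟪f 2, y⟫) ?_ ?_ ?_ ?_ ?_ ?_ <;>
        simp only [hb0, hb2]
      · linarith
      · linarith
      · exact h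
      · exact hcr 1
      · exact hcr 2
      · exact hz
    · refine Or.inl (Or.inr ?_)
      refine spike_of hp (b 1) hy (p₂ := ⟪f 0, y⟫) (p₃ := ⟪f 2, y⟫) ?_ ?_ ?_ ?_ ?_ ?_ <;>
        simp only [hb0, hb2, hpe 1]
      · linarith
      · linarith
      · exact h
      · exact hcr 0
      · exact hcr 2
      · exact hz
    · refine Or.inr ?_
      refine spike_of hp (b 2) hy (p₂ := ⟪f 0, y⟫) (p₃ := ⟪f 1, y⟫) ?_ ?_ ?_ ?_ ?_ ?_ <;>
        simp only [hb0, hb2, hpe 2]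
      · linarith
      · linarith
      · exact h
      · exact hcr 0
      · exact hcr 1
      · exact hz

end
end SphericalPal

namespace SphericalPal

section
variable {r : ℝ}

lemma IsCC.convex' {C : Set (E 2)} (hC : IsCC C) : Convex ℝ C := by
  intro a ha b hb s t hs ht _
  exact hC.add _ (hC.smul s hs a ha) _ (hC.smul t ht b hb)

/-- a closed set of full measure in a solid cone is everything -/
lemma full_of_sm {A C : Set (E 2)} (hA : IsClosed A) (hC : IsCC C) (hi : (interior C).Nonempty)
    (hAC : ∀ u, ‖u‖ = 1 → u ∈ A → u ∈ C) (hm : (sm C).toReal ≤ (sm A).toReal) :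
    ∀ u, ‖u‖ = 1 → u ∈ C → u ∈ A := by
  intro y hy hyC
  by_contra hyA
  have hy0 : y ≠ 0 := by rintro rfl; simp at hy
  have hV : nz ⁻¹' Aᶜ ∈ nhds y := by
    apply (nz_continuousAt hy0).preimage_mem_nhds
    rw [nz_of_unit hy]
    exact hA.isOpen_compl.mem_nhds hyA
  have hcl : y ∈ closure (interior C) :=
    (hC.convex'.closure_interior_eq_closure_of_nonempty_interior hi).ge (subset_closure hyC)
  obtain ⟨z, ⟨hz1, hz2⟩, hz3⟩ := mem_closure_iff_nhds.1 hcl _ (Filter.inter_mem hV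
    (isOpen_compl_singleton.mem_nhds (show y ∈ ({0}ᶜ : Set (E 2)) from hy0)))
  have hz0 : z ≠ 0 := hz2
  set W : Set (E 2) := {u | ‖z‖ • u ∈ interior C} ∩ Aᶜ with hW
  have hWo : IsOpen W := (isOpen_interior.preimage (by fun_prop : Continuous fun u : E 2 => ‖z‖ • u)).inter
    hA.isOpen_compl
  have hzW : nz z ∈ W := by
    refine ⟨?_, hz1⟩
    change ‖z‖ • nz z ∈ interior C
    rwa [norm_smul_nz]
  have hpos := sm_open_pos hWo (nz_norm hz0) hzW
  have hpos' : 0 < (sm W).toReal := ENNReal.toReal_pos hpos.ne' (measure_ne_top _ _)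
  have hd : Disjoint A W := by
    rw [Set.disjoint_left]
    exact fun u h1 h2 => h2.2 h1
  have h1 : (sm (A ∪ W)).toReal = (sm A).toReal + (sm W).toReal :=
    measureReal_union hd hWo.measurableSet
  have h2 := sm_mono (hA.measurableSet.union hWo.measurableSet) hC.closed.measurableSet (by
    rintro u hu (h | h)
    · exact hAC u hu h
    · have : ‖z‖ • u ∈ C := interior_subset h.1
      have h3 := hC.smul _ (inv_nonneg.2 (norm_nonneg z)) _ this
      rwa [inv_smul_smul₀ (norm_ne_zero_iff.2 hz0)] at h3)
  linarith

/-- the cone over the Reuleaux triangle -/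
def rcone (r : ℝ) (x : Fin 3 → E 2) : Set (E 2) := {v | ∀ i, cos r * ‖v‖ ≤ ⟪x i, v⟫}

lemma rcone_unit {x : Fin 3 → E 2} {u : E 2} (hu : ‖u‖ = 1) : u ∈ rcone r x ↔ u ∈ reul r x := by
  simp [rcone, reul, hu]

lemma rcone_cc (hr : 0 ≤ cos r) (x : Fin 3 → E 2) : IsCC (rcone r x) where
  closed := by
    have : rcone r x = ⋂ i, {y : E 2 | cos r * ‖y‖ ≤ ⟪x i, y⟫} := by
      ext y; simp [rcone]
    rw [this]
    exact isClosed_iInter fun i => isClosed_le (by fun_prop) (by fun_prop)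
  zero := by simp [rcone]
  smul := by
    intro t ht a ha i
    rw [norm_smul, Real.norm_of_nonneg ht, inner_smul_right]
    have := mul_le_mul_of_nonneg_left (ha i) ht
    linarith
  add := by
    intro a ha b hb i
    rw [inner_add_right]
    have := mul_le_mul_of_nonneg_left (norm_add_le a b) hr
    linarith [ha i, hb i]

lemma tri_inner {o : E 2} {f x : Fin 3 → E 2} (ho : ‖o‖ = 1) (hfo : ∀ i, ⟪f i, o⟫ = 0) {p q : ℝ}
    (hx : ∀ i, x i = p • o + q • f i) (i : Fin 3) : ⟪x i, o⟫ = p := by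
  rw [hx, inner_add_left, inner_smul_left, inner_smul_left, hfo, real_inner_self_eq_norm_sq, ho]
  simp

lemma reul_comp (h0 : 0 < r) (h1 : r < π / 2) {x : Fin 3 → E 2} (hx : ∀ i, ‖x i‖ = 1)
    (hxx : ∀ i j, i ≠ j → ⟪x i, x j⟫ = cos r) :
    IsComp r (reul r x) ∧ 3 * (sm (reul r x)).toReal = gG r (π / 3) := by
  obtain ⟨o, f, ho, hf, hfo, hff, hs, hxf⟩ := exists_tri h0 h1 hx hxx
  have pp := Real.pi_pos
  have hp := g_par h0 h1 (by positivity) (le_refl (π / 3))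
  have hcr : 0 < cos r := Real.cos_pos_of_mem_Ioo ⟨by linarith, by linarith⟩
  have hup := reul_upper h0 h1 hx hxx
  obtain ⟨D, hMD, hD⟩ := exists_comp h0 h1 (M := Set.range x) (by rintro _ ⟨i, rfl⟩; exact hx i) (by
    rintro _ ⟨i, rfl⟩ _ ⟨j, rfl⟩
    by_cases hij : i = j
    · rw [hij, real_inner_self_eq_norm_sq, hx]; simpa using Real.cos_le_one r
    · exact (hxx i j hij).ge)
  have hDU : D ⊆ reul r x := fun y hy => ⟨hD.norm hy, fun i => hD.inner (hMD ⟨i, rfl⟩) hy⟩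
  obtain ⟨ψ, hψ0, hψ1, hl, -⟩ := hD.lower
  have hanti : gG r (π / 3) ≤ gG r ψ :=
    (gG_anti h0 h1).antitoneOn ⟨hψ0, hψ1⟩ ⟨by positivity, le_rfl⟩ hψ1
  have hmono := sm_mono hD.closed.measurableSet (reul_closed (r := r) x).measurableSet
    (fun u _ h => hDU h)
  have hcc := rcone_cc hcr.le x
  have heq : (sm (rcone r x)).toReal = (sm (reul r x)).toReal := by
    rw [sm_congr hcc.closed.measurableSet (reul_closed (r := r) x).measurableSet]
    intro u hu; exact rcone_unit hu
  have hint : (interior (rcone r x)).Nonempty := by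
    refine ⟨o, mem_interior.2 ⟨⋂ i, {y : E 2 | cos r * ‖y‖ < ⟪x i, y⟫}, ?_, ?_, ?_⟩⟩
    · intro y hy i
      exact (Set.mem_iInter.1 hy i).le
    · exact isOpen_iInter_of_finite fun i => isOpen_lt (by fun_prop) (by fun_prop)
    · refine Set.mem_iInter.2 fun i => ?_
      change cos r * ‖o‖ < ⟪x i, o⟫
      rw [tri_inner ho hfo hxf, ho, mul_one]
      exact Real.cos_lt_cos_of_nonneg_of_le_pi hp.R0.le (by linarith) hp.Rr
  have hfull := full_of_sm hD.closed hcc hint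
    (fun u hu h => (rcone_unit hu).2 (hDU h)) (by linarith)
  have hE : reul r x = D := by
    refine Set.Subset.antisymm (fun y hy => ?_) hDU
    exact hfull y hy.1 ((rcone_unit hy.1).2 hy)
  refine ⟨hE ▸ hD, ?_⟩
  linarith

end
end SphericalPal

namespace SphericalPal

section
variable {r : ℝ}

lemma gball_iff {p y : E 2} (hp : ‖p‖ = 1) {a : ℝ} (h0 : 0 ≤ a) (h1 : a ≤ π) :
    y ∈ gball p a ↔ ‖y‖ = 1 ∧ cos a ≤ ⟪p, y⟫ := by
  change (y ∈ unitSphere 2 ∧ Real.arccos ⟪p, y⟫ ≤ a) ↔ _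
  rw [mem_us]
  refine and_congr_right fun hy => ?_
  have hb := abs_le.1 (abs_real_inner_le_norm p y)
  rw [hp, hy, mul_one] at hb
  rw [← Real.strictAntiOn_cos.le_iff_ge ⟨h0, h1⟩ ⟨Real.arccos_nonneg _, Real.arccos_le_pi _⟩,
    Real.cos_arccos hb.1 hb.2]

lemma inner_pos_of_interior {C : Set (E 2)} {p y : E 2} (hp : p ∈ interior C) (hy : ‖y‖ = 1)
    (h : ∀ c ∈ C, 0 ≤ ⟪c, y⟫) : 0 < ⟪p, y⟫ := by
  obtain ⟨ε, hε, hb⟩ := Metric.isOpen_iff.1 isOpen_interior p hp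
  have : p - (ε / 2) • y ∈ C := by
    apply interior_subset
    apply hb
    rw [Metric.mem_ball, dist_eq_norm, sub_sub_cancel_left, norm_neg, norm_smul, hy, mul_one,
      Real.norm_of_nonneg (by positivity)]
    linarith
  have := h _ this
  rw [inner_sub_left, inner_smul_left, us_inner_self hy] at this
  simp at this
  linarith

lemma dual_rcone {x : Fin 3 → E 2} {y v : E 2} (hy : y ∈ dual (reul r x)) (hv : v ∈ rcone r x)
    (hr : 0 ≤ cos r) : 0 ≤ ⟪v, y⟫ := by
  by_cases h0 : v = 0
  · rw [h0, inner_zero_left]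
  have h1 : nz v ∈ rcone r x := (rcone_cc hr x).smul _ (inv_nonneg.2 (norm_nonneg v)) _ hv
  have h2 := hy.2 _ ((rcone_unit (nz_norm h0)).1 h1)
  rw [← norm_smul_nz v, inner_smul_left]
  simp only [RCLike.conj_to_real]
  exact mul_nonneg (norm_nonneg _) h2

lemma rcone_of_balls (hs : 0 < sin r) (hc : 0 < cos r) {x u : E 2} (hx : ‖x‖ = 1)
    (h : ∀ a, ‖a‖ = 1 → sin r ≤ ⟪x, a⟫ → 0 ≤ ⟪a, u⟫) : cos r * ‖u‖ ≤ ⟪x, u⟫ := by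
  have hxx := us_inner_self hx
  have hp : 0 ≤ ⟪x, u⟫ := h x hx (by rw [hxx]; exact Real.sin_le_one r)
  have hsc := Real.sin_sq_add_cos_sq r
  set p := ⟪x, u⟫ with hpd
  set t := u - p • x with ht
  have hxt : ⟪x, t⟫ = 0 := by rw [ht, inner_sub_right, inner_smul_right, hxx, ← hpd]; ring
  have hu : u = p • x + t := by rw [ht]; abel
  have hun : ‖u‖ ^ 2 = p ^ 2 + ‖t‖ ^ 2 := by
    have htx : ⟪t, x⟫ = 0 := by rw [real_inner_comm]; exact hxt
    rw [← real_inner_self_eq_norm_sq, ← real_inner_self_eq_norm_sq t, hu]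
    simp only [inner_add_left, inner_add_right, inner_smul_left, inner_smul_right, hxx, hxt, htx,
      RCLike.conj_to_real]
    ring
  have key : cos r * ‖t‖ ≤ sin r * p := by
    by_cases ht0 : t = 0
    · rw [ht0, norm_zero, mul_zero]; positivity
    have hxn : ⟪x, nz t⟫ = 0 := by
      rw [nz, inner_smul_right, hxt, mul_zero]
    have ha : ‖sin r • x + (-cos r) • nz t‖ = 1 :=
      norm_comb2 hx (nz_norm ht0) hxn (by rw [neg_sq]; exact hsc)
    have h1 := h _ ha (by
      rw [inner_add_right, inner_smul_right, inner_smul_right, hxx, hxn]; simp)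
    have hnt : ⟪nz t, u⟫ = ‖t‖ := by
      rw [hu, inner_add_right, inner_smul_right, real_inner_comm x (nz t), hxn]
      nth_rewrite 2 [← norm_smul_nz t]
      rw [inner_smul_right, us_inner_self (nz_norm ht0)]; ring
    rw [inner_add_left, inner_smul_left, inner_smul_left, hnt, ← hpd] at h1
    simp only [RCLike.conj_to_real] at h1
    linarith
  refine (pow_le_pow_iff_left₀ (by positivity) hp two_ne_zero).1 ?_
  have k2 := (pow_le_pow_iff_left₀ (by positivity) (by positivity) two_ne_zero).2 key
  rw [mul_pow, hun]
  rw [mul_pow, mul_pow] at k2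
  have : p ^ 2 = sin r ^ 2 * p ^ 2 + cos r ^ 2 * p ^ 2 := by linear_combination (-p ^ 2) * hsc
  linarith

lemma coneOf_convex {C : Set (E 2)} (hC : SConvex C) : Convex ℝ (coneOf C) := by
  intro a ha b hb s t hs ht _
  have sm : ∀ s : ℝ, 0 ≤ s → ∀ a ∈ coneOf C, s • a ∈ coneOf C := by
    rintro s hs _ ⟨t, ht, k, hk, rfl⟩
    exact ⟨s * t, mul_nonneg hs ht, k, hk, by rw [smul_smul]⟩
  exact hC.coneOf_add _ (sm s hs a ha) _ (sm t ht b hb)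

lemma coneOf_hull_cc {B : Set (E 2)} (hB : IsCompact B) (hne : B.Nonempty)
    (h0 : (0 : E 2) ∉ convexHull ℝ B) : IsCC (coneOf (convexHull ℝ B)) := by
  have hneH : (convexHull ℝ B).Nonempty := hne.convexHull
  refine ⟨coneOf_closed (convexHull_compact hB) h0 hneH, ?_, ?_, ?_⟩
  · obtain ⟨k, hk⟩ := hneH
    exact ⟨0, le_rfl, k, hk, by simp⟩
  · rintro s hs _ ⟨t, ht, k, hk, rfl⟩
    exact ⟨s * t, mul_nonneg hs ht, k, hk, by rw [smul_smul]⟩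
  · rintro _ ⟨s, hs, a, ha, rfl⟩ _ ⟨t, ht, b, hb, rfl⟩
    rcases (add_nonneg hs ht).eq_or_lt with h | h
    · have hs0 : s = 0 := by linarith
      have ht0 : t = 0 := by linarith
      exact ⟨0, le_rfl, a, ha, by simp [hs0, ht0]⟩
    · refine ⟨s + t, h.le, (s / (s + t)) • a + (t / (s + t)) • b,
        (convex_convexHull ℝ B) ha hb (by positivity) (by positivity) (by field_simp), ?_⟩
      rw [smul_add, smul_smul, smul_smul, mul_div_cancel₀ _ h.ne', mul_div_cancel₀ _ h.ne']

lemma rcone_interior (h0 : 0 < r) (h1 : r < π / 2) {x : Fin 3 → E 2} (hx : ∀ i, ‖x i‖ = 1)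
    (hxx : ∀ i j, i ≠ j → ⟪x i, x j⟫ = cos r) : ∃ o, ‖o‖ = 1 ∧ o ∈ interior (rcone r x) := by
  obtain ⟨o, f, ho, hf, hfo, hff, hs, hxf⟩ := exists_tri h0 h1 hx hxx
  have pp := Real.pi_pos
  have hp := g_par h0 h1 (by positivity) (le_refl (π / 3))
  refine ⟨o, ho, mem_interior.2 ⟨⋂ i, {y : E 2 | cos r * ‖y‖ < ⟪x i, y⟫}, ?_, ?_, ?_⟩⟩
  · intro y hy i
    exact (Set.mem_iInter.1 hy i).le
  · exact isOpen_iInter_of_finite fun i => isOpen_lt (by fun_prop) (by fun_prop)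
  · refine Set.mem_iInter.2 fun i => ?_
    change cos r * ‖o‖ < ⟪x i, o⟫
    rw [tri_inner ho hfo hxf, ho, mul_one]
    exact Real.cos_lt_cos_of_nonneg_of_le_pi hp.R0.le (by linarith) hp.Rr

lemma polar_eq {w : ℝ} (hw1 : π / 2 < w) (hw2 : w < π) {x : Fin 3 → E 2} (hx : ∀ i, ‖x i‖ = 1)
    (hxx : ∀ i j, i ≠ j → ⟪x i, x j⟫ = cos (π - w)) :
    polarReuleaux (x 0) (x 1) (x 2) w = dual (reul (π - w) x) := by
  have pp := Real.pi_pos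
  have h0 : 0 < π - w := by linarith
  have h1 : π - w < π / 2 := by linarith
  have hcr : 0 < cos (π - w) := Real.cos_pos_of_mem_Ioo ⟨by linarith, by linarith⟩
  have hsr : 0 < sin (π - w) := Real.sin_pos_of_pos_of_lt_pi h0 (by linarith)
  have hcs : cos (w - π / 2) = sin (π - w) := by rw [Real.cos_sub_pi_div_two, Real.sin_pi_sub]
  have hgb : ∀ i y, y ∈ gball (x i) (w - π / 2) ↔ ‖y‖ = 1 ∧ sin (π - w) ≤ ⟪x i, y⟫ := by
    intro i y
    rw [gball_iff (hx i) (by linarith) (by linarith), hcs]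
  obtain ⟨o, ho, hoi⟩ := rcone_interior h0 h1 hx hxx
  set B := gball (x 0) (w - π / 2) ∪ gball (x 1) (w - π / 2) ∪ gball (x 2) (w - π / 2) with hB
  have hBm : ∀ y, y ∈ B ↔ ‖y‖ = 1 ∧ ∃ i, sin (π - w) ≤ ⟪x i, y⟫ := by
    intro y
    simp only [hB, Set.mem_union, hgb, Fin.exists_fin_succ, Fin.exists_fin_zero]
    simp
    tauto
  change sconv B = _
  have hop : ∀ y ∈ dual (reul (π - w) x), 0 < ⟪o, y⟫ := fun y hy =>
    inner_pos_of_interior hoi hy.1 fun c hc => dual_rcone hy hc hcr.le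
  apply Set.Subset.antisymm
  · apply Set.sInter_subset_of_mem
    refine ⟨⟨fun y hy => mem_us.2 hy.1, ⟨o, mem_us.2 ho, hop⟩, ?_⟩, ?_⟩
    · intro a ha b hb z hz
      have hab : a ≠ -b := by
        intro h
        have h1 := hop a ha
        have h2 := hop b hb
        rw [h, inner_neg_right] at h1
        linarith
      have hz1 := mem_us.1 hz.1
      obtain ⟨s, t, hs, ht, rfl⟩ := comb_of_seg ha.1 hb.1 hab hz
      refine ⟨hz1, fun u hu => ?_⟩
      rw [inner_add_right, inner_smul_right, inner_smul_right]
      have := ha.2 u hu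
      have := hb.2 u hu
      positivity
    · intro y hy
      obtain ⟨hy1, i, hi⟩ := (hBm y).1 hy
      refine ⟨hy1, fun u hu => ?_⟩
      have h2 : cos (π - w) ≤ ⟪u, x i⟫ := by rw [real_inner_comm]; exact hu.2 i
      have := inner_cos_add hu.1 (hx i) hy1 h0.le (by linarith : 0 ≤ w - π / 2) (by linarith) h2
        (by rw [hcs]; exact hi)
      rwa [show π - w + (w - π / 2) = π / 2 by ring, Real.cos_pi_div_two] at this
  · rintro y hy C ⟨hC, hBC⟩
    have hBc : IsCompact B := by
      have : B = Metric.sphere (0 : E 2) 1 ∩ ⋃ i, {y : E 2 | sin (π - w) ≤ ⟪x i, y⟫} := by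
        ext y; rw [hBm]; simp
      rw [this]
      exact (isCompact_sphere _ _).inter_right (isClosed_iUnion_of_finite fun i =>
        isClosed_le (by fun_prop) (by fun_prop))
    have hBne : B.Nonempty := ⟨x 0, (hBm _).2 ⟨hx 0, 0, by
      rw [us_inner_self (hx 0)]; exact Real.sin_le_one _⟩⟩
    obtain ⟨u, hu, hupos⟩ := hC.2.1
    have hB0 : (0 : E 2) ∉ convexHull ℝ B := by
      intro h
      have hsub : convexHull ℝ B ⊆ {y : E 2 | 0 < ⟪u, y⟫} := by
        refine convexHull_min (fun y hy => hupos y (hBC hy)) ?_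
        exact convex_halfSpace_gt (innerₗ (E 2) u).isLinear 0
      have : 0 < ⟪u, (0 : E 2)⟫ := hsub h
      simp at this
    have hN := coneOf_hull_cc hBc hBne hB0
    have hyN : y ∈ coneOf (convexHull ℝ B) := by
      apply hN.bipolar
      intro v hv
      rw [real_inner_comm]
      refine dual_rcone hy (fun i => ?_) hcr.le
      apply rcone_of_balls hsr hcr (hx i)
      intro a ha hai
      exact hv a ⟨1, zero_le_one, a, subset_convexHull ℝ B ((hBm a).2 ⟨ha, i, hai⟩), by simp⟩
    have hHC : convexHull ℝ B ⊆ coneOf C :=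
      convexHull_min (fun b hb => ⟨1, zero_le_one, b, hBC hb, by simp⟩) (coneOf_convex hC)
    obtain ⟨t, ht, h, hh, e⟩ := hyN
    obtain ⟨s, hs, k, hk, e'⟩ := hHC hh
    exact coneOf_unit (fun x hx => mem_us.1 (hC.1 hx)) hy.1
      ⟨t * s, mul_nonneg ht hs, k, hk, by rw [e, e', smul_smul]⟩

end
end SphericalPal

namespace SphericalPal

section
variable {r : ℝ} {K : Set (E 2)}

lemma cone_interior {p : E 2} (hK : SConvex K) (hp : p ∈ sInterior K) : p ∈ interior (coneOf K) := by
  obtain ⟨hpK, ε, hε, hb⟩ := hp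
  have hp1 := mem_us.1 (hK.1 hpK)
  have hp0 : p ≠ 0 := by rintro rfl; simp at hp1
  rw [mem_interior_iff_mem_nhds]
  have hcont : ContinuousAt (fun v => Real.arccos ⟪p, nz v⟫) p :=
    Real.continuous_arccos.continuousAt.comp (continuousAt_const.inner (nz_continuousAt hp0))
  have hlt : Real.arccos ⟪p, nz p⟫ < ε := by
    rw [nz_of_unit hp1, us_inner_self hp1, Real.arccos_one]; exact hε
  filter_upwards [hcont.eventually (gt_mem_nhds hlt), isOpen_compl_singleton.mem_nhds
    (show p ∈ ({0}ᶜ : Set (E 2)) from hp0)] with v hv hv0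
  exact ⟨‖v‖, norm_nonneg v, nz v, hb _ (mem_us.2 (nz_norm hv0)) hv, (norm_smul_nz v).symm⟩

lemma dual_cone {y v : E 2} (hy : y ∈ dual K) (hv : v ∈ coneOf K) : 0 ≤ ⟪v, y⟫ := by
  obtain ⟨t, ht, k, hk, rfl⟩ := hv
  rw [inner_smul_left]
  simp only [RCLike.conj_to_real]
  exact mul_nonneg ht (hy.2 k hk)

lemma breadth_eq {u v : E 2} (hu : ‖u‖ = 1) (hv : ‖v‖ = 1) (h1 : u ≠ v) (h2 : u ≠ -v) :
    breadth u v = Real.arccos (-⟪u, v⟫) := by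
  have huu := us_inner_self hu
  have hvv := us_inner_self hv
  have hvu : ⟪v, u⟫ = ⟪u, v⟫ := real_inner_comm _ _
  have hlt : 0 < 1 - ⟪u, v⟫ ^ 2 := by
    have a1 : ⟪u, v⟫ < 1 := by
      rw [inner_lt_one_iff_real_of_norm_eq_one hu hv]; exact h1
    have a2 : -1 < ⟪u, v⟫ := by
      have := (inner_lt_one_iff_real_of_norm_eq_one hu (by rw [norm_neg]; exact hv : ‖-v‖ = 1)).2 h2
      rw [inner_neg_right] at this
      linarith
    nlinarith
  have n1 : ‖(⟪u, v⟫ • u - v : E 2)‖ ^ 2 = 1 - ⟪u, v⟫ ^ 2 := by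
    rw [← real_inner_self_eq_norm_sq]
    simp only [inner_sub_left, inner_sub_right, inner_smul_left, inner_smul_right, huu, hvv, hvu,
      RCLike.conj_to_real]
    ring
  have n2 : ‖(⟪v, u⟫ • v - u : E 2)‖ ^ 2 = 1 - ⟪u, v⟫ ^ 2 := by
    rw [← real_inner_self_eq_norm_sq]
    simp only [inner_sub_left, inner_sub_right, inner_smul_left, inner_smul_right, huu, hvv, hvu,
      RCLike.conj_to_real]
    ring
  have n12 : ‖(⟪v, u⟫ • v - u : E 2)‖ = ‖(⟪u, v⟫ • u - v : E 2)‖ :=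
    (pow_left_inj₀ (norm_nonneg _) (norm_nonneg _) two_ne_zero).1 (by rw [n1, n2])
  have hn : ‖(⟪u, v⟫ • u - v : E 2)‖ ≠ 0 := by
    intro h; rw [h] at n1; linarith
  have hin : ⟪(⟪u, v⟫ • u - v : E 2), (⟪v, u⟫ • v - u : E 2)⟫ = -⟪u, v⟫ * (1 - ⟪u, v⟫ ^ 2) := by
    simp only [inner_sub_left, inner_sub_right, inner_smul_left, inner_smul_right, huu, hvv, hvu,
      RCLike.conj_to_real]
    ring
  rw [breadth, gdist, luneFaceCenter, luneFaceCenter, inner_smul_left, inner_smul_right, hin, n12, ← n1]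
  simp only [RCLike.conj_to_real]
  congr 1
  field_simp

lemma dual_touch (hKc : IsCompact K) (hKs : ∀ x ∈ K, ‖x‖ = 1) (hne : K.Nonempty) {u v : E 2}
    (hu : u ∈ dual K) (hv : v ∈ dual K) (h1 : u ≠ v) (h2 : u ≠ -v)
    (hmin : ∀ u' ∈ dual K, ⟪u, v⟫ ≤ ⟪u', v⟫) : ∃ x ∈ K, ⟪x, u⟫ = 0 := by
  by_contra! hcon
  obtain ⟨m, hm, hmm⟩ := hKc.exists_isMinOn hne (f := fun x => ⟪x, u⟫) (by fun_prop)
  have hδ : 0 < ⟪m, u⟫ := lt_of_le_of_ne (hu.2 m hm) (Ne.symm (hcon m hm))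
  set η := ⟪m, u⟫ with hη
  set c := ⟪u, v⟫ with hc
  have hc1 : c < 1 := by
    rw [hc, inner_lt_one_iff_real_of_norm_eq_one hu.1 hv.1]; exact h1
  have hc2 : -1 < c := by
    have := (inner_lt_one_iff_real_of_norm_eq_one hu.1 (by rw [norm_neg]; exact hv.1 : ‖-v‖ = 1)).2 h2
    rw [inner_neg_right] at this
    linarith
  set u' := u - η • v with hu'
  have hpos : ∀ x ∈ K, 0 ≤ ⟪x, u'⟫ := by
    intro x hx
    rw [hu', inner_sub_right, inner_smul_right]
    have a1 : η ≤ ⟪x, u⟫ := hmm hx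
    have a2 : ⟪x, v⟫ ≤ 1 := by
      have := real_inner_le_norm x v
      rwa [hKs x hx, hv.1, mul_one] at this
    have := mul_le_mul_of_nonneg_left a2 hδ.le
    linarith
  have hin : ⟪u', v⟫ = c - η := by
    rw [hu', inner_sub_left, inner_smul_left, us_inner_self hv.1]
    simp [hc]
  have hle : c * ‖u'‖ ≤ ⟪u', v⟫ := by
    by_cases h0 : u' = 0
    · rw [h0]; simp
    have hd : nz u' ∈ dual K := ⟨nz_norm h0, fun x hx => by
      rw [nz, inner_smul_right]
      exact mul_nonneg (inv_nonneg.2 (norm_nonneg _)) (hpos x hx)⟩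
    have := mul_le_mul_of_nonneg_right (hmin _ hd) (norm_nonneg u')
    have e : ⟪u', v⟫ = ‖u'‖ * ⟪nz u', v⟫ := by
      nth_rewrite 1 [← norm_smul_nz u']
      rw [inner_smul_left]; simp
    linarith
  rw [hin] at hle
  rcases le_or_gt 0 c with h | h
  · have b1 : 1 - η * c ≤ ‖u'‖ := by
      have := real_inner_le_norm u' u
      rw [hu.1, mul_one] at this
      refine le_trans (le_of_eq ?_) this
      rw [hu', inner_sub_left, inner_smul_left, us_inner_self hu.1, real_inner_comm, ← hc]; simp
    have b2 := mul_le_mul_of_nonneg_left b1 h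
    have b3 : 0 < η * (1 - c ^ 2) := mul_pos hδ (by nlinarith)
    linarith
  · have b1 : ‖u'‖ ≤ 1 + η := by
      have := norm_sub_le u (η • v)
      rwa [norm_smul, hu.1, hv.1, mul_one, Real.norm_of_nonneg hδ.le] at this
    have b2 := mul_le_mul_of_nonpos_left b1 h.le
    have b3 : 0 < η * (1 + c) := mul_pos hδ (by linarith)
    linarith

lemma dual_inner (hK : IsConvexBody K) {w : ℝ} (hw1 : π / 2 < w) (hw2 : w < π) (hKw : width K = w) :
    ∀ u ∈ dual K, ∀ v ∈ dual K, cos (π - w) ≤ ⟪u, v⟫ := by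
  intro u₀ hu₀ v₀ hv₀
  obtain ⟨hS, hKc, p, hp⟩ := hK
  have hKs : ∀ x ∈ K, ‖x‖ = 1 := fun x hx => mem_us.1 (hS.1 hx)
  have hne : K.Nonempty := ⟨p, hp.1⟩
  have hpi := cone_interior hS hp
  have hMc : IsCompact (dual K) := by
    refine Metric.isCompact_of_isClosed_isBounded (dual_closed K) ?_
    refine (Metric.isBounded_sphere (x := (0 : E 2)) (r := 1)).subset fun x hx => ?_
    simpa using hx.1
  obtain ⟨⟨u, v⟩, ⟨hu, hv⟩, hmin⟩ := (hMc.prod hMc).exists_isMinOn ⟨(u₀, v₀), hu₀, hv₀⟩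
    (f := fun q : E 2 × E 2 => ⟪q.1, q.2⟫) (by fun_prop)
  have hmin' : ∀ a ∈ dual K, ∀ b ∈ dual K, ⟪u, v⟫ ≤ ⟪a, b⟫ := fun a ha b hb =>
    hmin (show (a, b) ∈ dual K ×ˢ dual K from ⟨ha, hb⟩)
  refine le_trans ?_ (hmin' u₀ hu₀ v₀ hv₀)
  change u ∈ dual K at hu
  change v ∈ dual K at hv
  by_contra! hlt
  have h1 : u ≠ v := by
    rintro rfl
    rw [us_inner_self hu.1] at hlt
    linarith [Real.cos_le_one (π - w)]
  have hpu := inner_pos_of_interior hpi hu.1 fun c hc => dual_cone hu hc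
  have hpv := inner_pos_of_interior hpi hv.1 fun c hc => dual_cone hv hc
  have h2 : u ≠ -v := by
    rintro rfl
    rw [inner_neg_right] at hpu
    linarith
  obtain ⟨a, ha, hau⟩ := dual_touch hKc hKs hne hu hv h1 h2 fun u' hu' => hmin' u' hu' v hv
  obtain ⟨b, hb, hbv⟩ := dual_touch hKc hKs hne hv hu h1.symm (fun h => h2 (by rw [h, neg_neg]))
    fun v' hv' => by rw [real_inner_comm u v, real_inner_comm u v']; exact hmin' u hu v' hv'
  have hsup : IsSupportingLune K (-u) (-v) := by
    refine ⟨mem_us.2 (by rw [norm_neg]; exact hu.1), mem_us.2 (by rw [norm_neg]; exact hv.1),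
      fun h => h1 (neg_injective h), fun h => h2 (neg_injective h), ?_, ⟨a, ha, ?_⟩, ⟨b, hb, ?_⟩⟩
    · intro x hx
      exact ⟨hS.1 hx, by rw [inner_neg_right]; linarith [hu.2 x hx],
        by rw [inner_neg_right]; linarith [hv.2 x hx]⟩
    · exact ⟨hS.1 ha, by rw [inner_neg_right, hau, neg_zero],
        by rw [inner_neg_right]; linarith [hv.2 a ha]⟩
    · exact ⟨hS.1 hb, by rw [inner_neg_right, hbv, neg_zero],
        by rw [inner_neg_right]; linarith [hu.2 b hb]⟩
  have hwle : w ≤ breadth (-u) (-v) := by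
    rw [← hKw]
    refine csInf_le ⟨0, ?_⟩ ⟨-u, -v, hsup, rfl⟩
    rintro _ ⟨u, v, _, rfl⟩
    exact Real.arccos_nonneg _
  rw [breadth_eq (mem_us.1 hsup.1) (mem_us.1 hsup.2.1) hsup.2.2.1 hsup.2.2.2.1, inner_neg_neg,
    Real.arccos_neg] at hwle
  have hb := abs_le.1 (abs_real_inner_le_norm u v)
  rw [hu.1, hv.1, mul_one] at hb
  have := Real.cos_le_cos_of_nonneg_of_le_pi (Real.arccos_nonneg ⟪u, v⟫) (by linarith [Real.pi_pos])
    (by linarith : Real.arccos ⟪u, v⟫ ≤ π - w)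
  rw [Real.cos_arccos hb.1 hb.2] at this
  linarith

lemma dual_sub (hS : SConvex K) (hKc : IsCompact K) (hne : K.Nonempty) {D : Set (E 2)}
    (h : dual K ⊆ D) : dual D ⊆ K := by
  intro y hy
  refine coneOf_unit (fun x hx => mem_us.1 (hS.1 hx)) hy.1 ((hS.coneOf_isCC hKc hne).bipolar ?_)
  intro u hu
  by_cases h0 : u = 0
  · rw [h0, inner_zero_right]
  have hd : nz u ∈ dual K := ⟨nz_norm h0, fun x hx => by
      rw [nz, inner_smul_right]
      exact mul_nonneg (inv_nonneg.2 (norm_nonneg _)) (hu x ⟨1, zero_le_one, x, hx, by simp⟩)⟩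
  have := hy.2 _ (h hd)
  rw [← norm_smul_nz u, inner_smul_right, real_inner_comm]
  exact mul_nonneg (norm_nonneg _) this

end
end SphericalPal

namespace SphericalPal

section
variable {r : ℝ} {K : Set (E 2)}

lemma reg_basis (h0 : 0 < r) (h1 : r < π / 2) {x : Fin 3 → E 2} (hx : ∀ i, ‖x i‖ = 1)
    (hxx : ∀ i j, i ≠ j → ⟪x i, x j⟫ = cos r) : ∃ b : Module.Basis (Fin 3) ℝ (E 2), ∀ i, b i = x i := by
  have pp := Real.pi_pos
  have hc0 : 0 < cos r := Real.cos_pos_of_mem_Ioo ⟨by linarith, by linarith⟩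
  have hc1 : cos r < 1 := by
    rw [← Real.cos_zero]
    exact Real.cos_lt_cos_of_nonneg_of_le_pi le_rfl (by linarith) h0
  have hli : LinearIndependent ℝ x := by
    rw [Fintype.linearIndependent_iff]
    intro g hg
    rw [Fin.sum_univ_three] at hg
    have h : ∀ j, g 0 * ⟪x j, x 0⟫ + g 1 * ⟪x j, x 1⟫ + g 2 * ⟪x j, x 2⟫ = 0 := by
      intro j
      have := congrArg (fun z => ⟪x j, z⟫) hg
      simpa only [inner_add_right, inner_smul_right, inner_zero_right] using this
    have e0 := h 0
    have e1 := h 1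
    have e2 := h 2
    rw [us_inner_self (hx 0), hxx 0 1 (by decide), hxx 0 2 (by decide)] at e0
    rw [us_inner_self (hx 1), hxx 1 0 (by decide), hxx 1 2 (by decide)] at e1
    rw [us_inner_self (hx 2), hxx 2 0 (by decide), hxx 2 1 (by decide)] at e2
    have hS : g 0 + g 1 + g 2 = 0 := by
      have : (1 + 2 * cos r) * (g 0 + g 1 + g 2) = 0 := by linear_combination e0 + e1 + e2
      rcases mul_eq_zero.1 this with h | h
      · linarith
      · exact h
    have z : ∀ t, (1 - cos r) * t + cos r * (g 0 + g 1 + g 2) = 0 → t = 0 := by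
      intro t ht
      rw [hS, mul_zero, add_zero] at ht
      rcases mul_eq_zero.1 ht with h | h
      · linarith
      · exact h
    intro i
    fin_cases i
    · exact z (g 0) (by linear_combination e0)
    · exact z (g 1) (by linear_combination e1)
    · exact z (g 2) (by linear_combination e2)
  exact ⟨basisOfLinearIndependentOfCardEqFinrank hli (by simp), fun i => by simp⟩

lemma reg_isom (h0 : 0 < r) (h1 : r < π / 2) {x y : Fin 3 → E 2} (hx : ∀ i, ‖x i‖ = 1)
    (hxx : ∀ i j, i ≠ j → ⟪x i, x j⟫ = cos r) (hy : ∀ i, ‖y i‖ = 1)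
    (hyy : ∀ i j, i ≠ j → ⟪y i, y j⟫ = cos r) : ∃ f : E 2 ≃ₗᵢ[ℝ] E 2, ∀ i, f (x i) = y i := by
  obtain ⟨b, hb⟩ := reg_basis h0 h1 hx hxx
  obtain ⟨c, hc⟩ := reg_basis h0 h1 hy hyy
  set g : E 2 ≃ₗ[ℝ] E 2 := b.equiv c (Equiv.refl _) with hg
  have hgx : ∀ i, g (x i) = y i := by
    intro i
    rw [← hb, ← hc, hg, Module.Basis.equiv_apply]; rfl
  have key : (innerₗ (E 2)).compl₁₂ g.toLinearMap g.toLinearMap = innerₗ (E 2) := by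
    refine LinearMap.ext_basis b b fun i j => ?_
    change ⟪g (b i), g (b j)⟫ = ⟪b i, b j⟫
    rw [hb, hb, hgx, hgx]
    by_cases hij : i = j
    · rw [hij, us_inner_self (hx j), us_inner_self (hy j)]
    · rw [hxx i j hij, hyy i j hij]
  refine ⟨g.isometryOfInner fun a b => ?_, fun i => hgx i⟩
  exact LinearMap.congr_fun (LinearMap.congr_fun key a) b

lemma reg_map {x y : Fin 3 → E 2} (f : E 2 ≃ₗᵢ[ℝ] E 2) (hf : ∀ i, f (x i) = y i) :
    f '' dual (reul r x) ⊆ dual (reul r y) := by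
  rintro _ ⟨z, hz, rfl⟩
  refine ⟨by rw [f.norm_map]; exact hz.1, fun u hu => ?_⟩
  have hu' : f.symm u ∈ reul r x := ⟨by rw [f.symm.norm_map]; exact hu.1, fun i => by
    rw [← f.inner_map_map, hf, f.apply_symm_apply]; exact hu.2 i⟩
  have := hz.2 _ hu'
  rwa [← f.inner_map_map, f.apply_symm_apply] at this

lemma reg_map_eq {x y : Fin 3 → E 2} (f : E 2 ≃ₗᵢ[ℝ] E 2) (hf : ∀ i, f (x i) = y i) :
    f '' dual (reul r x) = dual (reul r y) := by
  refine Set.Subset.antisymm (reg_map f hf) fun z hz => ?_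
  have := reg_map (r := r) f.symm (fun i => by rw [← hf, f.symm_apply_apply] : ∀ i, f.symm (y i) = x i)
    ⟨z, hz, rfl⟩
  exact ⟨f.symm z, this, f.apply_symm_apply z⟩

lemma reg_pairs {x : Fin 3 → E 2} {c : ℝ} (h01 : ⟪x 0, x 1⟫ = c) (h12 : ⟪x 1, x 2⟫ = c)
    (h02 : ⟪x 0, x 2⟫ = c) : ∀ i j, i ≠ j → ⟪x i, x j⟫ = c := by
  intro i j hij
  fin_cases i <;> fin_cases j <;> simp at hij ⊢
  · exact h01
  · exact h02
  · rw [real_inner_comm]; exact h01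
  · exact h12
  · rw [real_inner_comm]; exact h02
  · rw [real_inner_comm]; exact h12

theorem main_fin {w : ℝ} (hw1 : π / 2 < w) (hw2 : w < π) (hK : IsConvexBody K) (hKw : width K = w)
    {x : Fin 3 → E 2} (hx : ∀ i, ‖x i‖ = 1) (hxx : ∀ i j, i ≠ j → ⟪x i, x j⟫ = cos (π - w)) :
    area (dual (reul (π - w) x)) ≤ area K ∧
    (area K = area (dual (reul (π - w) x)) ↔ Congruent K (dual (reul (π - w) x))) := by
  have pp := Real.pi_pos
  have h0 : 0 < π - w := by linarith
  have h1 : π - w < π / 2 := by linarith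
  set r := π - w with hr
  obtain ⟨κ, hκ, harea⟩ := exists_kappa
  obtain ⟨hU, hUm⟩ := reul_comp h0 h1 hx hxx
  have hin := dual_inner hK hw1 hw2 hKw
  have hK' := hK
  obtain ⟨hS, hKc, p, hp⟩ := hK'
  have hne : K.Nonempty := ⟨p, hp.1⟩
  obtain ⟨D, hMD, hD⟩ := exists_comp h0 h1 (M := dual K) (fun y hy => hy.1) hin
  have hLK : dual D ⊆ K := dual_sub hS hKc hne hMD
  have aK := harea K hKc.isClosed.measurableSet hS.1
  have aP := harea (dual (reul r x)) (dual_closed _).measurableSet fun y hy => mem_us.2 hy.1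
  have hmono := sm_mono (dual_closed D).measurableSet hKc.isClosed.measurableSet fun u _ h => hLK h
  have hdD := hD.area_dual
  have hdU := hU.area_dual
  have htan : 0 < tan (r / 2) := Real.tan_pos_of_pos_of_lt_pi_div_two (by linarith) (by linarith)
  obtain ⟨ψ, hψ0, hψ1, hl, hc⟩ := hD.lower
  have hanti : gG r (π / 3) ≤ gG r ψ :=
    (gG_anti h0 h1).antitoneOn ⟨hψ0, hψ1⟩ ⟨by positivity, le_rfl⟩ hψ1
  have hDU : (sm (reul r x)).toReal ≤ (sm D).toReal := by linarith
  have hdiff : (sm (dual D)).toReal - (sm (dual (reul r x))).toReal =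
      ((sm D).toReal - (sm (reul r x)).toReal) * tan (r / 2) := by rw [hdD, hdU]; ring
  have hLP : (sm (dual (reul r x))).toReal ≤ (sm (dual D)).toReal := by
    have := mul_nonneg (sub_nonneg.2 hDU) htan.le
    linarith
  refine ⟨?_, ?_, ?_⟩
  · rw [aK, aP]
    exact mul_le_mul_of_nonneg_left (hLP.trans hmono) hκ.le
  · intro he
    rw [aK, aP] at he
    have he' := mul_left_cancel₀ hκ.ne' he
    have hz : ((sm D).toReal - (sm (reul r x)).toReal) * tan (r / 2) = 0 := by linarith
    have hDe : (sm D).toReal = (sm (reul r x)).toReal := by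
      rcases mul_eq_zero.1 hz with h | h
      · linarith
      · exact absurd h htan.ne'
    have hψ : ψ = π / 3 := by
      by_contra hne'
      have := gG_anti h0 h1 ⟨hψ0, hψ1⟩ ⟨by positivity, le_rfl⟩ (lt_of_le_of_ne hψ1 hne')
      linarith
    obtain ⟨c₁, m1, c₂, m2, c₃, m3, e12, e23, e13⟩ := hc hψ
    set c : Fin 3 → E 2 := ![c₁, c₂, c₃] with hcd
    have hcD : ∀ i, c i ∈ D := by
      intro i; fin_cases i
      · exact m1
      · exact m2
      · exact m3
    have hc1 : ∀ i, ‖c i‖ = 1 := fun i => hD.norm (hcD i)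
    have hcc : ∀ i j, i ≠ j → ⟪c i, c j⟫ = cos r := reg_pairs e12 e23 e13
    obtain ⟨hV, -⟩ := reul_comp h0 h1 hc1 hcc
    have hDV : D ⊆ reul r c := fun y hy => ⟨hD.norm hy, fun i => hD.inner (hcD i) hy⟩
    have hDe2 : D = reul r c := by
      refine Set.Subset.antisymm hDV fun y hy => ?_
      rw [hD.mem_iff]
      exact ⟨hy.1, fun d hd => hV.inner (hDV hd) hy⟩
    have hcone := hS.coneOf_isCC hKc hne
    have hKu : ∀ y ∈ K, ‖y‖ = 1 := fun y hy => mem_us.1 (hS.1 hy)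
    have hKin : ∀ y ∈ K, y ∈ coneOf K := fun y hy => ⟨1, zero_le_one, y, hy, by simp⟩
    have hsmC : (sm (coneOf K)).toReal = (sm K).toReal := by
      rw [sm_congr hcone.closed.measurableSet hKc.isClosed.measurableSet]
      intro u hu
      exact ⟨coneOf_unit hKu hu, hKin u⟩
    have hfull := full_of_sm (dual_closed D) hcone ⟨p, cone_interior hS hp⟩
      (fun u _ h => hKin u (hLK h)) (by linarith)
    have hKL : K = dual D :=
      Set.Subset.antisymm (fun y hy => hfull y (hKu y hy) (hKin y hy)) hLK
    obtain ⟨f, hf⟩ := reg_isom h0 h1 hc1 hcc hx hxx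
    refine ⟨f, ?_⟩
    rw [hKL, hDe2]
    exact reg_map_eq f hf
  · rintro ⟨f, hf⟩
    rw [← hf, area, area, hm_isom]

end
end SphericalPal

/-- the isominwidth inequality for `π/2 < w < π`, the minimizer being the
convex hull `U°_{π-w}` of three balls of radius `w - π/2` centered at the vertices of a
regular triangle of side length `π - w`; equality iff congruence. -/
theorem pal_isominwidth_large (w : ℝ) (hw1 : π / 2 < w) (hw2 : w < π)
    (K : Set (E 2)) (hK : IsConvexBody K) (hKw : width K = w)
    (x₁ x₂ x₃ : E 2) (hx : IsRegularCenters x₁ x₂ x₃ (π - w)) :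
    area (polarReuleaux x₁ x₂ x₃ w) ≤ area K ∧
      (area K = area (polarReuleaux x₁ x₂ x₃ w) ↔ Congruent K (polarReuleaux x₁ x₂ x₃ w)) := by
  obtain ⟨m1, m2, m3, d12, d23, d13⟩ := hx
  obtain ⟨x, rfl, rfl, rfl⟩ : ∃ x : Fin 3 → E 2, x 0 = x₁ ∧ x 1 = x₂ ∧ x 2 = x₃ :=
    ⟨![x₁, x₂, x₃], rfl, rfl, rfl⟩
  have hn : ∀ i, ‖x i‖ = 1 := by
    intro i; fin_cases i
    · exact mem_us.1 m1
    · exact mem_us.1 m2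
    · exact mem_us.1 m3
  have hd : ∀ a b : E 2, ‖a‖ = 1 → ‖b‖ = 1 → gdist a b = π - w → ⟪a, b⟫ = cos (π - w) := by
    intro a b ha hb h
    have hb' := abs_le.1 (abs_real_inner_le_norm a b)
    rw [ha, hb, mul_one] at hb'
    rw [← h, gdist, Real.cos_arccos hb'.1 hb'.2]
  have hxx : ∀ i j, i ≠ j → ⟪x i, x j⟫ = cos (π - w) :=
    reg_pairs (hd _ _ (hn 0) (hn 1) d12) (hd _ _ (hn 1) (hn 2) d23) (hd _ _ (hn 0) (hn 2) d13)
  rw [polar_eq hw1 hw2 hn hxx]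
  exact main_fin hw1 hw2 hK hKw hn hxx
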